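/- Let h be a homeomorphism of a surface M. If every loop in M is freely homotopic to its image under h, then h acts trivially on π₁(M): for some (hence any) basepoint x₀ ∈ M there is a path α from x₀ to h(x₀) such that the isomorphism π₁(M,x₀) → π₁(M,h(x₀)) induced by h coincides with γ ↦ α ⋆ γ ⋆ α⁻¹; equivalently, h lifts to a homeomorphism of the universal cover of M commuting with all deck transformations. -/

import Mathlib

open unitInterval

/-- A surface: connected, Hausdorff, second-countable, every point has an open
neighbourhood homeomorphic to `ℝ²`. -/
def IsSurface (S : Type*) [TopologicalSpace S] : Prop :=
  ConnectedSpace S ∧ T2Space S ∧ SecondCountableTopology S ∧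
    ∀ x : S, ∃ U : Set S, IsOpen U ∧ x ∈ U ∧ Nonempty (U ≃ₜ (ℝ × ℝ))

/-- A free homotopy between two loops. -/
def FreelyHomotopic {X Y : Type*} [TopologicalSpace X] [TopologicalSpace Y]
    (γ γ' : X → Y) : Prop :=
  ∃ H : X × unitInterval → Y, Continuous H ∧ (∀ s, H (s, 0) = γ s) ∧ ∀ s, H (s, 1) = γ' s

namespace SurfacePi1
open FreeGroup hiding map_mul map_inv map_one norm_mul_le IsReduced

/-- Every pointwise-inner endomorphism is inner. -/
def PointwiseInnerInner (G : Type*) [Group G] : Prop :=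
  ∀ φ : G →* G, (∀ g, IsConj g (φ g)) → ∃ u : G, ∀ g, φ g = u * g * u⁻¹

section FreeGroupLemmas
variable {ι : Type*} [DecidableEq ι]

theorem norm_pow_le_of_isConj {x y : FreeGroup ι} (h : IsConj y x) :
    ∃ C : ℕ, ∀ n : ℕ, (x ^ n).norm ≤ C + n * y.norm := by
  obtain ⟨u, rfl⟩ := isConj_iff.1 h
  refine ⟨2 * u.norm, fun n => ?_⟩
  have h1 : (y ^ n).norm ≤ n * y.norm := by
    induction n with
    | zero => simp
    | succ n ih =>
      rw [pow_succ]
      calc _ ≤ _ := FreeGroup.norm_mul_le _ _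
        _ ≤ _ := by nlinarith
  rw [conj_pow]
  calc _ ≤ _ := FreeGroup.norm_mul_le _ _
    _ ≤ _ := Nat.add_le_add_right (FreeGroup.norm_mul_le _ _) _
    _ ≤ _ := by rw [norm_inv_eq]; omega

theorem norm_mk_pow_of_isCyclicallyReduced {L : List (ι × Bool)} (h : IsCyclicallyReduced L)
    (n : ℕ) : ((FreeGroup.mk L) ^ n).norm = n * L.length := by
  have h2 := (h.flatten_replicate n).isReduced
  have : (FreeGroup.mk L) ^ n = FreeGroup.mk (List.replicate n L).flatten := by
    induction n with
    | zero => simp; rfl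
    | succ n ih =>
      rw [pow_succ', ih (h.flatten_replicate n).isReduced, List.replicate_succ,
        List.flatten_cons, FreeGroup.mul_mk]
  rw [this, FreeGroup.norm, toWord_mk, h2.reduce_eq]
  simp

theorem length_le_of_isConj_mk {L : List (ι × Bool)} (h : IsCyclicallyReduced L)
    {y : FreeGroup ι} (hc : IsConj y (FreeGroup.mk L)) : L.length ≤ y.norm := by
  obtain ⟨C, hC⟩ := norm_pow_le_of_isConj hc
  by_contra! hlt
  have := hC (C + 1)
  rw [norm_mk_pow_of_isCyclicallyReduced h] at this
  nlinarith

theorem isReduced_invRev {w : List (ι × Bool)} (h : FreeGroup.IsReduced w) : FreeGroup.IsReduced (invRev w) := by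
  rw [isReduced_iff_reduce_eq, reduce_invRev, h.reduce_eq]

theorem isCyclicallyReduced_aux {i j : ι} (hij : i ≠ j) (β : Bool) {w : List (ι × Bool)}
    (hw : FreeGroup.IsReduced w) (h1 : ∀ p ∈ w.head?, p.1 ≠ i) (h2 : ∀ p ∈ w.getLast?, p.1 ≠ j) :
    IsCyclicallyReduced ((i, true) :: (w ++ (j, β) :: invRev w)) := by
  have h2' : ∀ p ∈ (invRev w).head?, p.1 ≠ j := by
    intro p hp
    simp only [invRev, List.head?_reverse, List.getLast?_map] at hp
    obtain ⟨q, hq, rfl⟩ := Option.mem_map.1 hp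
    exact h2 q hq
  have h1' : ∀ p ∈ (invRev w).getLast?, p.1 ≠ i := by
    intro p hp
    simp only [invRev, List.getLast?_reverse, List.head?_map] at hp
    obtain ⟨q, hq, rfl⟩ := Option.mem_map.1 hp
    exact h1 q hq
  have hw' := isReduced_invRev hw
  rw [isCyclicallyReduced_iff]
  refine ⟨?_, ?_⟩
  · unfold FreeGroup.IsReduced at *
    rw [List.isChain_cons, List.isChain_append, List.isChain_cons]
    refine ⟨?_, hw, ⟨?_, hw'⟩, ?_⟩
    · intro y hy h
      cases w with
      | nil => simp at hy; subst hy; exact absurd h hij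
      | cons p w => simp at hy; subst hy; exact absurd h.symm (h1 _ (by simp))
    · intro y hy h
      exact absurd h.symm (h2' y hy)
    · intro x hx y hy h
      simp at hy; subst hy
      exact absurd h (h2 x hx)
  · intro x hx y hy h
    simp only [List.head?_cons, Option.mem_def, Option.some.injEq] at hy
    subst hy
    cases hr : (invRev w).getLast? with
    | none =>
      simp only [List.getLast?_eq_none_iff] at hr
      have : w = [] := by
        have := congrArg List.length hr
        simp at this
        exact this
      subst this
      simp at hx
      subst hx
      exact absurd h.symm hij
    | some p =>
      have : x = p := by
        rw [← List.cons_append, List.getLast?_append] at hx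
        simp [List.getLast?_cons, hr] at hx
        exact hx.symm
      subst this
      exact absurd h (h1' _ hr)

theorem conj_letter_of_isConj_mul {i j : ι} (hij : i ≠ j) (β : Bool) (g : FreeGroup ι)
    (h : IsConj (of i * FreeGroup.mk [(j, β)]) (of i * (g * FreeGroup.mk [(j, β)] * g⁻¹))) :
    ∃ k : ℤ, g * of j * g⁻¹ = of i ^ k * of j * (of i ^ k)⁻¹ := by
  let S : Set (FreeGroup ι) := {g' | ∃ k l : ℤ, g' = of i ^ k * g * of j ^ l}
  have hS : S.Nonempty := ⟨g, 0, 0, by simp⟩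
  obtain ⟨g', ⟨k, l, hg'⟩, hmin⟩ :
      ∃ g' ∈ S, ∀ g'' ∈ S, g'.norm ≤ g''.norm := by
    obtain ⟨m, hm, hm'⟩ := WellFounded.has_min (measure (FreeGroup.norm (α := ι))).wf S hS
    exact ⟨m, hm, fun x hx => not_lt.1 (hm' x hx)⟩
  obtain ⟨e, he⟩ : ∃ e : ℤ, FreeGroup.mk [(j, β)] = of j ^ e := by
    cases β
    · exact ⟨-1, by simp [of, FreeGroup.inv_mk, invRev]⟩
    · exact ⟨1, by simp [of]⟩
  have hleft : ∀ m : ℤ, of i ^ m * g' ∈ S := fun m => ⟨m + k, l, by rw [hg', zpow_add]; group⟩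
  have hright : ∀ m : ℤ, g' * of j ^ m ∈ S := fun m => ⟨k, l + m, by rw [hg', zpow_add]; group⟩
  have hw := isReduced_toWord (x := g')
  have h1 : ∀ p ∈ g'.toWord.head?, p.1 ≠ i := by
    rintro ⟨p, b⟩ hp rfl
    obtain ⟨t, ht⟩ : ∃ t, g'.toWord = (p, b) :: t := by
      cases hh : g'.toWord with
      | nil => simp [hh] at hp
      | cons q t => simp [hh] at hp; exact ⟨t, by rw [hp]⟩
    have hg : g' = FreeGroup.mk [(p, b)] * FreeGroup.mk t := by
      rw [FreeGroup.mul_mk, List.singleton_append, ← ht, mk_toWord]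
    have hn : g'.norm = t.length + 1 := by rw [FreeGroup.norm, ht]; simp
    have key : ∃ m : ℤ, of p ^ m * g' = FreeGroup.mk t := by
      cases b
      · exact ⟨1, by rw [hg, zpow_one]; exact mul_inv_cancel_left (of p) _⟩
      · exact ⟨-1, by rw [hg, ← of]; group⟩
    obtain ⟨m, hm⟩ := key
    have := hmin _ (hleft m)
    rw [hm] at this
    have := this.trans norm_mk_le
    omega
  have h2 : ∀ p ∈ g'.toWord.getLast?, p.1 ≠ j := by
    rintro ⟨p, b⟩ hp rfl
    obtain ⟨t, ht⟩ : ∃ t, g'.toWord = t ++ [(p, b)] := by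
      obtain ⟨t, ht⟩ := List.getLast?_eq_some_iff.1 hp
      exact ⟨t, ht⟩
    have hg : g' = FreeGroup.mk t * FreeGroup.mk [(p, b)] := by
      rw [FreeGroup.mul_mk, ← ht, mk_toWord]
    have hn : g'.norm = t.length + 1 := by rw [FreeGroup.norm, ht]; simp
    have key : ∃ m : ℤ, g' * of p ^ m = FreeGroup.mk t := by
      cases b
      · exact ⟨1, by rw [hg, zpow_one]; exact inv_mul_cancel_right _ (of p)⟩
      · exact ⟨-1, by rw [hg, ← of]; group⟩
    obtain ⟨m, hm⟩ := key
    have := hmin _ (hright m)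
    rw [hm] at this
    have := this.trans norm_mk_le
    omega
  have hcyc := isCyclicallyReduced_aux hij β hw h1 h2
  have hmk : FreeGroup.mk ((i, true) :: (g'.toWord ++ (j, β) :: invRev g'.toWord))
      = of i ^ k * (of i * (g * FreeGroup.mk [(j, β)] * g⁻¹)) * (of i ^ k)⁻¹ := by
    have : FreeGroup.mk ((i, true) :: (g'.toWord ++ (j, β) :: invRev g'.toWord))
      = of i * g' * FreeGroup.mk [(j, β)] * g'⁻¹ := by
      conv_rhs => rw [← mk_toWord (x := g'), FreeGroup.inv_mk]
      simp [of, FreeGroup.mul_mk]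
    rw [this, hg', he]
    group
  have hconj : IsConj (of i * FreeGroup.mk [(j, β)])
      (FreeGroup.mk ((i, true) :: (g'.toWord ++ (j, β) :: invRev g'.toWord))) := by
    rw [hmk]
    exact h.trans (isConj_iff.2 ⟨of i ^ k, rfl⟩)
  have hlen := length_le_of_isConj_mk hcyc hconj
  have hle : (of i * FreeGroup.mk [(j, β)]).norm ≤ 2 := by
    rw [of, FreeGroup.mul_mk]
    exact norm_mk_le
  have hnil : g'.toWord = [] := by
    simp only [List.length_cons, List.length_append, invRev_length] at hlen
    exact List.length_eq_zero_iff.1 (by omega)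
  have hone : g' = 1 := toWord_eq_nil_iff.1 hnil
  have hgeq : g = of i ^ (-k) * of j ^ (-l) := by
    rw [hone] at hg'
    calc g = (of i ^ k)⁻¹ * (of i ^ k * g * of j ^ l) * (of j ^ l)⁻¹ := by group
      _ = _ := by rw [← hg']; group
  refine ⟨-k, ?_⟩
  rw [hgeq]; group

end FreeGroupLemmas

/-- doubling permutation of `ℚ` -/
noncomputable def dilate : Equiv.Perm ℚ := Equiv.mulLeft₀ 2 two_ne_zero

theorem dilate_zpow_apply (k : ℤ) (x : ℚ) : (dilate ^ k) x = 2 ^ k * x := by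
  induction k with
  | zero => simp
  | succ n ih => rw [zpow_add_one₀ two_ne_zero, add_comm, zpow_add, Equiv.Perm.mul_apply, ih]; simp [dilate]; ring
  | pred n ih =>
    have : dilate ((dilate ^ (-(n:ℤ) - 1)) x) = 2 ^ (-(n:ℤ)) * x := by
      rw [← ih, ← Equiv.Perm.mul_apply, ← zpow_one_add]; congr 2; ring
    have h2 : ∀ y, dilate y = 2 * y := fun y => rfl
    rw [h2] at this
    rw [zpow_sub_one₀ two_ne_zero]
    linarith

theorem inner_of_letters {ι : Type*} (φ : FreeGroup ι →* FreeGroup ι)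
    (h1 : ∀ i, IsConj (of i) (φ (of i)))
    (h2 : ∀ i j, i ≠ j → IsConj (of i * of j) (φ (of i * of j)) ∨
      IsConj (of i * (of j)⁻¹) (φ (of i * (of j)⁻¹))) :
    ∃ u : FreeGroup ι, ∀ g, φ g = u * g * u⁻¹ := by
  classical
  have main : ∀ ψ : FreeGroup ι →* FreeGroup ι, (∀ i, IsConj (of i) (ψ (of i))) →
      (∀ i j, i ≠ j → IsConj (of i * of j) (ψ (of i * of j)) ∨
      IsConj (of i * (of j)⁻¹) (ψ (of i * (of j)⁻¹))) → ∀ i j, i ≠ j → ψ (of i) = of i →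
      ∃ k : ℤ, ψ (of j) = of i ^ k * of j * (of i ^ k)⁻¹ := by
    intro ψ h1 h2 i j hij hi
    obtain ⟨g, hg⟩ := isConj_iff.1 (h1 j)
    rw [← hg]
    rcases h2 i j hij with h | h
    · apply conj_letter_of_isConj_mul hij true g
      rw [← FreeGroup.of]
      rwa [map_mul, hi, ← hg] at h
    · apply conj_letter_of_isConj_mul hij false g
      have : FreeGroup.mk [(j, false)] = (of j)⁻¹ := by simp [of, FreeGroup.inv_mk, invRev]
      rw [this]
      rw [map_mul, hi, map_inv, ← hg] at h
      convert h using 2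
      group
  by_cases hne : ∃ i j : ι, i ≠ j
  · obtain ⟨i, j, hij⟩ := hne
    obtain ⟨u, hu⟩ := isConj_iff.1 (h1 i)
    have step : ∀ (ψ : FreeGroup ι →* FreeGroup ι) (u : FreeGroup ι) (x), IsConj x (ψ x) →
        IsConj x (((MulAut.conj u⁻¹).toMonoidHom.comp ψ) x) := by
      intro ψ u x h
      exact h.trans (isConj_iff.2 ⟨u⁻¹, by simp⟩)
    set φ1 := (MulAut.conj u⁻¹).toMonoidHom.comp φ with hφ1
    have a1 : ∀ i, IsConj (of i) (φ1 (of i)) := fun i => step _ _ _ (h1 i)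
    have a2 : ∀ i j, i ≠ j → IsConj (of i * of j) (φ1 (of i * of j)) ∨
      IsConj (of i * (of j)⁻¹) (φ1 (of i * (of j)⁻¹)) :=
      fun i j h => (h2 i j h).imp (step _ _ _) (step _ _ _)
    have ai : φ1 (of i) = of i := by simp [hφ1, ← hu]; group
    obtain ⟨k, hk⟩ := main φ1 a1 a2 i j hij ai
    set v := of i ^ k with hv
    set φ2 := (MulAut.conj v⁻¹).toMonoidHom.comp φ1 with hφ2
    have b1 : ∀ i, IsConj (of i) (φ2 (of i)) := fun i => step _ _ _ (a1 i)
    have b2 : ∀ i j, i ≠ j → IsConj (of i * of j) (φ2 (of i * of j)) ∨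
      IsConj (of i * (of j)⁻¹) (φ2 (of i * (of j)⁻¹)) :=
      fun i j h => (a2 i j h).imp (step _ _ _) (step _ _ _)
    have bi : φ2 (of i) = of i := by
      have : φ2 (of i) = v⁻¹ * of i * v := by simp [hφ2, ai]
      rw [this, hv]; group
    have bj : φ2 (of j) = of j := by
      have : φ2 (of j) = v⁻¹ * φ1 (of j) * v := by simp [hφ2]
      rw [this, hk]; group
    have hid : ∀ c, φ2 (of c) = of c := by
      intro c
      by_cases hci : c = i
      · rw [hci, bi]
      by_cases hcj : c = j
      · rw [hcj, bj]
      obtain ⟨k, hk⟩ := main φ2 b1 b2 i c (Ne.symm hci) bi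
      obtain ⟨l, hl⟩ := main φ2 b1 b2 j c (Ne.symm hcj) bj
      let f : FreeGroup ι →* Equiv.Perm ℚ := FreeGroup.lift fun x =>
        if x = i then dilate else if x = c then Equiv.addRight 1 else 1
      have fi : f (of i) = dilate := by simp [f]
      have fj : f (of j) = 1 := by simp [f, hij.symm, Ne.symm hcj]
      have fc : f (of c) = Equiv.addRight 1 := by simp [f, hci]
      have hkl : f (of i ^ k * of c * (of i ^ k)⁻¹) = f (of j ^ l * of c * (of j ^ l)⁻¹) := by
        rw [← hk, ← hl]
      simp only [map_mul, map_inv, map_zpow, fi, fj, fc, one_zpow, one_mul, inv_one, mul_one] at hkl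
      have := congrArg (fun p : Equiv.Perm ℚ => p 0) hkl
      simp only [← zpow_neg, Equiv.Perm.mul_apply, dilate_zpow_apply] at this
      simp at this
      have hk0 : k = 0 := by
        rcases (zpow_eq_one_iff_right₀ (by norm_num : (0:ℚ) ≤ 2) (by norm_num)).1 this with h
        exact h
      rw [hk, hk0]; simp
    have hid' : φ2 = MonoidHom.id _ := FreeGroup.ext_hom _ _ (by simpa using hid)
    refine ⟨u * v, fun g => ?_⟩
    have := DFunLike.congr_fun hid' g
    simp [hφ2, hφ1] at this
    conv_rhs => rw [← this]
    group
  · push Not at hne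
    by_cases hι : Nonempty ι
    · obtain ⟨i⟩ := hι
      obtain ⟨u, hu⟩ := isConj_iff.1 (h1 i)
      refine ⟨u, fun g => ?_⟩
      have : φ = (MulAut.conj u).toMonoidHom := FreeGroup.ext_hom _ _ (fun a => by
        rw [hne a i, ← hu]; simp)
      rw [this]; simp
    · rw [not_nonempty_iff] at hι
      exact ⟨1, fun g => by rw [Subsingleton.elim (φ g) 1, Subsingleton.elim g 1]; simp⟩

universe u

theorem pointwiseInnerInner_of_comm {G : Type*} [Group G] (h : ∀ x y : G, x * y = y * x) :
    PointwiseInnerInner G := fun φ hφ => ⟨1, fun g => by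
  obtain ⟨c, hc⟩ := isConj_iff.1 (hφ g)
  rw [← hc, h c g]; simp⟩

/-- It suffices to treat endomorphisms fixing a given element. -/
theorem pointwiseInnerInner_of_fixed {G : Type*} [Group G] (x : G)
    (h : ∀ φ : G →* G, (∀ g, IsConj g (φ g)) → φ x = x → ∃ u : G, ∀ g, φ g = u * g * u⁻¹) :
    PointwiseInnerInner G := by
  intro φ hφ
  obtain ⟨u, hu⟩ := isConj_iff.1 (hφ x)
  obtain ⟨v, hv⟩ := h ((MulAut.conj u⁻¹).toMonoidHom.comp φ)
    (fun g => (hφ g).trans (isConj_iff.2 ⟨u⁻¹, by simp⟩)) (by simp [← hu, mul_assoc])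
  refine ⟨u * v, fun g => ?_⟩
  have := hv g
  simp at this
  calc φ g = u * (u⁻¹ * φ g * u) * u⁻¹ := by group
    _ = _ := by rw [this]; group

theorem eq_one_of_commute_of_nontrivial {ι : Type*} {i j : ι} (hij : i ≠ j) (z : FreeGroup ι)
    (hz : ∀ g, g * z = z * g) : z = 1 := by
  classical
  by_contra hne
  have hw : FreeGroup.IsReduced z.toWord := isReduced_toWord
  have hne' : z.toWord ≠ [] := fun h => hne (toWord_eq_nil_iff.1 h)
  obtain ⟨⟨p, β⟩, t, hpt⟩ := List.exists_cons_of_ne_nil hne'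
  obtain ⟨⟨q, γ⟩, hq⟩ : ∃ x, z.toWord.getLast? = some x :=
    ⟨_, List.getLast?_eq_some_getLast hne'⟩
  obtain ⟨k, hk⟩ : ∃ k, k ≠ p := by
    by_cases h : i = p
    · exact ⟨j, h ▸ hij.symm⟩
    · exact ⟨i, h⟩
  have hred : FreeGroup.IsReduced ((k, !γ) :: (z.toWord ++ [(k, γ)])) := by
    unfold FreeGroup.IsReduced at *
    rw [List.isChain_cons, List.isChain_append]
    refine ⟨?_, hw, by simp, ?_⟩
    · intro y hy h
      rw [hpt] at hy; simp at hy; subst hy; exact absurd h hk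
    · intro x hx y hy h
      rw [hq] at hx; simp at hx hy; subst hx hy; rfl
  have h1 : FreeGroup.mk ((k, !γ) :: (z.toWord ++ [(k, γ)])) = z := by
    have : FreeGroup.mk ((k, !γ) :: (z.toWord ++ [(k, γ)]))
        = FreeGroup.mk [(k, !γ)] * z * FreeGroup.mk [(k, γ)] := by
      conv_rhs => rw [← mk_toWord (x := z)]
      simp [FreeGroup.mul_mk]
    rw [this, hz, mul_assoc]
    have : FreeGroup.mk [(k, !γ)] * FreeGroup.mk [(k, γ)] = 1 := by
      rw [← mul_inv_cancel (FreeGroup.mk [(k, !γ)]), FreeGroup.inv_mk]; simp [invRev]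
    rw [this, mul_one]
  have h2 := congrArg (fun x => x.toWord.length) h1
  simp only [toWord_mk, hred.reduce_eq] at h2
  simp at h2
  omega

section Affine
variable {G : Type*} [Group G] (c : G →* Multiplicative ℤ) (d : G → ℚ)

/-- `d` is a crossed homomorphism to `ℚ` on which `g` acts by multiplication by `2 ^ c g`. -/
def IsDilationCocycle : Prop :=
  ∀ g h, d (g * h) = d g + 2 ^ (c g).toAdd * d h

variable {c d}

theorem IsDilationCocycle.map_one (hd : IsDilationCocycle c d) : d 1 = 0 := by
  have := hd 1 1
  simpa using this

theorem IsDilationCocycle.map_conj (hd : IsDilationCocycle c d) (w : G) {x : G} (hx : c x = 1) :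
    d (w * x * w⁻¹) = 2 ^ (c w).toAdd * d x := by
  have h1 := hd w w⁻¹
  have h2 := hd (w * x) w⁻¹
  rw [hd w x] at h2
  rw [mul_inv_cancel, hd.map_one] at h1
  simp only [map_mul, hx, mul_one] at h2
  linarith

theorem IsDilationCocycle.map_zpow (hd : IsDilationCocycle c d) {x : G} (hx : c x = 1) (n : ℤ) :
    d (x ^ n) = n * d x := by
  have h0 : ∀ y, d (x * y) = d x + d y := fun y => by simp [hd x y, hx]
  induction n with
  | zero => simp [hd.map_one]
  | succ n ih => rw [add_comm, zpow_add, zpow_one, h0, ih]; push_cast; ring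
  | pred n ih =>
    have := h0 (x ^ (-(n : ℤ) - 1))
    rw [← zpow_one_add, show 1 + (-(n : ℤ) - 1) = -n by ring, ih] at this
    push_cast at *
    linarith

theorem exists_freeGroup_mulEquiv_of_ne_zero {K : Type u} [Group K] [hK : IsFreeGroup K]
    (δ : K →* Multiplicative ℚ) {x : K} (hx : δ x ≠ 1) :
    ∃ (ι : Type u) (e : FreeGroup ι ≃* K), ∀ i, δ (e (of i)) ≠ 1 := by
  classical
  let e := (IsFreeGroup.toFreeGroup K).symm
  have hi0 : ∃ i0, δ (e (of i0)) ≠ 1 := by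
    by_contra! h
    have : δ.comp e.toMonoidHom = 1 := FreeGroup.ext_hom _ _ (by simpa using h)
    apply hx
    have := DFunLike.congr_fun this (e.symm x)
    simpa using this
  obtain ⟨i0, hi0⟩ := hi0
  let t (ε : ℤ) : FreeGroup (IsFreeGroup.Generators K) →* FreeGroup (IsFreeGroup.Generators K) :=
    FreeGroup.lift fun i => if δ (e (of i)) = 1 then of i * of i0 ^ ε else of i
  have ht0 : ∀ ε, t ε (of i0) = of i0 := fun ε => by simp [t, hi0]
  have htt : ∀ ε, (t (-ε)).comp (t ε) = MonoidHom.id _ := by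
    intro ε
    refine FreeGroup.ext_hom _ _ fun i => ?_
    by_cases h : δ (e (of i)) = 1
    · have h1 : ∀ ε, t ε (of i) = of i * of i0 ^ ε := fun ε => by simp [t, h]
      rw [MonoidHom.comp_apply, h1, map_mul, map_zpow, ht0, h1]
      simp
    · have h1 : ∀ ε, t ε (of i) = of i := fun ε => by simp [t, h]
      rw [MonoidHom.comp_apply, h1, h1]; rfl
  let A : FreeGroup (IsFreeGroup.Generators K) ≃* FreeGroup (IsFreeGroup.Generators K) :=
    MonoidHom.toMulEquiv (t 1) (t (-1)) (htt 1) (by simpa using htt (-1))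
  refine ⟨_, A.trans e, fun i => ?_⟩
  have : A (of i) = t 1 (of i) := rfl
  rw [MulEquiv.trans_apply, this]
  by_cases h : δ (e (of i)) = 1
  · have h1 : t 1 (of i) = of i * of i0 := by simp [t, h]
    rw [h1, map_mul, map_mul, h, one_mul]; exact hi0
  · have h1 : t 1 (of i) = of i := by simp [t, h]
    rw [h1]; exact h

theorem pointwiseInnerInner_of_dilationCocycle (hd : IsDilationCocycle c d)
    (hK : IsFreeGroup c.ker) {a0 : G} (ha0 : c a0 = Multiplicative.ofAdd 1)
    {x0 : G} (hx0 : c x0 = 1) (hdx0 : d x0 ≠ 0) : PointwiseInnerInner G := by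
  refine pointwiseInnerInner_of_fixed x0 fun φ hφ hφ0 => ?_
  have hcφ : ∀ g, c (φ g) = c g := fun g => by
    obtain ⟨w, hw⟩ := isConj_iff.1 (hφ g)
    rw [← hw]; simp [mul_comm]
  have hadd : ∀ x y, c x = 1 → d (x * y) = d x + d y := fun x y hx => by simp [hd x y, hx]
  have key : ∀ x, c x = 1 → d x ≠ 0 → ∃ w, c w = 1 ∧ w * x * w⁻¹ = φ x := by
    intro x hx hdx
    obtain ⟨w, hw⟩ := isConj_iff.1 (hφ x)
    refine ⟨w, ?_, hw⟩
    obtain ⟨p, q, hp, hq, hpq⟩ : ∃ p q : ℤ, p ≠ 0 ∧ q ≠ 0 ∧ (p : ℚ) * d x0 = q * d x := by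
      refine ⟨(d x / d x0).num, (d x / d x0).den, ?_, ?_, ?_⟩
      · simp [hdx, hdx0]
      · simp
      · have h := Rat.num_div_den (d x / d x0)
        have hden : ((d x / d x0).den : ℚ) ≠ 0 := by simp
        have h2 : ((d x / d x0).num : ℚ) = (d x / d x0) * (d x / d x0).den := by
          exact (div_eq_iff hden).1 h
        rw [h2]; field_simp; push_cast; ring
    have hy : d (x0 ^ p * x ^ (-q)) = 0 := by
      rw [hadd _ _ (by simp [hx0]), hd.map_zpow hx0, hd.map_zpow hx, hpq]; push_cast; ring
    have hcy : c (x0 ^ p * x ^ (-q)) = 1 := by simp [hx0, hx]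
    obtain ⟨v, hv⟩ := isConj_iff.1 (hφ (x0 ^ p * x ^ (-q)))
    have h1 : d (φ (x0 ^ p * x ^ (-q))) = 0 := by rw [← hv, hd.map_conj v hcy, hy, mul_zero]
    have hcx : c (φ x) = 1 := by rw [hcφ, hx]
    rw [map_mul, map_zpow, map_zpow, hφ0, hadd _ _ (by simp [hx0]), hd.map_zpow hx0,
      hd.map_zpow hcx, ← hw, hd.map_conj w hx, hpq] at h1
    have h2 : (2 : ℚ) ^ (c w).toAdd = 1 := by
      have : (q : ℚ) * d x * (1 - 2 ^ (c w).toAdd) = 0 := by push_cast at h1; linarith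
      have hq' : (q : ℚ) ≠ 0 := by exact_mod_cast hq
      rcases mul_eq_zero.1 this with h | h
      · simp [hq', hdx] at h
      · linarith
    have := (zpow_eq_one_iff_right₀ (by norm_num : (0:ℚ) ≤ 2) (by norm_num)).1 h2
    exact this
  let δ : c.ker →* Multiplicative ℚ :=
    { toFun := fun x => Multiplicative.ofAdd (d x)
      map_one' := by simp [hd.map_one]
      map_mul' := fun x y => by
        rw [← ofAdd_add]; congr 1; exact hadd _ _ x.2 }
  obtain ⟨ι, e, he⟩ := exists_freeGroup_mulEquiv_of_ne_zero δ (x := ⟨x0, hx0⟩) (by simpa [δ] using hdx0)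
  have he' : ∀ i, d (e (of i)) ≠ 0 := fun i h => he i (by simp [δ, h])
  let φK : c.ker →* c.ker := (φ.comp c.ker.subtype).codRestrict c.ker fun x => by
    show c _ = 1
    rw [MonoidHom.comp_apply, hcφ]; exact x.2
  have hφK : ∀ x : c.ker, d x ≠ 0 → IsConj x (φK x) := by
    intro x hx
    obtain ⟨w, hw, h⟩ := key x x.2 hx
    exact isConj_iff.2 ⟨⟨w, hw⟩, Subtype.ext h⟩
  have hconj : ∀ x : FreeGroup ι, d (e x) ≠ 0 →
      IsConj x (((e.symm.toMonoidHom.comp φK).comp e.toMonoidHom) x) := by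
    intro x hx
    obtain ⟨w, hw⟩ := isConj_iff.1 (hφK _ hx)
    refine isConj_iff.2 ⟨e.symm w, ?_⟩
    simp [← hw]
  obtain ⟨u, hu⟩ := inner_of_letters ((e.symm.toMonoidHom.comp φK).comp e.toMonoidHom)
    (fun i => hconj _ (he' i)) (fun i j _ => by
      by_cases h : d (e (of i * of j)) = 0
      · right
        apply hconj
        have h1 : d (e (of i * of j)) = d (e (of i)) + d (e (of j)) := by
          rw [map_mul]; exact hadd _ _ (e (of i)).2
        have h2 : d (e (of i * (of j)⁻¹)) = d (e (of i)) + (-1 : ℤ) * d (e (of j)) := by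
          rw [map_mul, map_inv, ← zpow_neg_one, ← hd.map_zpow (e (of j)).2]
          exact hadd _ _ (e (of i)).2
        rw [h2]; push_cast
        intro h3
        have := he' i
        apply this; linarith
      · exact Or.inl (hconj _ h))
  set v : G := (e u : G) with hv
  have hcv : c v = 1 := (e u).2
  have hφv : ∀ x, c x = 1 → φ x = v * x * v⁻¹ := by
    intro x hx
    have := congrArg e (hu (e.symm ⟨x, hx⟩))
    simp at this
    exact congrArg Subtype.val this
  refine ⟨v, fun g => ?_⟩
  have hz : ∀ k, c k = 1 → (g⁻¹ * v⁻¹ * φ g * v) * k = k * (g⁻¹ * v⁻¹ * φ g * v) := by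
    intro k hk
    have h1 := hφv (g * k * g⁻¹) (by simp [hk])
    rw [map_mul, map_mul, hφv k hk, map_inv] at h1
    have : φ g * v * k = v * g * k * g⁻¹ * v⁻¹ * φ g * v := by
      calc φ g * v * k = (φ g * (v * k * v⁻¹) * (φ g)⁻¹) * φ g * v := by group
        _ = _ := by rw [h1]; group
    calc _ = g⁻¹ * v⁻¹ * (φ g * v * k) := by group
      _ = _ := by rw [this]; group
  have hcz : c (g⁻¹ * v⁻¹ * φ g * v) = 1 := by simp [hcφ, hcv]
  suffices h : (⟨_, hcz⟩ : c.ker) = 1 by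
    have : g⁻¹ * v⁻¹ * φ g * v = 1 := congrArg Subtype.val h
    calc φ g = v * g * (g⁻¹ * v⁻¹ * φ g * v) * v⁻¹ := by group
      _ = _ := by rw [this]; group
  by_cases hne : ∃ i j : ι, i ≠ j
  · obtain ⟨i, j, hij⟩ := hne
    have := eq_one_of_commute_of_nontrivial hij (e.symm ⟨_, hcz⟩) (fun y => by
      apply e.injective
      simp only [map_mul, MulEquiv.apply_symm_apply]
      exact Subtype.ext (hz _ (e y).2).symm)
    simpa using this
  · exfalso
    push Not at hne
    have hι : Nonempty ι := by
      by_contra h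
      rw [not_nonempty_iff] at h
      have : (⟨x0, hx0⟩ : c.ker) = 1 := e.symm.injective (Subsingleton.elim _ _)
      have : x0 = 1 := congrArg Subtype.val this
      exact hdx0 (this ▸ hd.map_one)
    obtain ⟨i⟩ := hι
    have hgen : ∀ y : FreeGroup ι, ∃ n : ℤ, y = of i ^ n := by
      intro y
      have : y ∈ Subgroup.zpowers (of i) := by
        induction y using FreeGroup.induction_on with
        | C1 => exact one_mem _
        | of j => rw [hne j i]; exact Subgroup.mem_zpowers _
        | inv_of j h => exact inv_mem h
        | mul x y hx hy => exact mul_mem hx hy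
      obtain ⟨n, hn⟩ := this
      exact ⟨n, hn.symm⟩
    have hgen' : ∀ x, c x = 1 → ∃ n : ℤ, d x = n * d (e (of i)) := by
      intro x hx
      obtain ⟨n, hn⟩ := hgen (e.symm ⟨x, hx⟩)
      have : (⟨x, hx⟩ : c.ker) = e (of i) ^ n := by
        rw [← map_zpow, ← hn]; simp
      refine ⟨n, ?_⟩
      rw [← hd.map_zpow (e (of i)).2, show x = _ from congrArg Subtype.val this]; rfl
    have hci : c (e (of i)) = 1 := (e (of i)).2
    obtain ⟨n, hn⟩ := hgen' (a0⁻¹ * e (of i) * a0⁻¹⁻¹) (by simp [hci])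
    rw [hd.map_conj _ hci] at hn
    have hn' := mul_right_cancel₀ (he' i) hn
    simp [ha0] at hn'
    have : (2 * n : ℚ) = 1 := by rw [← hn']; norm_num
    have : 2 * n = 1 := by exact_mod_cast this
    omega

end Affine

theorem pointwiseInnerInner_of_cyclic_ker {G : Type*} [Group G] (c : G →* Multiplicative ℤ)
    {a s : G} (ha : c a = Multiplicative.ofAdd 1) (hs : c.ker = Subgroup.zpowers s)
    (hs' : s ≠ 1 → ∀ n : ℤ, s ^ n = 1 → n = 0) : PointwiseInnerInner G := by
  refine pointwiseInnerInner_of_fixed a fun φ hφ hφa => ?_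
  have hcs : c s = 1 := by
    have : s ∈ c.ker := hs ▸ Subgroup.mem_zpowers s
    exact this
  have hgen : ∀ w, ∃ i j : ℤ, w = s ^ i * a ^ j := by
    intro w
    have : w * a ^ (-(c w).toAdd) ∈ c.ker := by
      rw [MonoidHom.mem_ker, map_mul, map_zpow, ha]
      apply Multiplicative.toAdd.injective
      simp
    rw [hs] at this
    obtain ⟨i, hi⟩ := this
    refine ⟨i, (c w).toAdd, ?_⟩
    have hi : s ^ i = w * a ^ (-(c w).toAdd) := hi
    rw [hi]; group
  have hconj : ∀ w, w * s * w⁻¹ = s ∨ w * s * w⁻¹ = s⁻¹ := by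
    intro w
    by_cases h1 : s = 1
    · simp [h1]
    have hmem : ∀ w, ∃ m : ℤ, s ^ m = w * s * w⁻¹ := by
      intro w
      have : w * s * w⁻¹ ∈ c.ker := by simp [MonoidHom.mem_ker, hcs]
      rw [hs] at this
      exact this
    obtain ⟨m, hm⟩ := hmem w
    obtain ⟨n, hn⟩ := hmem w⁻¹
    have h2 : s ^ (m * n - 1) = 1 := by
      rw [zpow_sub_one, zpow_mul, hm, conj_zpow, hn]; group
    have h3 := hs' h1 _ h2
    have h4 : m * n = 1 := by omega
    rcases Int.eq_one_or_neg_one_of_mul_eq_one h4 with h | h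
    · left; rw [← hm, h, zpow_one]
    · right; rw [← hm, h, zpow_neg_one]
  by_cases hφs : φ s = s
  · refine ⟨1, fun g => ?_⟩
    obtain ⟨i, j, rfl⟩ := hgen g
    simp [hφs, hφa]
  · obtain ⟨w, hw⟩ := isConj_iff.1 (hφ s)
    have hφs' : φ s = s⁻¹ := by
      rcases hconj w with h | h
      · exact absurd (hw.symm.trans h) hφs
      · exact hw.symm.trans h
    rcases hconj a with h | h
    · exfalso
      have hcomm : Commute a s := by
        rw [commute_iff_eq]
        calc a * s = (a * s * a⁻¹) * a := by group
          _ = _ := by rw [h]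
      obtain ⟨i, j, rfl⟩ := hgen w
      have : Commute (s ^ i * a ^ j) s :=
        ((Commute.refl s).zpow_left i).mul_left (hcomm.zpow_left j)
      apply hφs
      rw [← hw, this.eq, mul_inv_cancel_right]
    · refine ⟨a, fun g => ?_⟩
      have : φ = (MulAut.conj a).toMonoidHom.comp (MonoidHom.id G) := by
        ext g
        obtain ⟨i, j, rfl⟩ := hgen g
        rw [map_mul, map_zpow, map_zpow, map_mul, map_zpow, map_zpow, hφs', hφa]
        simp [h]
      rw [this]; simp

theorem exists_surjective_of_ne_one {G : Type*} [Group G] (f : G →* Multiplicative ℤ)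
    (hf : f ≠ 1) : ∃ c : G →* Multiplicative ℤ, Function.Surjective c := by
  obtain ⟨n, hn⟩ := Int.subgroup_cyclic (Subgroup.toAddSubgroup' f.range)
  have hmem : ∀ m : ℤ, (∃ g, f g = Multiplicative.ofAdd m) ↔ n ∣ m := by
    intro m
    rw [← Int.mem_zmultiples_iff, AddSubgroup.zmultiples_eq_closure, ← hn]
    exact Iff.rfl
  have hn0 : n ≠ 0 := by
    rintro rfl
    apply hf
    ext g
    have := (hmem (f g).toAdd).1 ⟨g, rfl⟩
    simpa using this
  have hd : ∀ g, n ∣ (f g).toAdd := fun g => (hmem _).1 ⟨g, rfl⟩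
  refine ⟨MonoidHom.mk' (fun g => Multiplicative.ofAdd ((f g).toAdd / n)) fun x y => ?_, fun m => ?_⟩
  · rw [← ofAdd_add, map_mul, toAdd_mul, Int.add_ediv_of_dvd_left (hd x)]
  · obtain ⟨g, hg⟩ := (hmem (n * m.toAdd)).2 (dvd_mul_right _ _)
    refine ⟨g, ?_⟩
    simp [hg, hn0]

theorem exists_nonzero_hom_of_two {ι : Type*} {p q : ι} (hpq : p ≠ q) (r : FreeGroup ι) :
    ∃ f : FreeGroup ι →* Multiplicative ℤ, f ≠ 1 ∧ f r = 1 := by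
  classical
  let E (m n : ℤ) : FreeGroup ι →* Multiplicative ℤ := FreeGroup.lift fun x =>
    if x = p then Multiplicative.ofAdd m else if x = q then Multiplicative.ofAdd n else 1
  have hp : ∀ m n, E m n (of p) = Multiplicative.ofAdd m := fun m n => by simp [E]
  have hq : ∀ m n, E m n (of q) = Multiplicative.ofAdd n := fun m n => by simp [E, hpq.symm]
  have hlin : ∀ m n x, (E m n x).toAdd = m * (E 1 0 x).toAdd + n * (E 0 1 x).toAdd := by
    intro m n x
    induction x using FreeGroup.induction_on with
    | C1 => simp
    | of j =>
      by_cases h : j = p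
      · subst h; simp [hp]
      · by_cases h' : j = q
        · subst h'; simp [hq]
        · simp [E, h, h']
    | inv_of j h => simp only [map_inv, toAdd_inv] at *; rw [h]; ring
    | mul x y hx hy => simp only [map_mul, toAdd_mul] at *; rw [hx, hy]; ring
  by_cases h0 : (E 1 0 r).toAdd = 0 ∧ (E 0 1 r).toAdd = 0
  · refine ⟨E 1 0, fun h => ?_, ?_⟩
    · have := hp 1 0
      rw [h] at this
      simp at this
      exact absurd (Multiplicative.ofAdd.injective this) (by norm_num)
    · exact Multiplicative.toAdd.injective h0.1
  · refine ⟨E (E 0 1 r).toAdd (-(E 1 0 r).toAdd), fun h => ?_, ?_⟩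
    · have h1 := hp (E 0 1 r).toAdd (-(E 1 0 r).toAdd)
      have h2 := hq (E 0 1 r).toAdd (-(E 1 0 r).toAdd)
      rw [h] at h1 h2
      have h1' := congrArg Multiplicative.toAdd h1
      have h2' := congrArg Multiplicative.toAdd h2
      simp only [MonoidHom.one_apply, toAdd_one, toAdd_ofAdd] at h1' h2'
      exact h0 ⟨by omega, by omega⟩
    · apply Multiplicative.toAdd.injective
      rw [hlin]; simp; ring

/-- the affine permutation `x ↦ 2 ^ n * x + w` -/
noncomputable def affinePerm (n : ℤ) (w : ℚ) : Equiv.Perm ℚ where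
  toFun x := 2 ^ n * x + w
  invFun x := (2 ^ n)⁻¹ * (x - w)
  left_inv x := by
    have : (2 : ℚ) ^ n ≠ 0 := zpow_ne_zero _ two_ne_zero
    field_simp; ring
  right_inv x := by
    have : (2 : ℚ) ^ n ≠ 0 := zpow_ne_zero _ two_ne_zero
    field_simp; ring

theorem exists_dilationCocycle {ι : Type*} (c : FreeGroup ι →* Multiplicative ℤ) (v : ι → ℚ) :
    ∃ d : FreeGroup ι → ℚ, IsDilationCocycle c d ∧ ∀ j, d (of j) = v j := by
  let f : FreeGroup ι →* Equiv.Perm ℚ := FreeGroup.lift fun j => affinePerm (c (of j)).toAdd (v j)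
  have hf : ∀ g x, f g x = 2 ^ (c g).toAdd * x + f g 0 := by
    intro g
    induction g using FreeGroup.induction_on with
    | C1 => simp
    | of j => intro x; simp [f, affinePerm]
    | inv_of j h =>
      intro x
      have h0 : (2 : ℚ) ^ (c (of j)).toAdd ≠ 0 := zpow_ne_zero _ two_ne_zero
      have h1 := h (f (of j)⁻¹ x)
      have h2 := h (f (of j)⁻¹ 0)
      have e1 : ∀ y, f (of j) ((f (of j))⁻¹ y) = y := fun y => (f (of j)).apply_symm_apply y
      rw [map_inv, e1] at h1 h2
      rw [map_inv, map_inv, toAdd_inv, zpow_neg]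
      field_simp
      linarith
    | mul x y hx hy =>
      intro z
      simp only [map_mul, Equiv.Perm.mul_apply, toAdd_mul]
      rw [hx, hx (f y 0), hy z, zpow_add₀ two_ne_zero]
      ring
  refine ⟨fun g => f g 0, fun g h => ?_, fun j => ?_⟩
  · show f (g * h) 0 = _
    rw [map_mul, Equiv.Perm.mul_apply, hf]; ring
  · simp [f, affinePerm]

theorem IsDilationCocycle.factor {ι G : Type} [Group G] {i : FreeGroup ι →* G}
    (hi : Function.Surjective i) {r : FreeGroup ι}
    (hext : ∀ (L : Type) [Group L] (ψ : FreeGroup ι →* L), ψ r = 1 → ∀ x, i x = 1 → ψ x = 1)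
    {c : G →* Multiplicative ℤ} {d : FreeGroup ι → ℚ} (hd : IsDilationCocycle (c.comp i) d)
    (hr : i r = 1) (hdr : d r = 0) :
    ∃ d' : G → ℚ, IsDilationCocycle c d' ∧ ∀ x, d' (i x) = d x := by
  let ψ : FreeGroup ι →* Equiv.Perm ℚ := MonoidHom.mk'
    (fun g => affinePerm ((c.comp i) g).toAdd (d g)) fun g h => by
      ext x
      simp only [affinePerm, Equiv.Perm.mul_apply, Equiv.coe_fn_mk]
      rw [hd g h, map_mul, toAdd_mul, zpow_add₀ two_ne_zero]
      ring
  have hψ : ∀ x, ψ x 0 = d x := fun x => by simp [ψ, affinePerm]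
  have hψr : ψ r = 1 := by
    ext x
    simp [ψ, affinePerm, hr, hdr]
  have hd1 : ∀ x y, i x = i y → d x = d y := by
    intro x y hxy
    have h1 : ψ (x * y⁻¹) = 1 := hext _ ψ hψr _ (by simp [hxy])
    have : ψ x = ψ y := by
      rw [map_mul, map_inv] at h1
      exact mul_inv_eq_one.1 h1
    rw [← hψ, ← hψ, this]
  choose s hs using hi
  refine ⟨fun g => d (s g), fun g h => ?_, fun x => hd1 _ _ (hs (i x))⟩
  show d (s (g * h)) = d (s g) + 2 ^ (c g).toAdd * d (s h)
  rw [hd1 _ (s g * s h) (by rw [hs, map_mul, hs, hs]), hd, MonoidHom.comp_apply, hs]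

theorem exists_vector (a v0 : Fin 3 → ℚ) :
    ∃ v : Fin 3 → ℚ, a ⬝ᵥ v = 0 ∧ ∀ t : ℚ, v ≠ t • v0 := by
  let ℓ : (Fin 3 → ℚ) →ₗ[ℚ] ℚ := dotProductBilin ℚ ℚ a
  by_contra! h
  have hle : LinearMap.ker ℓ ≤ Submodule.span ℚ {v0} := by
    intro v hv
    obtain ⟨t, ht⟩ := h v (by simpa [ℓ] using hv)
    exact Submodule.mem_span_singleton.2 ⟨t, ht.symm⟩
  have h1 := Submodule.finrank_mono hle
  have h2 := finrank_span_le_card (R := ℚ) ({v0} : Set (Fin 3 → ℚ))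
  simp only [Set.toFinset_singleton, Finset.card_singleton] at h2
  have h3 := LinearMap.finrank_range_add_finrank_ker ℓ
  have h4 : Module.finrank ℚ (LinearMap.range ℓ) ≤ 1 := by
    have := Submodule.finrank_le (LinearMap.range ℓ)
    simpa using this
  simp at h3
  omega

theorem exists_dilationCocycle_ne_zero {ι G : Type} [Group G] {i : FreeGroup ι →* G}
    (hi : Function.Surjective i) {r : FreeGroup ι}
    (hext : ∀ (L : Type) [Group L] (ψ : FreeGroup ι →* L), ψ r = 1 → ∀ x, i x = 1 → ψ x = 1)
    (hr : i r = 1) {c : G →* Multiplicative ℤ} {a0 : G} (ha0 : c a0 = Multiplicative.ofAdd 1)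
    (t : Fin 3 → ι) (ht : Function.Injective t) :
    ∃ d : G → ℚ, IsDilationCocycle c d ∧ ∃ x, c x = 1 ∧ d x ≠ 0 := by
  classical
  have hbasis : ∀ k : Fin 3, ∃ d : FreeGroup ι → ℚ, IsDilationCocycle (c.comp i) d ∧
      ∀ j, d (of j) = if j = t k then 1 else 0 :=
    fun k => exists_dilationCocycle (c.comp i) (fun j => if j = t k then 1 else 0)
  choose D hD hDt using hbasis
  obtain ⟨v, hv, hv0⟩ := exists_vector (fun k => D k r)
    (fun k => 2 ^ (c (i (of (t k)))).toAdd - 1)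
  let d : FreeGroup ι → ℚ := fun g => (fun k => D k g) ⬝ᵥ v
  have hd : IsDilationCocycle (c.comp i) d := by
    intro g h
    simp only [d, dotProduct, hD _ g h, add_mul, Finset.sum_add_distrib, Finset.mul_sum, mul_assoc]
  have hdt : ∀ k, d (of (t k)) = v k := by
    intro k
    simp [d, dotProduct, hDt, ht.eq_iff]
  obtain ⟨d', hd', hdd'⟩ := hd.factor hi hext hr hv
  refine ⟨d', hd', ?_⟩
  by_contra! h
  apply hv0 (d' a0)
  have hprin : ∀ g, d' g = d' a0 * (2 ^ (c g).toAdd - 1) := by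
    intro g
    have hpow : ∀ n : ℤ, d' (a0 ^ n) = d' a0 * (2 ^ n - 1) := by
      have hstep : ∀ n : ℤ, d' (a0 ^ (n + 1)) = d' a0 + 2 * d' (a0 ^ n) := by
        intro n
        rw [add_comm, zpow_add, zpow_one, hd', ha0]; simp
      intro n
      induction n with
      | zero => simp [hd'.map_one]
      | succ n ih => rw [hstep, ih, zpow_add_one₀ two_ne_zero]; ring
      | pred n ih =>
        have := hstep (-(n : ℤ) - 1)
        rw [sub_add_cancel, ih] at this
        rw [zpow_sub_one₀ two_ne_zero]; linarith
    have hk : c (g * a0 ^ (-(c g).toAdd)) = 1 := by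
      apply Multiplicative.toAdd.injective
      simp [ha0]
    have h1 : d' (g * a0 ^ (-(c g).toAdd) * a0 ^ (c g).toAdd) = d' (a0 ^ (c g).toAdd) := by
      rw [hd', hk, h _ hk]; simp
    rw [← hpow, ← h1]; congr 1; group
  ext k
  rw [← hdt, ← hdd', hprin]; rfl

section TwoGenerators

theorem exists_generators_aux {F : Type*} [Group F] (c : F →* Multiplicative ℤ) (n : ℕ) :
    ∀ x y : F, (c x).toAdd.natAbs + (c y).toAdd.natAbs ≤ n → Subgroup.closure {x, y} = ⊤ →
      ∃ a b : F, c b = 1 ∧ Subgroup.closure {a, b} = ⊤ := by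
  induction n with
  | zero =>
    intro x y h hxy
    refine ⟨x, y, ?_, hxy⟩
    apply Multiplicative.toAdd.injective
    show (c y).toAdd = 0
    omega
  | succ n ih =>
    have main : ∀ x y : F, (c x).toAdd.natAbs + (c y).toAdd.natAbs ≤ n + 1 →
        (c x).toAdd.natAbs ≤ (c y).toAdd.natAbs → Subgroup.closure {x, y} = ⊤ →
      ∃ a b : F, c b = 1 ∧ Subgroup.closure {a, b} = ⊤ := by
      intro x y h hle hxy
      have hswap : ∀ z, (y = z * x ∨ y = z * x⁻¹) → Subgroup.closure {x, z} = ⊤ := by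
        intro z hz
        rw [eq_top_iff, ← hxy, Subgroup.closure_le]
        have hx : x ∈ Subgroup.closure {x, z} := Subgroup.subset_closure (by simp)
        have hz' : z ∈ Subgroup.closure {x, z} := Subgroup.subset_closure (by simp)
        rintro w (rfl | hw)
        · exact hx
        · rw [Set.mem_singleton_iff] at hw
          subst hw
          rcases hz with h | h
          · rw [h]; exact mul_mem hz' hx
          · rw [h]; exact mul_mem hz' (inv_mem hx)
      by_cases hx : (c x).toAdd = 0
      · refine ⟨y, x, Multiplicative.toAdd.injective hx, ?_⟩
        rwa [Set.pair_comm]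
      by_cases hs : 0 ≤ (c x).toAdd * (c y).toAdd
      · refine ih x (y * x⁻¹) ?_ (hswap _ (Or.inl (by group)))
        have : (c (y * x⁻¹)).toAdd = (c y).toAdd - (c x).toAdd := by simp [sub_eq_add_neg]
        rw [this]
        rcases lt_or_gt_of_ne hx with h1 | h1
        · have : (c y).toAdd ≤ 0 := by nlinarith
          omega
        · have : 0 ≤ (c y).toAdd := by nlinarith
          omega
      · refine ih x (y * x) ?_ (hswap _ (Or.inr (by group)))
        have : (c (y * x)).toAdd = (c y).toAdd + (c x).toAdd := by simp
        rw [this]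
        rcases lt_or_gt_of_ne hx with h1 | h1
        · have : 0 ≤ (c y).toAdd := by nlinarith
          omega
        · have : (c y).toAdd ≤ 0 := by nlinarith
          omega
    intro x y h hxy
    rcases le_total (c x).toAdd.natAbs (c y).toAdd.natAbs with hle | hle
    · exact main x y h hle hxy
    · exact main y x (by omega) hle (by rwa [Set.pair_comm])

variable {F : Type*} [Group F] {c : F →* Multiplicative ℤ}

theorem exists_generators (hc : Function.Surjective c) {x y : F}
    (hxy : Subgroup.closure {x, y} = ⊤) :
    ∃ a b : F, c a = Multiplicative.ofAdd 1 ∧ c b = 1 ∧ Subgroup.closure {a, b} = ⊤ := by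
  obtain ⟨a, b, hb, hab⟩ := exists_generators_aux c _ x y le_rfl hxy
  have hdvd : ∀ g, (c a).toAdd ∣ (c g).toAdd := by
    intro g
    have hg : g ∈ Subgroup.closure {a, b} := hab ▸ Subgroup.mem_top g
    induction hg using Subgroup.closure_induction with
    | mem x hx =>
      rcases hx with rfl | hx
      · exact dvd_rfl
      · rw [Set.mem_singleton_iff] at hx; subst hx; rw [hb]; exact dvd_zero _
    | one => simp
    | mul x y _ _ hx hy => rw [map_mul, toAdd_mul]; exact dvd_add hx hy
    | inv x _ hx => rw [map_inv, toAdd_inv]; exact (dvd_neg).2 hx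
  obtain ⟨g, hg⟩ := hc (Multiplicative.ofAdd 1)
  have h1 := hdvd g
  rw [hg, toAdd_ofAdd] at h1
  rcases Int.isUnit_iff.1 (isUnit_of_dvd_one h1) with h | h
  · exact ⟨a, b, Multiplicative.toAdd.injective h, hb, hab⟩
  · refine ⟨a⁻¹, b, Multiplicative.toAdd.injective (by simp [h]), hb, ?_⟩
    rw [eq_top_iff, ← hab, Subgroup.closure_le]
    rintro w (rfl | hw)
    · have : w⁻¹ ∈ Subgroup.closure {w⁻¹, b} := Subgroup.subset_closure (by simp)
      simpa using inv_mem this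
    · exact Subgroup.subset_closure (by simp at hw; simp [hw])

theorem ker_le_closure_conj {a b : F} (ha : c a = Multiplicative.ofAdd 1) (hb : c b = 1)
    (hab : Subgroup.closure {a, b} = ⊤) {x : F} (hx : c x = 1) :
    x ∈ Subgroup.closure (Set.range fun j : ℤ => a ^ j * b * (a ^ j)⁻¹) := by
  set C := Subgroup.closure (Set.range fun j : ℤ => a ^ j * b * (a ^ j)⁻¹) with hC
  have hconj : ∀ (l : ℤ), ∀ k ∈ C, a ^ l * k * (a ^ l)⁻¹ ∈ C := by
    intro l k hk
    induction hk using Subgroup.closure_induction with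
    | mem x hx =>
      obtain ⟨j, rfl⟩ := hx
      exact Subgroup.subset_closure ⟨l + j, by simp only [zpow_add]; group⟩
    | one => simp
    | mul x y _ _ hx hy =>
      have := mul_mem hx hy
      convert this using 1; group
    | inv x _ hx =>
      have := inv_mem hx
      convert this using 1; group
  have hbC : b ∈ C := Subgroup.subset_closure ⟨0, by simp⟩
  have hdec : ∀ g, g * (a ^ (c g).toAdd)⁻¹ ∈ C := by
    intro g
    have hg : g ∈ Subgroup.closure {a, b} := hab ▸ Subgroup.mem_top g
    induction hg using Subgroup.closure_induction with
    | mem x hx =>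
      rcases hx with rfl | hx
      · simp [ha]
      · rw [Set.mem_singleton_iff] at hx; subst hx; simpa [hb]
    | one => simp
    | mul x y _ _ hx hy =>
      have := mul_mem hx (hconj (c x).toAdd _ hy)
      convert this using 1
      rw [map_mul, toAdd_mul, zpow_add]; group
    | inv x _ hx =>
      have := hconj (-(c x).toAdd) _ (inv_mem hx)
      convert this using 1
      rw [map_inv, toAdd_inv]; group
  simpa [hx] using hdec x

/-- An element of the kernel of `c`, as seen by additive functions. -/
theorem exists_exponents {a b : F} (ha : c a = Multiplicative.ofAdd 1) (hb : c b = 1)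
    (hab : Subgroup.closure {a, b} = ⊤) {x : F} (hx : c x = 1) :
    ∃ n : ℤ →₀ ZMod 2, ∀ ψ : F → ZMod 2, (∀ g h, c g = 1 → c h = 1 → ψ (g * h) = ψ g + ψ h) →
      ∀ l : ℤ, ψ (a ^ l * x * (a ^ l)⁻¹) = n.sum fun j m => m * ψ (a ^ (l + j) * b * (a ^ (l + j))⁻¹) := by
  have hcl := ker_le_closure_conj ha hb hab hx
  have hker : ∀ y ∈ Subgroup.closure (Set.range fun j : ℤ => a ^ j * b * (a ^ j)⁻¹), c y = 1 := by
    intro y hy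
    have : Subgroup.closure (Set.range fun j : ℤ => a ^ j * b * (a ^ j)⁻¹) ≤ c.ker := by
      rw [Subgroup.closure_le]
      rintro _ ⟨j, rfl⟩
      simp [MonoidHom.mem_ker, hb]
    exact this hy
  have hkc : ∀ (l : ℤ) y, c y = 1 → c (a ^ l * y * (a ^ l)⁻¹) = 1 := by
    intro l y hy; simp [hy]
  clear hx
  induction hcl using Subgroup.closure_induction with
  | mem x hx =>
    obtain ⟨j, rfl⟩ := hx
    refine ⟨Finsupp.single j 1, fun ψ _ l => ?_⟩
    rw [Finsupp.sum_single_index (by simp), one_mul, zpow_add]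
    congr 1; group
  | one =>
    refine ⟨0, fun ψ hψ l => ?_⟩
    have := hψ 1 1 (map_one c) (map_one c)
    simpa using this
  | mul x y hx hy ihx ihy =>
    obtain ⟨m, hm⟩ := ihx
    obtain ⟨n, hn⟩ := ihy
    refine ⟨m + n, fun ψ hψ l => ?_⟩
    rw [Finsupp.sum_add_index' (by simp) (by intros; ring), ← hm ψ hψ, ← hn ψ hψ,
      ← hψ _ _ (hkc l _ (hker _ hx)) (hkc l _ (hker _ hy))]
    congr 1; group
  | inv x hx ihx =>
    obtain ⟨m, hm⟩ := ihx
    refine ⟨m, fun ψ hψ l => ?_⟩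
    rw [← hm ψ hψ]
    have h1 := hψ 1 1 (map_one c) (map_one c)
    have h2 := hψ _ _ (hkc l _ (hker _ hx)) (hkc l _ (by rw [map_inv, hker _ hx, inv_one] : c x⁻¹ = 1))
    rw [show a ^ l * x * (a ^ l)⁻¹ * (a ^ l * x⁻¹ * (a ^ l)⁻¹) = 1 by group] at h2
    have h3 : ψ 1 = 0 := by simpa using h1
    rw [h3] at h2
    rw [eq_comm, ← CharTwo.add_eq_zero, ← h2]

/-- A finitely supported family of mod 2 cochains with two adjacent defects along `x` forces
additive functions killing the conjugates of `x` to be constant along the conjugates of `b`. -/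
theorem constant_of_defect {a b : F} (ha : c a = Multiplicative.ofAdd 1) (hb : c b = 1)
    (hab : Subgroup.closure {a, b} = ⊤) {r : F} (hr : c r = 1)
    {e : F → ℤ → ZMod 2} (he : ∀ g h j, e (g * h) j = e g j + e h (j + (c g).toAdd))
    (hfin : ∀ g, (Function.support (e g)).Finite)
    {j0 : ℤ} (hj0 : ∀ j, e r j ≠ 0 ↔ j = j0 ∨ j = j0 + 1)
    {χ : F → ZMod 2} (hχ : ∀ g h, c g = 1 → c h = 1 → χ (g * h) = χ g + χ h)
    (hχr : ∀ l : ℤ, χ (a ^ l * r * (a ^ l)⁻¹) = 0) (s : ℤ) :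
    χ (a ^ s * b * (a ^ s)⁻¹) = χ b := by
  obtain ⟨n, hn⟩ := exists_exponents ha hb hab hr
  set X : ℤ → ZMod 2 := fun j => χ (a ^ j * b * (a ^ j)⁻¹) with hX
  have he1 : ∀ j, e 1 j = 0 := fun j => by simpa using he 1 1 j
  have hca : ∀ j : ℤ, (c (a ^ j)).toAdd = j := fun j => by simp [ha]
  have hconj : ∀ (l m : ℤ) (y), c y = 1 → e (a ^ l * y * (a ^ l)⁻¹) m = e y (m + l) := by
    intro l m y hy
    have h1 := he (a ^ l) (a ^ l)⁻¹ m
    rw [mul_inv_cancel, he1, hca] at h1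
    rw [he, he, hca, map_mul, hy, mul_one, hca, add_right_comm, ← h1, zero_add]
  have her : ∀ m, e r m = n.sum fun j k => k * e b (m + j) := by
    intro m
    have := hn (fun g => e g m) (fun g h hg _ => by simp [he, hg]) 0
    simp only [hconj _ _ _ hr, hconj _ _ _ hb] at this
    simpa using this
  have hXr : ∀ l, (n.sum fun j k => k * X (l + j)) = 0 := by
    intro l
    rw [← hn χ hχ l, hχr]
  have hstep : ∀ t : ℤ, X (t - j0) = X (t - (j0 + 1)) := by
    intro t
    have h1 : ∑ᶠ m, e r m * X (t - m) = X (t - j0) + X (t - (j0 + 1)) := by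
      have hval : ∀ m, e r m * X (t - m) = if m = j0 ∨ m = j0 + 1 then X (t - m) else 0 := by
        intro m
        split_ifs with h
        · have := (hj0 m).2 h
          have h1 : e r m = 1 := by
            generalize e r m = z at this
            revert this; revert z; decide
          rw [h1, one_mul]
        · have : e r m = 0 := by
            by_contra h'; exact h ((hj0 m).1 h')
          rw [this, zero_mul]
      rw [finsum_congr hval, finsum_eq_sum_of_support_subset (s := {j0, j0 + 1})]
      · rw [Finset.sum_pair (by omega)]; simp
      · intro m hm
        simp at hm ⊢
        exact hm.1
    have h2 : ∑ᶠ m, e r m * X (t - m) = 0 := by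
      have e1 : ∀ m, e r m * X (t - m) = n.sum fun j k => k * e b (m + j) * X (t - m) := by
        intro m; rw [her, Finsupp.sum_mul]
      have hfs : ∀ j ∈ n.support, (Function.support fun m => n j * e b (m + j) * X (t - m)).Finite := by
        intro j _
        refine ((hfin b).preimage (f := fun m => m + j) (by intro x _ y _ h; simpa using h)).subset ?_
        intro m hm h0
        apply hm
        simp [h0]
      rw [finsum_congr e1]
      simp only [Finsupp.sum]
      rw [finsum_sum_comm _ _ hfs]
      have e2 : ∀ j, ∑ᶠ m, n j * e b (m + j) * X (t - m) = ∑ᶠ k, e b k * (n j * X (t - k + j)) := by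
        intro j
        rw [← finsum_comp_equiv (Equiv.addRight j) (f := fun k => e b k * (n j * X (t - k + j)))]
        refine finsum_congr fun m => ?_
        simp only [Equiv.coe_addRight]
        rw [show t - (m + j) + j = t - m by ring]; ring
      rw [Finset.sum_congr rfl fun j _ => e2 j, ← finsum_sum_comm]
      · rw [finsum_eq_zero_of_forall_eq_zero]
        intro k
        rw [← Finset.mul_sum]
        have := hXr (t - k)
        rw [Finsupp.sum] at this
        rw [this, mul_zero]
      · intro j _
        refine (hfin b).subset ?_
        intro m hm h0
        apply hm
        simp [h0]
    rw [h1] at h2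
    exact CharTwo.add_eq_zero.1 h2
  have hstep' : ∀ t : ℤ, X (t + 1) = X t := by
    intro t
    have := hstep (t + 1 + j0)
    rw [show t + 1 + j0 - j0 = t + 1 by ring, show t + 1 + j0 - (j0 + 1) = t by ring] at this
    exact this
  have hX0 : X 0 = χ b := by simp [X]
  rw [← hX0]
  change X s = X 0
  induction s with
  | zero => rfl
  | succ n ih => rw [hstep', ih]
  | pred n ih => rw [← ih, ← hstep', sub_add_cancel]

end TwoGenerators

theorem exists_generator_of_subsingleton {K : Type*} [Group K] (hK : IsFreeGroup K)
    (h : Subsingleton (IsFreeGroup.Generators K)) :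
    ∃ s : K, (∀ x, x ∈ Subgroup.zpowers s) ∧ (s ≠ 1 → ∀ n : ℤ, s ^ n = 1 → n = 0) := by
  let e := IsFreeGroup.toFreeGroup K
  rcases isEmpty_or_nonempty (IsFreeGroup.Generators K) with h0 | ⟨⟨k⟩⟩
  · refine ⟨1, fun x => ?_, fun h => absurd rfl h⟩
    have : x = 1 := e.injective (Subsingleton.elim _ _)
    rw [this]; exact one_mem _
  · refine ⟨e.symm (of k), fun x => ?_, fun _ n hn => ?_⟩
    · have : ∀ y : FreeGroup (IsFreeGroup.Generators K), y ∈ Subgroup.zpowers (of k) := by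
        intro y
        induction y using FreeGroup.induction_on with
        | C1 => exact one_mem _
        | of j => rw [Subsingleton.elim j k]; exact Subgroup.mem_zpowers _
        | inv_of j h => exact inv_mem h
        | mul x y hx hy => exact mul_mem hx hy
      obtain ⟨n, hn⟩ := this (e x)
      refine ⟨n, e.injective ?_⟩
      have hn : of k ^ n = e x := hn
      simp [hn]
    · have h1 : of k ^ n = 1 := by
        have := congrArg e hn
        simpa using this
      have h2 := congrArg (FreeGroup.lift fun _ => Multiplicative.ofAdd (1 : ℤ)) h1
      simp only [map_zpow, FreeGroup.lift_apply_of, map_one] at h2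
      have h3 := congrArg Multiplicative.toAdd h2
      simpa using h3

section OneRelator
variable {ι G : Type} [Group G] {i : FreeGroup ι →* G}
  (hi : Function.Surjective i) {r : FreeGroup ι} (hr : i r = 1)
  (hext : ∀ (L : Type) [Group L] (ψ : FreeGroup ι →* L), ψ r = 1 → ∀ x, i x = 1 → ψ x = 1)
include hi hext

theorem exists_surjective_of_two {p q : ι} (hpq : p ≠ q) :
    ∃ c : G →* Multiplicative ℤ, Function.Surjective c := by
  obtain ⟨f, hf, hfr⟩ := exists_nonzero_hom_of_two hpq r
  have hk : i.ker ≤ f.ker := fun x hx => hext _ f hfr x hx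
  let c0 : G →* Multiplicative ℤ := i.liftOfSurjective hi ⟨f, hk⟩
  have hc0 : ∀ x, c0 (i x) = f x := fun x => MonoidHom.liftOfRightInverse_comp_apply i _ _ ⟨f, hk⟩ x
  refine exists_surjective_of_ne_one c0 fun h => hf ?_
  ext x
  rw [← hc0, h]; rfl

include hr

theorem pointwiseInnerInner_of_three
    (hfree : ∀ c : G →* Multiplicative ℤ, Function.Surjective c → IsFreeGroup c.ker)
    (t : Fin 3 → ι) (ht : Function.Injective t) : PointwiseInnerInner G := by
  obtain ⟨c, hc⟩ := exists_surjective_of_two hi hext (ht.ne (by decide : (0 : Fin 3) ≠ 1))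
  obtain ⟨a0, ha0⟩ := hc (Multiplicative.ofAdd 1)
  obtain ⟨d, hd, x, hx, hdx⟩ := exists_dilationCocycle_ne_zero hi hext hr ha0 t ht
  exact pointwiseInnerInner_of_dilationCocycle hd (hfree c hc) ha0 hx hdx

theorem pointwiseInnerInner_of_two
    (hfree : ∀ c : G →* Multiplicative ℤ, Function.Surjective c → IsFreeGroup c.ker)
    (hdef : ∀ c : G →* Multiplicative ℤ, Function.Surjective c →
      ∃ e : FreeGroup ι → ℤ → ZMod 2,
        (∀ g h j, e (g * h) j = e g j + e h (j + (c (i g)).toAdd)) ∧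
        (∀ g, (Function.support (e g)).Finite) ∧
        ∃ j0, ∀ j, e r j ≠ 0 ↔ j = j0 ∨ j = j0 + 1)
    {p q : ι} (hpq : p ≠ q) (hall : ∀ j, j = p ∨ j = q) : PointwiseInnerInner G := by
  classical
  obtain ⟨c, hc⟩ := exists_surjective_of_two hi hext hpq
  have hcl : Subgroup.closure {of p, of q} = ⊤ := by
    rw [eq_top_iff, ← FreeGroup.closure_range_of, Subgroup.closure_le]
    rintro _ ⟨j, rfl⟩
    rcases hall j with h | h <;> rw [h] <;> exact Subgroup.subset_closure (by simp)
  obtain ⟨a, b, ha, hb, hab⟩ := exists_generators (c := c.comp i) (hc.comp hi) hcl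
  have hK := hfree c hc
  obtain ⟨e, he, hfin, j0, hj0⟩ := hdef c hc
  have hconst : ∀ (θ : c.ker →* Multiplicative (ZMod 2)) (s : ℤ) (h1 : c (i (a ^ s * b * (a ^ s)⁻¹)) = 1),
      θ ⟨i (a ^ s * b * (a ^ s)⁻¹), h1⟩ = θ ⟨i b, hb⟩ := by
    intro θ s h1
    let χ : FreeGroup ι → ZMod 2 := fun g =>
      if h : c (i g) = 1 then (θ ⟨i g, h⟩).toAdd else 0
    have hχ : ∀ g (h : c (i g) = 1), χ g = (θ ⟨i g, h⟩).toAdd := fun g h => dif_pos h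
    have hr' : ∀ l : ℤ, i (a ^ l * r * (a ^ l)⁻¹) = 1 := fun l => by simp [hr]
    have := constant_of_defect ha hb hab (r := r) (by simp [hr]) he hfin hj0 (χ := χ) ?_ ?_ s
    · rw [hχ _ h1, hχ _ hb] at this
      exact Multiplicative.toAdd.injective this
    · intro g h hg hh
      have hgh : c (i (g * h)) = 1 := by
        have hg : c (i g) = 1 := hg
        have hh : c (i h) = 1 := hh
        rw [map_mul, map_mul, hg, hh, one_mul]
      rw [hχ g hg, hχ h hh, hχ _ hgh, ← toAdd_mul, ← map_mul]
      congr 2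
      exact Subtype.ext (map_mul i g h)
    · intro l
      have h2 : c (i (a ^ l * r * (a ^ l)⁻¹)) = 1 := by rw [hr', map_one]
      rw [hχ _ h2]
      have : (⟨i (a ^ l * r * (a ^ l)⁻¹), h2⟩ : c.ker) = 1 := Subtype.ext (hr' l)
      rw [this, map_one]; rfl
  have heq : ∀ θ θ' : c.ker →* Multiplicative (ZMod 2), θ ⟨i b, hb⟩ = θ' ⟨i b, hb⟩ → θ = θ' := by
    intro θ θ' hθ
    ext ⟨x, hx⟩
    obtain ⟨y, rfl⟩ := hi x
    have hy : (c.comp i) y = 1 := hx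
    have hmem := ker_le_closure_conj ha hb hab hy
    have : ∀ y ∈ Subgroup.closure (Set.range fun j : ℤ => a ^ j * b * (a ^ j)⁻¹),
        ∃ h : c (i y) = 1, θ ⟨i y, h⟩ = θ' ⟨i y, h⟩ := by
      intro y hy
      induction hy using Subgroup.closure_induction with
      | mem x hx =>
        obtain ⟨j, rfl⟩ := hx
        have h1 : c (i (a ^ j * b * (a ^ j)⁻¹)) = 1 := by
          have hb' : c (i b) = 1 := hb
          simp [hb']
        exact ⟨h1, by rw [hconst θ, hconst θ', hθ]⟩
      | one =>
        refine ⟨by simp, ?_⟩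
        have : (⟨i 1, by simp⟩ : c.ker) = 1 := Subtype.ext (map_one i)
        rw [this, map_one, map_one]
      | mul x y _ _ hx hy =>
        obtain ⟨h1, h2⟩ := hx
        obtain ⟨h3, h4⟩ := hy
        have h5 : c (i (x * y)) = 1 := by rw [map_mul, map_mul, h1, h3, one_mul]
        refine ⟨h5, ?_⟩
        have : (⟨i (x * y), h5⟩ : c.ker)
            = ⟨i x, h1⟩ * ⟨i y, h3⟩ := Subtype.ext (map_mul i x y)
        rw [this, map_mul, map_mul, h2, h4]
      | inv x _ hx =>
        obtain ⟨h1, h2⟩ := hx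
        have h5 : c (i x⁻¹) = 1 := by rw [map_inv, map_inv, h1, inv_one]
        refine ⟨h5, ?_⟩
        have : (⟨i x⁻¹, h5⟩ : c.ker)
            = ⟨i x, h1⟩⁻¹ := Subtype.ext (map_inv i x)
        rw [this, map_inv, map_inv, h2]
    obtain ⟨_, h⟩ := this y hmem
    exact congrArg Multiplicative.toAdd h
  have hsub : Subsingleton (IsFreeGroup.Generators c.ker) := by
    refine ⟨fun k l => ?_⟩
    by_contra hkl
    let E : FreeGroup (IsFreeGroup.Generators c.ker) ≃* c.ker := (IsFreeGroup.toFreeGroup c.ker).symm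
    let Θ (k : IsFreeGroup.Generators c.ker) : c.ker →* Multiplicative (ZMod 2) :=
      (FreeGroup.lift fun j => if j = k then Multiplicative.ofAdd 1 else 1).comp E.symm.toMonoidHom
    have hΘ : ∀ k l, Θ k (E (of l)) = if l = k then Multiplicative.ofAdd 1 else 1 := by
      intro k l; simp [Θ]
    have hne : ∀ k, Θ k ⟨i b, hb⟩ = Multiplicative.ofAdd 1 := by
      intro k
      have h2 : ∀ z : Multiplicative (ZMod 2), z = 1 ∨ z = Multiplicative.ofAdd 1 := by decide
      rcases h2 (Θ k ⟨i b, hb⟩) with h | h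
      · have := heq (Θ k) 1 (by rw [h]; rfl)
        have h3 := hΘ k k
        rw [this, if_pos rfl, MonoidHom.one_apply] at h3
        exact absurd h3 (by decide)
      · exact h
    have := heq (Θ k) (Θ l) (by rw [hne, hne])
    have h3 := hΘ k k
    rw [this, hΘ, if_neg hkl, if_pos rfl] at h3
    exact absurd h3 (by decide)
  obtain ⟨s, hs, hs'⟩ := exists_generator_of_subsingleton hK hsub
  refine pointwiseInnerInner_of_cyclic_ker c (a := i a) (s := s) ha ?_ ?_
  · ext x
    constructor
    · intro hx
      obtain ⟨n, hn⟩ := hs ⟨x, hx⟩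
      exact ⟨n, by simpa using congrArg Subtype.val hn⟩
    · rintro ⟨n, rfl⟩
      exact zpow_mem s.2 n
  · intro h1 n hn
    exact hs' (fun h => h1 (by rw [h]; rfl)) n (Subtype.ext (by simpa using hn))

theorem pointwiseInnerInner_of_oneRelator
    (hfree : ∀ c : G →* Multiplicative ℤ, Function.Surjective c → IsFreeGroup c.ker)
    (hdef : ∀ c : G →* Multiplicative ℤ, Function.Surjective c →
      ∃ e : FreeGroup ι → ℤ → ZMod 2,
        (∀ g h j, e (g * h) j = e g j + e h (j + (c (i g)).toAdd)) ∧
        (∀ g, (Function.support (e g)).Finite) ∧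
        ∃ j0, ∀ j, e r j ≠ 0 ↔ j = j0 ∨ j = j0 + 1) : PointwiseInnerInner G := by
  by_cases h2 : ∃ p q : ι, p ≠ q
  · obtain ⟨p, q, hpq⟩ := h2
    by_cases h3 : ∃ j, j ≠ p ∧ j ≠ q
    · obtain ⟨j, hj⟩ := h3
      refine pointwiseInnerInner_of_three hi hr hext hfree ![p, q, j] ?_
      intro x y hxy
      fin_cases x <;> fin_cases y <;> simp_all [eq_comm]
    · push Not at h3
      exact pointwiseInnerInner_of_two hi hr hext hfree hdef hpq fun j =>
        or_iff_not_imp_left.2 (h3 j)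
  · push Not at h2
    apply pointwiseInnerInner_of_comm
    have hF : ∀ x y : FreeGroup ι, x * y = y * x := by
      intro x y
      rcases isEmpty_or_nonempty ι with h | ⟨⟨k⟩⟩
      · exact Subsingleton.elim _ _
      · have hz : ∀ z : FreeGroup ι, z ∈ Subgroup.zpowers (of k) := by
          intro z
          induction z using FreeGroup.induction_on with
          | C1 => exact one_mem _
          | of j => rw [h2 j k]; exact Subgroup.mem_zpowers _
          | inv_of j h => exact inv_mem h
          | mul x y hx hy => exact mul_mem hx hy
        obtain ⟨m, rfl⟩ := hz x
        obtain ⟨n, rfl⟩ := hz y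
        exact (Commute.refl (of k)).zpow_zpow m n
    intro x y
    obtain ⟨x, rfl⟩ := hi x
    obtain ⟨y, rfl⟩ := hi y
    rw [← map_mul, hF, map_mul]

end OneRelator

end SurfacePi1

namespace SurfacePi1

open Topology Filter Metric

set_option linter.unusedSectionVars false
set_option linter.style.haveILetI false

section Cocycles

variable {X Y Z : Type} [TopologicalSpace X] [TopologicalSpace Y] [TopologicalSpace Z]
variable {G H : Type} [Group G] [Group H]

/-- The germwise cocycle condition at a point. -/
def CocycleAt (g : X → X → G) (x : X) : Prop :=
  ∀ᶠ y in 𝓝 x, ∀ᶠ z in 𝓝 y, g x z = g x y * g y z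

/-- `s` is, near `y`, a primitive along `f` of the cocycle `g`. -/
def PrimAt (g : X → X → G) (f : Y → X) (s : Y → G) (y : Y) : Prop :=
  ∀ᶠ z in 𝓝 y, s z = s y * g (f y) (f z)

namespace CocycleAt

theorem self_eq_one {g : X → X → G} {x : X} (h : CocycleAt g x) : g x x = 1 := by
  have h1 := Eventually.self_of_nhds (p := fun y => ∀ᶠ z in 𝓝 y, g x z = g x y * g y z) h
  have h2 : g x x = g x x * g x x := h1.self_of_nhds
  simpa using h2

theorem eventually {g : X → X → G} {x : X} (h : CocycleAt g x) :
    ∀ᶠ y in 𝓝 x, CocycleAt g y := by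
  filter_upwards [eventually_eventually_nhds.2 h] with y hy
  have h0 : ∀ᶠ z in 𝓝 y, g x z = g x y * g y z := hy.self_of_nhds
  filter_upwards [hy, h0, eventually_eventually_nhds.2 h0] with y' hy' h0' h1
  filter_upwards [hy', h1] with z hz h2
  rw [← mul_right_inj (g x y), ← h2, hz, h0', mul_assoc]

theorem comp {g : X → X → G} {f : Y → X} (hf : Continuous f) {y : Y} (h : CocycleAt g (f y)) :
    CocycleAt (fun a b => g (f a) (f b)) y := by
  filter_upwards [(hf.tendsto y).eventually h] with a ha
  exact (hf.tendsto a).eventually ha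

theorem hom {g : X → X → G} {x : X} (h : CocycleAt g x) (q : G →* H) :
    CocycleAt (fun a b => q (g a b)) x := by
  filter_upwards [h] with y hy
  filter_upwards [hy] with z hz
  rw [hz, map_mul]

theorem congr {g g' : X → X → G} {x : X} (h : CocycleAt g x)
    (hg : ∀ᶠ y in 𝓝 x, ∀ᶠ z in 𝓝 y, g y z = g' y z) : CocycleAt g' x := by
  have h0 := hg.self_of_nhds
  filter_upwards [h, hg, h0, eventually_eventually_nhds.2 h0] with y hy h1 h2 h3
  filter_upwards [hy, h1, h3] with z hz h4 h5
  rw [← h5, hz, h2, h4]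

end CocycleAt

namespace PrimAt

theorem comp {g : X → X → G} {f : Y → X} {s : Y → G} {φ : Z → Y} {z : Z}
    (hφ : ContinuousAt φ z) (h : PrimAt g f s (φ z)) : PrimAt g (f ∘ φ) (s ∘ φ) z :=
  hφ.eventually h

theorem mul_left {g : X → X → G} {f : Y → X} {s : Y → G} {y : Y} (h : PrimAt g f s y) (k : G) :
    PrimAt g f (fun y => k * s y) y := by
  filter_upwards [h] with z hz
  rw [hz, mul_assoc]

theorem hom {g : X → X → G} {f : Y → X} {s : Y → G} {y : Y} (h : PrimAt g f s y) (q : G →* H) :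
    PrimAt (fun a b => q (g a b)) f (fun y => q (s y)) y := by
  filter_upwards [h] with z hz
  rw [hz, map_mul]

theorem congr {g g' : X → X → G} {f : Y → X} {s : Y → G} {y : Y} (h : PrimAt g f s y)
    (hg : ∀ᶠ z in 𝓝 y, g (f y) (f z) = g' (f y) (f z)) : PrimAt g' f s y := by
  filter_upwards [h, hg] with z hz h1
  rw [hz, h1]

theorem unique_set {g : X → X → G} {f : Y → X} {s s' : Y → G} {A : Set Y} (hA : IsPreconnected A)
    (hs : ∀ y ∈ A, PrimAt g f s y) (hs' : ∀ y ∈ A, PrimAt g f s' y)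
    {y z : Y} (hy : y ∈ A) (hz : z ∈ A) :
    s' z * (s z)⁻¹ = s' y * (s y)⁻¹ := by
  letI : TopologicalSpace G := ⊥
  haveI : DiscreteTopology G := ⟨rfl⟩
  refine hA.constant (Y := G) (f := fun y => s' y * (s y)⁻¹) (fun y hy => ?_) hz hy
  refine ContinuousAt.continuousWithinAt ?_
  refine (continuousAt_const (y := s' y * (s y)⁻¹)).congr ?_
  filter_upwards [hs y hy, hs' y hy] with z h1 h2
  rw [h1, h2]; group

theorem unique [PreconnectedSpace Y] {g : X → X → G} {f : Y → X} {s s' : Y → G}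
    (hs : ∀ y, PrimAt g f s y) (hs' : ∀ y, PrimAt g f s' y) (y z : Y) :
    s' z * (s z)⁻¹ = s' y * (s y)⁻¹ :=
  unique_set isPreconnected_univ (fun y _ => hs y) (fun y _ => hs' y)
    (Set.mem_univ y) (Set.mem_univ z)

end PrimAt

/-- The total space of the covering attached to a cocycle. -/
structure Tot (g : X → X → G) where
  pt : X
  lab : G

namespace Tot

variable {g : X → X → G}

instance : TopologicalSpace (Tot g) :=
  TopologicalSpace.mkOfNhds fun p => map (fun z => ⟨z, p.lab * g p.pt z⟩) (𝓝 p.pt)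

theorem nhds_eq (hg : ∀ x, CocycleAt g x) (p : Tot g) :
    𝓝 p = map (fun z => ⟨z, p.lab * g p.pt z⟩) (𝓝 p.pt) := by
  refine TopologicalSpace.nhds_mkOfNhds _ _ ?_ ?_
  · intro p s hs
    have h1 := Eventually.self_of_nhds (p := fun z => (⟨z, p.lab * g p.pt z⟩ : Tot g) ∈ s) hs
    rw [(hg p.pt).self_eq_one, mul_one] at h1
    exact h1
  · intro p s hs
    have h1 : ∀ᶠ z in 𝓝 p.pt, (⟨z, p.lab * g p.pt z⟩ : Tot g) ∈ s := hs
    change ∀ᶠ y in 𝓝 p.pt, ∀ᶠ z in 𝓝 y, (⟨z, p.lab * g p.pt y * g y z⟩ : Tot g) ∈ s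
    filter_upwards [eventually_eventually_nhds.2 h1, hg p.pt] with y hy h2
    filter_upwards [hy, h2] with z hz h3
    rwa [mul_assoc, ← h3]

theorem continuous_pt (hg : ∀ x, CocycleAt g x) : Continuous (pt : Tot g → X) := by
  refine continuous_iff_continuousAt.2 fun p => ?_
  rw [ContinuousAt, nhds_eq hg, tendsto_map'_iff]
  exact tendsto_id

/-- Continuity of a map to the total space. -/
theorem continuousAt_iff (hg : ∀ x, CocycleAt g x) {f : Y → Tot g} {y : Y} :
    ContinuousAt f y ↔ ContinuousAt (fun y => (f y).pt) y ∧
      PrimAt g (fun y => (f y).pt) (fun y => (f y).lab) y := by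
  constructor
  · intro h
    refine ⟨((continuous_pt hg).tendsto _).comp h, ?_⟩
    have : ∀ᶠ q in 𝓝 (f y), q.lab = (f y).lab * g (f y).pt q.pt := by
      rw [nhds_eq hg, eventually_map]
      exact Eventually.of_forall fun z => rfl
    exact h.eventually this
  · rintro ⟨h1, h2⟩
    rw [ContinuousAt, nhds_eq hg]
    have : (fun y => f y) =ᶠ[𝓝 y] fun z => ⟨(f z).pt, (f y).lab * g (f y).pt (f z).pt⟩ := by
      filter_upwards [h2] with z hz
      rw [← hz]
    refine Tendsto.congr' this.symm ?_
    exact (tendsto_map (f := fun z => (⟨z, (f y).lab * g (f y).pt z⟩ : Tot g))).comp h1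

theorem isCoveringMap (hg : ∀ x, CocycleAt g x) : IsCoveringMap (pt : Tot g → X) := by
  letI : TopologicalSpace G := ⊥
  haveI : DiscreteTopology G := ⟨rfl⟩
  have key : ∀ x, IsEvenlyCovered (pt : Tot g → X) x G := by
    intro x
    set W : Set X := interior {y | ∀ᶠ z in 𝓝 y, g x z = g x y * g y z} with hW
    have hxW : x ∈ W := mem_interior_iff_mem_nhds.2 (hg x)
    have hWz : ∀ y ∈ W, ∀ᶠ z in 𝓝 y, g x z = g x y * g y z := fun y hy =>
      interior_subset (s := {y | ∀ᶠ z in 𝓝 y, g x z = g x y * g y z}) hy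
    let t : Bundle.Trivialization G (pt : Tot g → X) :=
      { toFun p := (p.pt, p.lab * (g x p.pt)⁻¹)
        invFun q := ⟨q.1, q.2 * g x q.1⟩
        source := pt ⁻¹' W
        target := W ×ˢ Set.univ
        map_source' p hp := ⟨hp, trivial⟩
        map_target' q hq := hq.1
        left_inv' p hp := by simp
        right_inv' q hq := by simp
        open_source := isOpen_interior.preimage (continuous_pt hg)
        open_target := isOpen_interior.prod isOpen_univ
        continuousOn_toFun := by
          intro p hp
          refine ContinuousAt.continuousWithinAt ((continuous_pt hg).continuousAt.prodMk ?_)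
          refine (continuousAt_const (y := p.lab * (g x p.pt)⁻¹)).congr ?_
          change ∀ᶠ q in 𝓝 p, _
          rw [nhds_eq hg, eventually_map]
          filter_upwards [hWz _ hp] with z hz
          rw [hz]; group
        continuousOn_invFun := by
          intro q hq
          refine ContinuousAt.continuousWithinAt ((continuousAt_iff hg).2 ⟨continuousAt_fst, ?_⟩)
          have h1 : ∀ᶠ r in 𝓝 q, r.2 = q.2 :=
            continuousAt_snd.eventually (by simp [nhds_discrete] : ∀ᶠ e in 𝓝 q.2, e = q.2)
          filter_upwards [h1, continuousAt_fst.eventually (hWz q.1 hq.1)] with r h2 h3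
          rw [h2, h3, mul_assoc]
        baseSet := W
        open_baseSet := isOpen_interior
        source_eq := rfl
        target_eq := rfl
        proj_toFun p hp := rfl }
    exact IsEvenlyCovered.of_trivialization (t := t) hxW
  exact fun x => (key x).to_isEvenlyCovered_preimage

end Tot

/-- On a simply connected, locally path connected space every cocycle has primitives. -/
theorem exists_prim [SimplyConnectedSpace Y] [LocallyPathConnectedSpace Y]
    {g : X → X → G} {f : Y → X} (hf : Continuous f) (hg : ∀ y, CocycleAt g (f y)) (y₀ : Y) (k : G) :
    ∃ s : Y → G, (∀ y, PrimAt g f s y) ∧ s y₀ = k := by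
  have hg' : ∀ y, CocycleAt (fun a b => g (f a) (f b)) y := fun y => (hg y).comp hf
  obtain ⟨F, ⟨h1, h2⟩, -⟩ := (Tot.isCoveringMap hg').existsUnique_continuousMap_lifts
    (ContinuousMap.id Y) y₀ ⟨y₀, k⟩ rfl
  refine ⟨fun y => (F y).lab, fun y => ?_, congrArg Tot.lab h1⟩
  have h3 : ∀ y, (F y).pt = y := fun y => congrFun h2 y
  have := ((Tot.continuousAt_iff hg').1 (F.continuous.continuousAt (x := y))).2
  simpa only [PrimAt, h3] using this

end Cocycles

instance : LocallyPathConnectedSpace I :=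
  (Topology.IsQuotientMap.of_inverse (f := (Subtype.val : I → ℝ))
    (g := Set.projIcc (0 : ℝ) 1 zero_le_one) continuous_subtype_val continuous_projIcc
    (fun x => by simp)).locallyPathConnectedSpace

instance : ContractibleSpace I :=
  (convex_Icc (0 : ℝ) 1).contractibleSpace ⟨0, by simp⟩

/-- The fundamental group, with multiplication in path order. -/
def Pi1 {X : Type} [TopologicalSpace X] (x : X) : Type := Path.Homotopic.Quotient x x

namespace Pi1

variable {X : Type} [TopologicalSpace X] {x : X}

def mk (γ : Path x x) : Pi1 x := Path.Homotopic.Quotient.mk γ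

noncomputable instance : Group (Pi1 x) where
  mul a b := Path.Homotopic.Quotient.trans a b
  one := Path.Homotopic.Quotient.refl x
  inv a := Path.Homotopic.Quotient.symm a
  mul_assoc a b c := Path.Homotopic.Quotient.trans_assoc a b c
  one_mul a := Path.Homotopic.Quotient.refl_trans a
  mul_one a := Path.Homotopic.Quotient.trans_refl a
  inv_mul_cancel a := Path.Homotopic.Quotient.symm_trans a

theorem mk_surjective (a : Pi1 x) : ∃ γ : Path x x, mk γ = a :=
  Path.Homotopic.Quotient.mk_surjective a

theorem mk_eq {γ γ' : Path x x} : mk γ = mk γ' ↔ γ.Homotopic γ' := Path.Homotopic.Quotient.eq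

theorem mk_trans (γ γ' : Path x x) : mk (γ.trans γ') = mk γ * mk γ' :=
  Path.Homotopic.Quotient.mk_trans γ γ'

theorem mk_symm (γ : Path x x) : mk γ.symm = (mk γ)⁻¹ :=
  Path.Homotopic.Quotient.mk_symm γ

theorem mk_refl : mk (Path.refl x) = 1 := rfl

end Pi1

section Holonomy

variable {X Y : Type} [TopologicalSpace X] [TopologicalSpace Y]
variable {G H : Type} [Group G] [Group H] {g : X → X → G}

theorem PrimAt.eq_of_const [PreconnectedSpace Y] {x : X} (hx : CocycleAt g x) {f : Y → X}
    (hf : ∀ y, f y = x) {s : Y → G} (hs : ∀ y, PrimAt g f s y) (y z : Y) : s y = s z := by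
  have h1 : ∀ y, PrimAt g f (fun _ => (1 : G)) y := fun y => Eventually.of_forall fun z => by
    rw [hf, hf, hx.self_eq_one, one_mul]
  simpa using PrimAt.unique hs h1 z y

/-- The holonomy of a cocycle along a path. -/
noncomputable def holPath (hg : ∀ x, CocycleAt g x) {x y : X} (γ : Path x y) : G :=
  (Classical.choose (exists_prim γ.continuous (fun t => hg (γ t)) 0 (1 : G))) 1

theorem holPath_eq (hg : ∀ x, CocycleAt g x) {x y : X} (γ : Path x y) {s : I → G}
    (hs : ∀ t, PrimAt g γ s t) : holPath hg γ = (s 0)⁻¹ * s 1 := by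
  have h := Classical.choose_spec (exists_prim γ.continuous (fun t => hg (γ t)) 0 (1 : G))
  have h1 := PrimAt.unique hs h.1 0 1
  rw [h.2] at h1
  rw [holPath, eq_mul_of_mul_inv_eq h1, one_mul]

theorem holPath_trans (hg : ∀ x, CocycleAt g x) {x y z : X} (γ : Path x y) (γ' : Path y z) :
    holPath hg (γ.trans γ') = holPath hg γ * holPath hg γ' := by
  obtain ⟨s, hs, -⟩ := exists_prim (γ.trans γ').continuous (fun t => hg (γ.trans γ' t)) 0 (1 : G)
  let a : I → I := fun t => ⟨t / 2, by have := t.2.1; have := t.2.2; constructor <;> linarith⟩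
  let b : I → I := fun t => ⟨(1 + t) / 2, by have := t.2.1; have := t.2.2; constructor <;> linarith⟩
  have ha : Continuous a := by fun_prop
  have hb : Continuous b := by fun_prop
  have h1 : (γ.trans γ') ∘ a = γ := by
    funext t
    have : ((a t : I) : ℝ) ≤ 1 / 2 := by have := t.2.2; simp only [a]; linarith
    rw [Function.comp_apply, Path.trans_apply, dif_pos this]
    congr 1; ext; simp [a]; ring
  have h2 : (γ.trans γ') ∘ b = γ' := by
    funext t
    rw [Function.comp_apply, Path.trans_apply]
    split_ifs with h
    · have h0 : t = 0 := Subtype.ext (le_antisymm (by simp only [b] at h; simp only [Set.Icc.coe_zero]; linarith) t.2.1)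
      subst h0
      rw [γ'.source]
      convert γ.target using 2
      ext; simp [b]
    · congr 1; ext; simp [b]; ring
  have h3 := holPath_eq hg γ (s := s ∘ a) fun t => h1 ▸ (hs (a t)).comp ha.continuousAt
  have h4 := holPath_eq hg γ' (s := s ∘ b) fun t => h2 ▸ (hs (b t)).comp hb.continuousAt
  rw [h3, h4, holPath_eq hg _ hs]
  have e0 : a 0 = 0 := by ext; simp [a]
  have e1 : a 1 = b 0 := by ext; simp [a, b]
  have e2 : b 1 = 1 := by ext; simp [b]
  simp only [Function.comp_apply, e0, e1, e2]
  group

theorem holPath_homotopic (hg : ∀ x, CocycleAt g x) {x y : X} {γ γ' : Path x y}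
    (h : γ.Homotopic γ') : holPath hg γ = holPath hg γ' := by
  obtain ⟨F⟩ := h
  obtain ⟨s, hs, -⟩ := exists_prim (f := fun p : I × I => F p) F.continuous (fun t => hg _) (0, 0)
    (1 : G)
  have h1 := holPath_eq hg γ (s := fun t => s (0, t)) fun t => by
    have := (hs (0, t)).comp (φ := fun t : I => ((0 : I), t)) (by fun_prop)
    have e : (fun p : I × I => F p) ∘ (fun t : I => ((0 : I), t)) = γ := by
      funext t; simp
    rwa [e] at this
  have h2 := holPath_eq hg γ' (s := fun t => s (1, t)) fun t => by
    have := (hs (1, t)).comp (φ := fun t : I => ((1 : I), t)) (by fun_prop)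
    have e : (fun p : I × I => F p) ∘ (fun t : I => ((1 : I), t)) = γ' := by
      funext t; simp
    rwa [e] at this
  have h3 : s (0, 0) = s (1, 0) := PrimAt.eq_of_const (hg x) (f := fun t : I => F (t, 0))
    (fun t => by simp) (s := fun t => s (t, 0))
    (fun t => (hs (t, 0)).comp (φ := fun t : I => (t, (0 : I))) (by fun_prop)) 0 1
  have h4 : s (0, 1) = s (1, 1) := PrimAt.eq_of_const (hg y) (f := fun t : I => F (t, 1))
    (fun t => by simp) (s := fun t => s (t, 1))
    (fun t => (hs (t, 1)).comp (φ := fun t : I => (t, (1 : I))) (by fun_prop)) 0 1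
  rw [h1, h2, h3, h4]

theorem holPath_refl (hg : ∀ x, CocycleAt g x) (x : X) : holPath hg (Path.refl x) = 1 := by
  rw [holPath_eq hg _ (s := fun _ => 1) fun t => Eventually.of_forall fun z => by
    simp [(hg x).self_eq_one]]
  simp

theorem holPath_symm (hg : ∀ x, CocycleAt g x) {x y : X} (γ : Path x y) :
    holPath hg γ.symm = (holPath hg γ)⁻¹ := by
  refine (eq_inv_of_mul_eq_one_right ?_)
  rw [← holPath_trans, holPath_homotopic hg (Path.Homotopic.trans_symm γ), holPath_refl]

/-- The holonomy homomorphism of a cocycle. -/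
noncomputable def hol (hg : ∀ x, CocycleAt g x) (x : X) : Pi1 x →* G where
  toFun a := Quotient.liftOn a (fun γ => holPath hg γ) fun _ _ h => holPath_homotopic hg h
  map_one' := holPath_refl hg x
  map_mul' := by
    intro a b
    obtain ⟨γ, rfl⟩ := Pi1.mk_surjective a
    obtain ⟨γ', rfl⟩ := Pi1.mk_surjective b
    rw [← Pi1.mk_trans]
    exact holPath_trans hg γ γ'

theorem hol_mk (hg : ∀ x, CocycleAt g x) {x : X} (γ : Path x x) :
    hol hg x (Pi1.mk γ) = holPath hg γ := rfl

theorem holPath_comp (hg : ∀ x, CocycleAt g x) (q : G →* H) {x y : X} (γ : Path x y) :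
    holPath (fun x => (hg x).hom q) γ = q (holPath hg γ) := by
  obtain ⟨s, hs, -⟩ := exists_prim γ.continuous (fun t => hg (γ t)) 0 (1 : G)
  rw [holPath_eq hg γ hs, holPath_eq _ γ fun t => (hs t).hom q, map_mul, map_inv]

theorem holPath_coboundary (hg : ∀ x, CocycleAt g x) {g' : X → X → G} (hg' : ∀ x, CocycleAt g' x)
    (t : X → G) (h : ∀ x, ∀ᶠ y in 𝓝 x, g' x y = t x * g x y * (t y)⁻¹) {x y : X} (γ : Path x y) :
    holPath hg' γ = t x * holPath hg γ * (t y)⁻¹ := by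
  obtain ⟨s, hs, -⟩ := exists_prim γ.continuous (fun t => hg (γ t)) 0 (1 : G)
  rw [holPath_eq hg γ hs, holPath_eq hg' γ (s := fun r => s r * (t (γ r))⁻¹)]
  · simp only [γ.source, γ.target]; group
  · intro r
    filter_upwards [hs r, γ.continuous.continuousAt.eventually (h (γ r))] with z h1 h2
    rw [h1, h2]; group

theorem holPath_congr (hg : ∀ x, CocycleAt g x) {g' : X → X → G} (hg' : ∀ x, CocycleAt g' x)
    (h : ∀ x, ∀ᶠ y in 𝓝 x, g' x y = g x y) {x y : X} (γ : Path x y) :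
    holPath hg' γ = holPath hg γ := by
  have := holPath_coboundary hg hg' (fun _ => 1) (fun x => by simpa using h x) γ
  simpa using this

theorem holPath_map {g : Y → Y → G} (hg : ∀ y, CocycleAt g y) {f : X → Y} (hf : Continuous f)
    {x y : X} (γ : Path x y) :
    holPath (fun x => (hg (f x)).comp hf) γ = holPath hg (γ.map hf) := by
  obtain ⟨s, hs, -⟩ := exists_prim (γ.map hf).continuous (fun t => hg (γ.map hf t)) 0 (1 : G)
  rw [holPath_eq hg _ hs, holPath_eq _ γ hs]

end Holonomy

/-- Every point is the centre of a chart modelled on the plane. -/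
def PlaneCharts (X : Type) [TopologicalSpace X] : Prop :=
  ∀ x : X, ∃ φ : ℂ → X, IsOpenEmbedding φ ∧ φ 0 = x

section

variable {X Y : Type} [TopologicalSpace X] [TopologicalSpace Y] {G H : Type} [Group G] [Group H]

theorem homotopic_of_range_subset {φ : ℂ → X} (hφ : IsOpenEmbedding φ) {a b : X} (γ γ' : Path a b)
    (h : ∀ t, γ t ∈ Set.range φ) (h' : ∀ t, γ' t ∈ Set.range φ) : γ.Homotopic γ' := by
  let e : ℂ ≃ₜ Set.range φ := hφ.toIsEmbedding.toHomeomorph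
  have he : ∀ z, φ (e.symm z) = z := fun z => congrArg Subtype.val (e.apply_symm_apply z)
  have ha : a ∈ Set.range φ := by simpa using h 0
  have hb : b ∈ Set.range φ := by simpa using h 1
  let lift (δ : Path a b) (hδ : ∀ t, δ t ∈ Set.range φ) : Path (e.symm ⟨a, ha⟩) (e.symm ⟨b, hb⟩) :=
    { toFun t := e.symm ⟨δ t, hδ t⟩
      continuous_toFun := e.symm.continuous.comp (δ.continuous.subtype_mk hδ)
      source' := by simp
      target' := by simp }
  have h1 := (SimplyConnectedSpace.paths_homotopic (lift γ h) (lift γ' h')).map ⟨φ, hφ.continuous⟩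
  have h2 := h1.pathCast (he ⟨a, ha⟩).symm (he ⟨b, hb⟩).symm
  have h3 : ∀ (δ : Path a b) (hδ : ∀ t, δ t ∈ Set.range φ),
      ((lift δ hδ).map hφ.continuous).cast (he ⟨a, ha⟩).symm (he ⟨b, hb⟩).symm = δ := by
    intro δ hδ; ext t; exact he ⟨δ t, hδ t⟩
  have h4 := h3 γ h
  have h5 := h3 γ' h'
  rw [← h4, ← h5]
  exact h2

theorem PlaneCharts.locallyPathConnectedSpace (hX : PlaneCharts X) :
    LocallyPathConnectedSpace X := by
  rw [locallyPathConnectedSpace_iff_pathComponentIn_mem_nhds]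
  intro x u hu hxu
  obtain ⟨φ, hφ, rfl⟩ := hX x
  have h1 := (hu.preimage hφ.continuous).pathComponentIn 0
  have h2 : φ '' pathComponentIn (φ ⁻¹' u) 0 ∈ 𝓝 (φ 0) :=
    (hφ.isOpenMap _ h1).mem_nhds ⟨0, mem_pathComponentIn_self hxu, rfl⟩
  refine mem_of_superset h2 ?_
  have h3 : IsPathConnected (φ '' pathComponentIn (φ ⁻¹' u) 0) :=
    (isPathConnected_pathComponentIn (F := φ ⁻¹' u) hxu).image hφ.continuous
  exact h3.subset_pathComponentIn ⟨0, mem_pathComponentIn_self hxu, rfl⟩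
    ((Set.image_mono pathComponentIn_subset).trans (Set.image_preimage_subset _ _))

theorem PlaneCharts.eventually_joinedIn (hX : PlaneCharts X) {x : X} {V : Set X} (hV : V ∈ 𝓝 x) :
    ∀ᶠ y in 𝓝 x, JoinedIn V x y := by
  have := hX.locallyPathConnectedSpace
  obtain ⟨s, hs, hs'⟩ := (path_connected_basis x).mem_iff.1 hV
  filter_upwards [hs.1] with y hy
  exact (hs.2.joinedIn x (mem_of_mem_nhds hs.1) y hy).mono hs'

/-- The universal cocycle: its holonomy is the identity of the fundamental group. -/
theorem exists_universal_cocycle (hX : PlaneCharts X) [PathConnectedSpace X] (x₀ : X) :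
    ∃ g : X → X → Pi1 x₀, ∃ hg : ∀ x, CocycleAt g x, ∀ a, hol hg x₀ a = a := by
  classical
  choose φ hφ hφ0 using hX
  let τ : ∀ x, Path x₀ x := fun x =>
    if h : x₀ = x then (Path.refl x₀).cast rfl h.symm else (PathConnectedSpace.joined x₀ x).somePath
  have hτ : τ x₀ = Path.refl x₀ := by simp only [τ, dif_pos]; rfl
  let P : ∀ x y, Path x y → Prop := fun x y ρ => ∀ t, ρ t ∈ Set.range (φ x)
  let g : X → X → Pi1 x₀ := fun x y =>
    if h : ∃ ρ, P x y ρ then Pi1.mk (((τ x).trans h.choose).trans (τ y).symm) else 1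
  have hgρ : ∀ x y (ρ : Path x y), P x y ρ → g x y = Pi1.mk (((τ x).trans ρ).trans (τ y).symm) := by
    intro x y ρ hρ
    have h : ∃ ρ, P x y ρ := ⟨ρ, hρ⟩
    simp only [g, dif_pos h]
    rw [Pi1.mk_eq]
    exact ((Path.Homotopic.refl _).hcomp
      (homotopic_of_range_subset (hφ x) _ _ h.choose_spec hρ)).hcomp (Path.Homotopic.refl _)
  have hmem : ∀ x, Set.range (φ x) ∈ 𝓝 x := fun x =>
    (hφ x).isOpen_range.mem_nhds ⟨0, hφ0 x⟩
  have hX : PlaneCharts X := fun x => ⟨φ x, hφ x, hφ0 x⟩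
  have hg : ∀ x, CocycleAt g x := by
    intro x
    filter_upwards [hX.eventually_joinedIn (hmem x), (hφ x).isOpen_range.mem_nhds ⟨0, hφ0 x⟩]
      with y hy hy'
    obtain ⟨ρ, hρ⟩ := hy
    filter_upwards [hX.eventually_joinedIn
      (inter_mem ((hφ x).isOpen_range.mem_nhds hy') (hmem y))] with z hz
    obtain ⟨ρ', hρ'⟩ := hz
    rw [hgρ x y ρ hρ, hgρ y z ρ' fun t => (hρ' t).2, hgρ x z (ρ.trans ρ') ?_]
    · change Path.Homotopic.Quotient.mk _ = Path.Homotopic.Quotient.trans (Path.Homotopic.Quotient.mk _) (Path.Homotopic.Quotient.mk _)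
      simp only [Path.Homotopic.Quotient.mk_trans, Path.Homotopic.Quotient.mk_symm, Path.Homotopic.Quotient.trans_assoc]
      rw [← Path.Homotopic.Quotient.trans_assoc (Path.Homotopic.Quotient.mk (τ y)).symm, Path.Homotopic.Quotient.symm_trans,
        Path.Homotopic.Quotient.refl_trans]
    · intro t
      have : ρ.trans ρ' t ∈ Set.range (ρ.trans ρ') := ⟨t, rfl⟩
      rw [Path.trans_range] at this
      rcases this with ⟨s, hs⟩ | ⟨s, hs⟩
      · rw [← hs]; exact hρ s
      · rw [← hs]; exact (hρ' s).1
  refine ⟨g, hg, fun a => ?_⟩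
  obtain ⟨γ, rfl⟩ := Pi1.mk_surjective a
  rw [hol_mk]
  let A : ∀ t : I, Path x₀ (γ t) := fun t => (γ.subpath 0 t).cast γ.source.symm rfl
  rw [holPath_eq hg γ (s := fun t => Pi1.mk ((A t).trans (τ (γ t)).symm))]
  · have h0 : Pi1.mk ((A 0).trans (τ (γ 0)).symm) = 1 := by
      have : ∀ x (h : x₀ = x) (p : Path x₀ x), p = (Path.refl x₀).cast rfl h.symm →
          Pi1.mk (p.trans (τ x).symm) = 1 := by
        rintro x rfl p rfl
        rw [hτ]
        rw [Pi1.mk_trans, Pi1.mk_symm]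
        change Pi1.mk (Path.refl x₀) * (Pi1.mk (Path.refl x₀))⁻¹ = 1
        rw [mul_inv_cancel]
      refine this _ γ.source.symm _ ?_
      ext t
      simp [A]
    have h1 : Pi1.mk ((A 1).trans (τ (γ 1)).symm) = Pi1.mk γ := by
      have : ∀ x (h : x₀ = x) (p : Path x₀ x), p = γ.cast rfl h.symm →
          Pi1.mk (p.trans (τ x).symm) = Pi1.mk γ := by
        rintro x rfl p rfl
        rw [hτ]
        rw [Pi1.mk_trans, Pi1.mk_symm, Pi1.mk_refl, inv_one, mul_one]
        rfl
      refine this _ γ.target.symm _ ?_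
      ext t
      simp [A]
    simp only [h0, h1]
    simp
  · intro t
    have h1 : γ ⁻¹' Set.range (φ (γ t)) ∈ 𝓝 t := γ.continuous.continuousAt (hmem (γ t))
    obtain ⟨ε, hε, hball⟩ := Metric.mem_nhds_iff.1 h1
    filter_upwards [Metric.ball_mem_nhds t hε] with t' ht'
    rw [hgρ _ _ (γ.subpath t t')]
    · change Path.Homotopic.Quotient.mk _ = Path.Homotopic.Quotient.trans (Path.Homotopic.Quotient.mk _) (Path.Homotopic.Quotient.mk _)
      have h2 : Path.Homotopic.Quotient.mk (A t') = Path.Homotopic.Quotient.trans (Path.Homotopic.Quotient.mk (A t))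
          (Path.Homotopic.Quotient.mk (γ.subpath t t')) := by
        rw [← Path.Homotopic.Quotient.mk_trans, Path.Homotopic.Quotient.eq]
        have h3 : ((γ.subpath 0 t).trans (γ.subpath t t')).Homotopic (γ.subpath 0 t') :=
          ⟨Path.Homotopy.subpathTransSubpath γ 0 t t'⟩
        have := h3.symm.pathCast γ.source.symm rfl
        convert this using 1
        ext r
        simp [A, Path.trans_apply]
      simp only [Path.Homotopic.Quotient.mk_trans, Path.Homotopic.Quotient.mk_symm, h2, Path.Homotopic.Quotient.trans_assoc]
      rw [← Path.Homotopic.Quotient.trans_assoc (Path.Homotopic.Quotient.mk (τ (γ t))).symm, Path.Homotopic.Quotient.symm_trans,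
        Path.Homotopic.Quotient.refl_trans]
    · intro r
      have h2 : γ.subpath t t' r ∈ γ '' Set.uIcc t t' := by
        rw [← Path.range_subpath]; exact ⟨r, rfl⟩
      obtain ⟨u, hu, hu'⟩ := h2
      rw [← hu']
      apply hball
      rw [Metric.mem_ball, Subtype.dist_eq, Real.dist_eq] at ht' ⊢
      refine lt_of_le_of_lt (Set.abs_sub_left_of_mem_uIcc ?_) ht'
      rcases Set.mem_uIcc.1 hu with h | h
      · exact Set.mem_uIcc.2 (Or.inl h)
      · exact Set.mem_uIcc.2 (Or.inr h)

end

section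

variable {N : Type} [TopologicalSpace N] {E Q : Type} [Group E] [Group Q]

/-- `k` lifts, germwise, the cocycle `g` through `q`. -/
def IsLift (q : E →* Q) (g : N → N → Q) (k : N → N → E) : Prop :=
  ∀ x, ∀ᶠ y in 𝓝 x, q (k x y) = g x y

open Classical in
/-- Replace `k` inside the disc of radius `R` of a chart by `m`. -/
noncomputable def patch (φ : ℂ → N) (R : ℝ) (k : N → N → E) (m : ℂ → ℂ → E) : N → N → E :=
  fun x y => if x ∈ φ '' ball 0 R ∧ y ∈ φ '' ball 0 R then
    m (Function.invFun φ x) (Function.invFun φ y) else k x y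

variable {φ : ℂ → N} {R : ℝ} {k : N → N → E} {m : ℂ → ℂ → E}

theorem patch_in (hφ : IsOpenEmbedding φ) {u v : ℂ} (hu : u ∈ ball 0 R) (hv : v ∈ ball 0 R) :
    patch φ R k m (φ u) (φ v) = m u v := by
  rw [patch, if_pos ⟨⟨u, hu, rfl⟩, ⟨v, hv, rfl⟩⟩, Function.leftInverse_invFun hφ.injective,
    Function.leftInverse_invFun hφ.injective]

theorem patch_out {x y : N} (h : ¬ (x ∈ φ '' ball 0 R ∧ y ∈ φ '' ball 0 R)) :
    patch φ R k m x y = k x y := if_neg h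

theorem exists_patch [T2Space N] (hφ : IsOpenEmbedding φ) {q : E →* Q} {g : N → N → Q} {L : Set N}
    (hk : IsLift q g k) (h1 : ∀ u ∈ ball 0 R, ∀ᶠ v in 𝓝 u, q (m u v) = g (φ u) (φ v))
    (h2 : ∀ u ∈ ball 0 R, u ≠ 0 → CocycleAt m u)
    (h3 : ∀ u, ‖u‖ = R → φ u ∈ L → ∀ᶠ a in 𝓝 u, ∀ᶠ b in 𝓝 a, a ∈ ball 0 R → b ∈ ball 0 R →
      m a b = k (φ a) (φ b)) :
    ∃ k' : N → N → E, IsLift q g k' ∧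
      (∀ x y, ¬ (x ∈ φ '' ball 0 R ∧ y ∈ φ '' ball 0 R) → k' x y = k x y) ∧
      (∀ u ∈ ball 0 R, u ≠ 0 → CocycleAt k' (φ u)) ∧
      ∀ x ∈ L, x ∉ φ '' ball 0 R → CocycleAt k x → CocycleAt k' x := by
  have hev : ∀ u ∈ ball (0 : ℂ) R, ∀ᶠ v in 𝓝 u, v ∈ ball (0 : ℂ) R := fun u hu =>
    isOpen_ball.mem_nhds hu
  refine ⟨patch φ R k m, ?_, fun x y h => patch_out h, ?_, ?_⟩
  · intro x
    by_cases hx : x ∈ φ '' ball 0 R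
    · obtain ⟨u, hu, rfl⟩ := hx
      rw [← hφ.map_nhds_eq, eventually_map]
      filter_upwards [h1 u hu, hev u hu] with v hv hv'
      rw [patch_in hφ hu hv', hv]
    · filter_upwards [hk x] with y hy
      rw [patch_out fun h => hx h.1, hy]
  · intro u hu h0
    unfold CocycleAt
    rw [← hφ.map_nhds_eq, eventually_map]
    filter_upwards [h2 u hu h0, hev u hu] with v hv hv'
    rw [← hφ.map_nhds_eq, eventually_map]
    filter_upwards [hv, hev v hv'] with w hw hw'
    rw [patch_in hφ hu hv', patch_in hφ hu hw', patch_in hφ hv' hw', hw]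
  · intro x hxL hx hgood
    refine hgood.congr ?_
    by_cases hx' : x ∈ φ '' closedBall 0 R
    · obtain ⟨u, hu, rfl⟩ := hx'
      have huR : ‖u‖ = R := by
        have h4 : u ∉ ball 0 R := fun h => hx ⟨u, h, rfl⟩
        rw [mem_ball_zero_iff] at h4
        rw [mem_closedBall_zero_iff] at hu
        linarith
      rw [← hφ.map_nhds_eq, eventually_map]
      filter_upwards [h3 u huR hxL] with a ha
      rw [← hφ.map_nhds_eq, eventually_map]
      filter_upwards [ha] with b hb
      by_cases h : a ∈ ball 0 R ∧ b ∈ ball 0 R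
      · rw [patch_in hφ h.1 h.2, hb h.1 h.2]
      · rw [patch_out]
        rwa [hφ.injective.mem_set_image, hφ.injective.mem_set_image]
    · have hc : IsClosed (φ '' closedBall 0 R) :=
        ((isCompact_closedBall 0 R).image hφ.continuous).isClosed
      filter_upwards [hc.isOpen_compl.mem_nhds hx'] with y hy
      refine Eventually.of_forall fun z => (patch_out fun h => hy ?_).symm
      exact Set.image_mono ball_subset_closedBall h.1

theorem exists_prim_convex {f : ℂ → N} (hf : Continuous f) {B : Set ℂ} (hB : Convex ℝ B)
    (hBo : IsOpen B) (hk : ∀ w ∈ B, CocycleAt k (f w)) : ∃ S : ℂ → E, ∀ w ∈ B, PrimAt k f S w := by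
  classical
  rcases B.eq_empty_or_nonempty with rfl | hne
  · exact ⟨fun _ => 1, by simp⟩
  have := hB.contractibleSpace hne
  have := hBo.locallyPathConnectedSpace
  obtain ⟨s, hs, -⟩ := exists_prim (f := fun w : B => f w) (hf.comp continuous_subtype_val)
    (fun w => hk w w.2) ⟨hne.choose, hne.choose_spec⟩ (1 : E)
  refine ⟨fun w => if h : w ∈ B then s ⟨w, h⟩ else 1, fun w hw => ?_⟩
  have h2 : ∀ᶠ z in map (Subtype.val : B → ℂ) (𝓝 ⟨w, hw⟩),
      (if h : z ∈ B then s ⟨z, h⟩ else 1) = (if h : w ∈ B then s ⟨w, h⟩ else 1) * k (f w) (f z) := by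
    rw [eventually_map]
    filter_upwards [hs ⟨w, hw⟩] with z hz
    simpa [hw] using hz
  rwa [hBo.isOpenEmbedding_subtypeVal.map_nhds_eq] at h2

/-- Primitives on an open set of horizontal strips. -/
theorem exists_prim_strips {f : ℂ → N} (hf : Continuous f) {q : E →* Q} (hq : Function.Surjective q)
    {g : N → N → Q} (hk : IsLift q g k) {A : Set ℝ} (hA : Convex ℝ A) (hAo : IsOpen A) {Θ : Set ℝ}
    (hΘ : IsOpen Θ) (hgood : ∀ w : ℂ, w.re ∈ A → w.im ∈ Θ → CocycleAt k (f w)) {s : ℂ → Q}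
    (hs : ∀ w, PrimAt g f s w) :
    ∃ S : ℂ → E, ∀ w : ℂ, w.re ∈ A → w.im ∈ Θ → PrimAt k f S w ∧ q (S w) = s w := by
  classical
  have key : ∀ C : Set ℝ, ∃ S : ℂ → E, C ⊆ Θ → Convex ℝ C → IsOpen C →
      ∀ w : ℂ, w.re ∈ A → w.im ∈ C → PrimAt k f S w ∧ q (S w) = s w := by
    intro C
    by_cases h : C ⊆ Θ ∧ Convex ℝ C ∧ IsOpen C
    · obtain ⟨hC, hCc, hCo⟩ := h
      set B : Set ℂ := {w | w.re ∈ A ∧ w.im ∈ C} with hBdef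
      have hB : Convex ℝ B :=
        (hA.is_linear_preimage Complex.reLm.isLinear).inter
          (hCc.is_linear_preimage Complex.imLm.isLinear)
      have hBo : IsOpen B :=
        (hAo.preimage Complex.continuous_re).inter (hCo.preimage Complex.continuous_im)
      obtain ⟨S, hS⟩ := exists_prim_convex (k := k) hf hB hBo fun w hw => hgood w hw.1 (hC hw.2)
      have hqS : ∀ w ∈ B, PrimAt g f (fun w => q (S w)) w := fun w hw =>
        ((hS w hw).hom q).congr (hf.continuousAt.eventually (hk (f w)))
      rcases B.eq_empty_or_nonempty with h0 | ⟨w₀, hw₀⟩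
      · refine ⟨S, fun _ _ _ w h1 h2 => ?_⟩
        have : w ∈ B := ⟨h1, h2⟩
        rw [h0] at this
        exact this.elim
      obtain ⟨e, he⟩ := hq (s w₀ * (q (S w₀))⁻¹)
      refine ⟨fun w => e * S w, fun _ _ _ w h1 h2 => ⟨(hS w ⟨h1, h2⟩).mul_left e, ?_⟩⟩
      have := PrimAt.unique_set hB.isPreconnected hqS (fun w _ => hs w) hw₀ ⟨h1, h2⟩
      rw [map_mul, he, ← this]
      simp
    · exact ⟨fun _ => 1, fun h1 h2 h3 => (h ⟨h1, h2, h3⟩).elim⟩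
  choose S hS using key
  let C : ℂ → Set ℝ := fun w => connectedComponentIn Θ w.im
  have hCo : ∀ w, IsOpen (C w) := fun w => hΘ.connectedComponentIn
  refine ⟨fun w => S (C w) w, fun w h1 h2 => ?_⟩
  have hw : w.im ∈ C w := mem_connectedComponentIn h2
  obtain ⟨h3, h4⟩ := hS (C w) (connectedComponentIn_subset _ _)
    (Real.convex_iff_isPreconnected.2 isPreconnected_connectedComponentIn) (hCo w) w h1 hw
  refine ⟨?_, h4⟩
  have h5 : ∀ᶠ z : ℂ in 𝓝 w, z.im ∈ C w :=
    Complex.continuous_im.continuousAt.eventually ((hCo w).mem_nhds hw)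
  filter_upwards [h3, h5] with z hz hz'
  have : C z = C w := (connectedComponentIn_eq hz').symm
  simp only [this]
  exact hz

end

theorem CocycleAt.comp_of_eventually {X Y G : Type} [TopologicalSpace X] [TopologicalSpace Y]
    [Group G] {g : X → X → G} {f : Y → X} {y : Y} (hf : ∀ᶠ z in 𝓝 y, ContinuousAt f z)
    (h : CocycleAt g (f y)) : CocycleAt (fun a b => g (f a) (f b)) y := by
  filter_upwards [hf.self_of_nhds.eventually h, hf] with a ha ha'
  exact ha'.eventually ha

section

variable {N : Type} [TopologicalSpace N] [T2Space N] {E Q : Type} [Group E] [Group Q]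
variable {φ : ℂ → N} {R : ℝ} {k : N → N → E} {q : E →* Q} {g : N → N → Q} {L : Set N}

/-- `k'` improves `k` in the disc of radius `R` of the chart `φ`. -/
def Improves (q : E →* Q) (g : N → N → Q) (φ : ℂ → N) (R : ℝ) (L : Set N) (k k' : N → N → E) :
    Prop :=
  IsLift q g k' ∧ (∀ x y, ¬ (x ∈ φ '' ball 0 R ∧ y ∈ φ '' ball 0 R) → k' x y = k x y) ∧
    (∀ x ∈ φ '' ball 0 R, x ≠ φ 0 → CocycleAt k' x) ∧
    ∀ x ∈ L, x ∉ φ '' ball 0 R → CocycleAt k x → CocycleAt k' x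

theorem exists_improves (hφ : IsOpenEmbedding φ) {m : ℂ → ℂ → E}
    (hk : IsLift q g k) (h1 : ∀ u ∈ ball 0 R, ∀ᶠ v in 𝓝 u, q (m u v) = g (φ u) (φ v))
    (h2 : ∀ u ∈ ball 0 R, u ≠ 0 → CocycleAt m u)
    (h3 : ∀ u, ‖u‖ = R → φ u ∈ L → ∀ᶠ a in 𝓝 u, ∀ᶠ b in 𝓝 a, a ∈ ball 0 R → b ∈ ball 0 R →
      m a b = k (φ a) (φ b)) : ∃ k', Improves q g φ R L k k' := by
  obtain ⟨k', h4, h5, h6, h7⟩ := exists_patch hφ hk h1 h2 h3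
  refine ⟨k', h4, h5, ?_, h7⟩
  rintro _ ⟨u, hu, rfl⟩ hne
  exact h6 u hu fun h => hne (h ▸ rfl)

theorem exists_improves_of_full (hφ : IsOpenEmbedding φ) (hR : 0 < R)
    (hq : Function.Surjective q) (hg : ∀ x, CocycleAt g x) (hk : IsLift q g k)
    (hc : ∀ u, ‖u‖ = R → CocycleAt k (φ u)) : ∃ k', Improves q g φ R L k k' := by
  classical
  obtain ⟨s, hs, -⟩ := exists_prim hφ.continuous (fun u => hg (φ u)) 0 (1 : Q)
  let U : Set ℂ := {u | CocycleAt k (φ u)}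
  have hU : IsOpen U := isOpen_iff_mem_nhds.2 fun u hu =>
    hφ.continuous.continuousAt.eventually (CocycleAt.eventually hu)
  obtain ⟨δ, hδ, hδU⟩ := (isCompact_sphere (0 : ℂ) R).exists_thickening_subset_open hU
    fun u hu => hc u (by simpa using hu)
  obtain ⟨r, hr0, hrR, hrδ⟩ : ∃ r, 0 < r ∧ r < R ∧ R - δ < r :=
    ⟨max (R - δ / 2) (R / 2), by positivity, by simp; constructor <;> linarith,
      lt_of_lt_of_le (by linarith) (le_max_left _ _)⟩
  let ρ : ℂ → ℂ := fun u => ((max 1 (r / ‖u‖) : ℝ) : ℂ) * u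
  have hρ1 : ∀ u, r ≤ ‖u‖ → ρ u = u := fun u hu => by
    have : r / ‖u‖ ≤ 1 := div_le_one_of_le₀ hu (norm_nonneg _)
    simp [ρ, max_eq_left this]
  have hρn : ∀ u, u ≠ 0 → ‖ρ u‖ = max ‖u‖ r := fun u hu => by
    have h0 : 0 < ‖u‖ := norm_pos_iff.2 hu
    simp only [ρ, norm_mul, Complex.norm_real]
    rw [Real.norm_of_nonneg (by positivity), max_mul_of_nonneg _ _ h0.le, one_mul,
      div_mul_cancel₀ _ h0.ne']
  have hρc : ∀ u, u ≠ 0 → ContinuousAt ρ u := fun u hu => by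
    have h0 : ‖u‖ ≠ 0 := norm_ne_zero_iff.2 hu
    have : ContinuousAt (fun u : ℂ => max 1 (r / ‖u‖)) u :=
      continuousAt_const.max (continuousAt_const.div continuous_norm.continuousAt h0)
    exact (Complex.continuous_ofReal.continuousAt.comp this).mul continuousAt_id
  have hρU : ∀ u ∈ ball (0 : ℂ) R, u ≠ 0 → CocycleAt k (φ (ρ u)) := by
    intro u hu h0
    rw [mem_ball_zero_iff] at hu
    apply hδU
    have hn := hρn u h0
    set w := ρ u
    have hwpos : 0 < ‖w‖ := by rw [hn]; positivity
    have hwR : ‖w‖ < R := by rw [hn]; exact max_lt hu hrR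
    have hwr : r ≤ ‖w‖ := by rw [hn]; exact le_max_right _ _
    rw [mem_thickening_iff]
    refine ⟨((R / ‖w‖ : ℝ) : ℂ) * w, ?_, ?_⟩
    · rw [mem_sphere_zero_iff_norm, norm_mul, Complex.norm_real, Real.norm_of_nonneg (by positivity),
        div_mul_cancel₀ _ hwpos.ne']
    · rw [dist_eq_norm]
      have : w - ((R / ‖w‖ : ℝ) : ℂ) * w = ((1 - R / ‖w‖ : ℝ) : ℂ) * w := by push_cast; ring
      rw [this, norm_mul, Complex.norm_real, Real.norm_eq_abs, abs_sub_comm,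
        abs_of_nonneg (by rw [sub_nonneg, le_div_iff₀ hwpos]; linarith), sub_mul,
        div_mul_cancel₀ _ hwpos.ne']
      linarith
  choose ℓ hℓ using hq
  let a : ℂ → E := fun u => if r ≤ ‖u‖ then 1 else ℓ ((s (ρ u))⁻¹ * s u)
  have ha : ∀ u, q (a u) = (s (ρ u))⁻¹ * s u := fun u => by
    by_cases h : r ≤ ‖u‖
    · simp [a, h, hρ1]
    · simp [a, h, hℓ]
  let m : ℂ → ℂ → E := fun u v => if u = 0 ∨ v = 0 then (ℓ (s u))⁻¹ * ℓ (s v) else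
    (a u)⁻¹ * k (φ (ρ u)) (φ (ρ v)) * a v
  have hm : ∀ u v, u ≠ 0 → v ≠ 0 → m u v = (a u)⁻¹ * k (φ (ρ u)) (φ (ρ v)) * a v := by
    intro u v hu hv; simp [m, hu, hv]
  refine exists_improves hφ (m := m) hk ?_ ?_ ?_
  · intro u hu
    rcases eq_or_ne u 0 with rfl | h0
    · filter_upwards [hs 0] with v hv
      simp [m, hℓ, hv]
    · have h1 : ContinuousAt (fun v => φ (ρ v)) u := hφ.continuous.continuousAt.comp (hρc u h0)
      filter_upwards [hs u, (hρc u h0).eventually (hs (ρ u)), h1.eventually (hk (φ (ρ u))),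
        isOpen_ne.mem_nhds h0] with v h2 h3 h4 h5
      rw [hm u v h0 h5, map_mul, map_mul, map_inv, ha, ha, h4, h3, h2]
      group
  · intro u hu h0
    have h1 : CocycleAt (fun x y => k (φ (ρ x)) (φ (ρ y))) u := by
      refine CocycleAt.comp_of_eventually (f := fun v => φ (ρ v)) ?_ (hρU u hu h0)
      filter_upwards [isOpen_ne.mem_nhds h0] with v hv
      exact hφ.continuous.continuousAt.comp (hρc v hv)
    have h2 : ∀ᶠ v in 𝓝 u, v ≠ 0 := isOpen_ne.mem_nhds h0
    filter_upwards [h1, eventually_eventually_nhds.2 h2] with v hv hv'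
    filter_upwards [hv, hv'] with w hw hw'
    rw [hm u v h0 hv'.self_of_nhds, hm u w h0 hw', hm v w hv'.self_of_nhds hw', hw]
    group
  · intro u hu _
    have h1 : ∀ᶠ x : ℂ in 𝓝 u, r < ‖x‖ :=
      continuous_norm.continuousAt.eventually (lt_mem_nhds (show r < ‖u‖ by rw [hu]; exact hrR))
    filter_upwards [eventually_eventually_nhds.2 h1] with x hx
    filter_upwards [hx] with y hy _ _
    have hx' := hx.self_of_nhds
    have hx0 : x ≠ 0 := norm_pos_iff.1 (hr0.trans hx')
    have hy0 : y ≠ 0 := norm_pos_iff.1 (hr0.trans hy)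
    rw [hm x y hx0 hy0, hρ1 x hx'.le, hρ1 y hy.le]
    simp [a, hx'.le, hy.le]

theorem exists_improves_of_slit (hφ : IsOpenEmbedding φ) (hR : 0 < R) (hL : IsClosed L)
    (hq : Function.Surjective q) (hg : ∀ x, CocycleAt g x) (hk : IsLift q g k)
    (hc : ∀ u, ‖u‖ = R → φ u ∈ L → CocycleAt k (φ u)) (hs : φ (-R) ∉ L) :
    ∃ k', Improves q g φ R L k k' := by
  classical
  obtain ⟨s, hs', -⟩ := exists_prim hφ.continuous (fun u => hg (φ u)) 0 (1 : Q)
  choose ℓ hℓ using id hq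
  let c : ℝ × ℝ → ℂ := fun p => Complex.exp (p.1 + p.2 * Complex.I)
  have hc' : Continuous c := by fun_prop
  let U : Set (ℝ × ℝ) := {p | CocycleAt k (φ (c p))}
  have hU : IsOpen U := isOpen_iff_mem_nhds.2 fun u hu =>
    (hφ.continuous.comp hc').continuousAt.eventually (CocycleAt.eventually hu)
  let T : Set ℝ := Set.Icc (-Real.pi) Real.pi ∩ {θ | φ (c (Real.log R, θ)) ∈ L}
  have hcn : ∀ θ, ‖c (Real.log R, θ)‖ = R := fun θ => by
    simp [c, Complex.norm_exp, Real.exp_log hR]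
  have hT : IsCompact T := isCompact_Icc.inter_right
    (hL.preimage (hφ.continuous.comp (hc'.comp (by fun_prop))))
  obtain ⟨A, Θ, hA, hΘ, hRA, hTΘ, hAΘ⟩ := generalized_tube_lemma
    (isCompact_singleton (x := Real.log R)) hT hU (by
      rintro ⟨x, θ⟩ ⟨hx, hθ⟩
      have hx' : x = Real.log R := hx
      subst hx'
      exact hc _ (hcn θ) hθ.2)
  obtain ⟨ε, hε, hεA⟩ := Metric.isOpen_iff.1 hA _ (hRA rfl)
  obtain ⟨S, hS⟩ := exists_prim_strips (k := k) (hφ.continuous.comp Complex.continuous_exp) hq hk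
    (convex_ball (Real.log R) ε) isOpen_ball hΘ (fun w h1 h2 => by
      have h3 : (w.re, w.im) ∈ U := hAΘ ⟨hεA h1, h2⟩
      have h4 : c (w.re, w.im) = Complex.exp w := by simp only [c, Complex.re_add_im]
      have h3' : CocycleAt k (φ (c (w.re, w.im))) := h3
      rw [h4] at h3'
      exact h3')
    (s := s ∘ Complex.exp) (fun w => (hs' _).comp Complex.continuous_exp.continuousAt)
  let S' : ℂ → E := fun u => if q (S (Complex.log u)) = s u then S (Complex.log u) else ℓ (s u)
  have hS' : ∀ u, q (S' u) = s u := fun u => by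
    by_cases h : q (S (Complex.log u)) = s u
    · simp [S', h]
    · simp [S', h, hℓ]
  refine exists_improves hφ (m := fun u v => (S' u)⁻¹ * S' v) hk ?_ ?_ ?_
  · intro u _
    filter_upwards [hs' u] with v hv
    simp [hS', hv]
  · intro u _ _
    exact Eventually.of_forall fun v => Eventually.of_forall fun w => by group
  · intro u hu huL
    have hu0 : u ≠ 0 := norm_pos_iff.1 (hu ▸ hR)
    have hslit : u ∈ Complex.slitPlane := by
      rw [Complex.mem_slitPlane_iff]
      by_contra h
      push Not at h
      apply hs
      have h1 : u = (u.re : ℂ) := Complex.ext rfl (by simp [h.2])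
      have h2 : -u.re = R := by
        rw [← hu, h1, Complex.norm_real, Real.norm_of_nonpos (by simpa using h.1)]
        simp
      rw [← h2]
      simpa [← h1] using huL
    have h1 : ∀ᶠ a : ℂ in 𝓝 u, a ∈ Complex.slitPlane :=
      Complex.isOpen_slitPlane.mem_nhds hslit
    have h2 : ∀ᶠ a : ℂ in 𝓝 u, (Complex.log a).re ∈ ball (Real.log R) ε := by
      refine (Complex.continuous_re.continuousAt.comp (continuousAt_clog hslit)).eventually
        (isOpen_ball.mem_nhds ?_)
      simp [Complex.log_re, hu, hε]
    have h3 : ∀ᶠ a : ℂ in 𝓝 u, (Complex.log a).im ∈ Θ := by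
      refine (Complex.continuous_im.continuousAt.comp (continuousAt_clog hslit)).eventually
        (hΘ.mem_nhds (hTΘ ?_))
      refine ⟨⟨(Complex.neg_pi_lt_log_im u).le, Complex.log_im_le_pi u⟩, ?_⟩
      have h4 : c (Real.log R, (Complex.log u).im) = u := by
        have : Real.log R = (Complex.log u).re := by rw [Complex.log_re, hu]
        simp only [c, this, Complex.re_add_im, Complex.exp_log hu0]
      simpa [h4] using huL
    have h5 : ∀ᶠ a : ℂ in 𝓝 u, a ∈ Complex.slitPlane ∧ S' a = S (Complex.log a) ∧
        PrimAt k (φ ∘ Complex.exp) S (Complex.log a) := by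
      filter_upwards [h1, h2, h3] with a h1 h2 h3
      obtain ⟨h6, h7⟩ := hS _ h2 h3
      rw [Function.comp_apply, Complex.exp_log (Complex.slitPlane_ne_zero h1)] at h7
      exact ⟨h1, by simp [S', h7], h6⟩
    filter_upwards [eventually_eventually_nhds.2 h5] with a ha
    obtain ⟨ha1, ha2, ha3⟩ := ha.self_of_nhds
    filter_upwards [ha, ha3.comp (continuousAt_clog ha1)] with b hb hb' _ _
    simp only [Function.comp_apply, Complex.exp_log (Complex.slitPlane_ne_zero ha1),
      Complex.exp_log (Complex.slitPlane_ne_zero hb.1)] at hb'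
    rw [ha2, hb.2.1, hb']
    group

theorem exists_improves_of_circle (hφ : IsOpenEmbedding φ) (hR : 0 < R) (hL : IsClosed L)
    (hq : Function.Surjective q) (hg : ∀ x, CocycleAt g x) (hk : IsLift q g k)
    (hc : ∀ u, ‖u‖ = R → φ u ∈ L → CocycleAt k (φ u)) :
    ∃ k', Improves q g φ R L k k' := by
  by_cases h : ∀ u, ‖u‖ = R → φ u ∈ L
  · exact exists_improves_of_full hφ hR hq hg hk fun u hu => hc u hu (h u hu)
  push Not at h
  obtain ⟨u₀, hu₀, hu₀L⟩ := h
  have hR' : (R : ℂ) ≠ 0 := Complex.ofReal_ne_zero.2 hR.ne'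
  set c : ℂ := -u₀ / R with hcdef
  have hcn : ‖c‖ = 1 := by
    rw [hcdef, norm_div, norm_neg, hu₀, Complex.norm_real, Real.norm_of_nonneg hR.le,
      div_self hR.ne']
  have hc0 : c ≠ 0 := norm_ne_zero_iff.1 (by rw [hcn]; exact one_ne_zero)
  have hφ' : IsOpenEmbedding (fun u => φ (c * u)) :=
    hφ.comp (Homeomorph.mulLeft₀ c hc0).isOpenEmbedding
  have him : (fun u => φ (c * u)) '' ball 0 R = φ '' ball 0 R := by
    ext x
    constructor
    · rintro ⟨u, hu, rfl⟩
      exact ⟨c * u, by simpa [hcn] using hu, rfl⟩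
    · rintro ⟨u, hu, rfl⟩
      refine ⟨c⁻¹ * u, by simpa [hcn] using hu, ?_⟩
      simp [mul_inv_cancel_left₀ hc0]
  obtain ⟨k', h1⟩ := exists_improves_of_slit hφ' hR hL hq hg hk
    (fun u hu hu' => hc _ (by rw [norm_mul, hcn, hu, one_mul]) hu') (by
      have : c * -(R : ℂ) = u₀ := by rw [hcdef]; field_simp
      rwa [this])
  unfold Improves at h1
  rw [him] at h1
  simp only [mul_zero] at h1
  exact ⟨k', h1⟩

end

section

variable {N : Type} [TopologicalSpace N]

theorem PlaneCharts.exists_chart (hN : PlaneCharts N) (x : N) {U : Set N} (hU : U ∈ 𝓝 x) (r : ℝ) :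
    ∃ φ : ℂ → N, IsOpenEmbedding φ ∧ φ 0 = x ∧ φ '' closedBall 0 r ⊆ U := by
  obtain ⟨φ, hφ, rfl⟩ := hN x
  obtain ⟨ε, hε, hεU⟩ := Metric.mem_nhds_iff.1 (hφ.continuous.continuousAt.preimage_mem_nhds hU)
  have hc : ((ε / (|r| + 1) : ℝ) : ℂ) ≠ 0 := Complex.ofReal_ne_zero.2 (by positivity)
  refine ⟨fun u => φ ((ε / (|r| + 1) : ℝ) * u), hφ.comp (Homeomorph.mulLeft₀ _ hc).isOpenEmbedding,
    by simp, ?_⟩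
  rintro _ ⟨u, hu, rfl⟩
  apply hεU
  rw [mem_ball_zero_iff, norm_mul, Complex.norm_real, Real.norm_of_nonneg (by positivity),
    div_mul_eq_mul_div, div_lt_iff₀ (by positivity)]
  have : ‖u‖ ≤ r := by simpa using hu
  nlinarith [le_abs_self r]

theorem PlaneCharts.locallyCompactSpace [T2Space N] (hN : PlaneCharts N) :
    LocallyCompactSpace N := by
  have : WeaklyLocallyCompactSpace N := ⟨fun x => by
    obtain ⟨φ, hφ, rfl⟩ := hN x
    exact ⟨φ '' closedBall 0 1, (isCompact_closedBall _ _).image hφ.continuous,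
      hφ.isOpenMap.image_mem_nhds (closedBall_mem_nhds _ one_pos)⟩⟩
  infer_instance

/-- No component of the complement of `K` is relatively compact. -/
def Unbounded (K : Set N) : Prop :=
  ∀ p ∉ K, ∀ L, IsCompact L → ∃ q ∉ L, q ∈ connectedComponentIn Kᶜ p

theorem exists_compact_unbounded [T2Space N] [ConnectedSpace N] [NoncompactSpace N]
    [LocallyCompactSpace N] [LocallyConnectedSpace N] {K : Set N} (hK : IsCompact K) :
    ∃ K', K ⊆ K' ∧ IsCompact K' ∧ Unbounded K' := by
  have hop : ∀ x, IsOpen (connectedComponentIn Kᶜ x) := fun x =>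
    hK.isClosed.isOpen_compl.connectedComponentIn
  let U : Set N := {x | x ∉ K ∧ ∀ L, IsCompact L → ∃ q ∉ L, q ∈ connectedComponentIn Kᶜ x}
  have hsub : ∀ x ∈ U, connectedComponentIn Kᶜ x ⊆ U := fun x hx y hy =>
    ⟨connectedComponentIn_subset _ _ hy, by rw [← connectedComponentIn_eq hy]; exact hx.2⟩
  have hU : IsOpen U := isOpen_iff_mem_nhds.2 fun x hx =>
    mem_of_superset ((hop x).mem_nhds (mem_connectedComponentIn hx.1)) (hsub x hx)
  refine ⟨Uᶜ, fun x hx hxU => hxU.1 hx, ?_, ?_⟩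
  · obtain ⟨K', hK', hKK'⟩ := exists_compact_superset hK
    have hF : IsCompact (frontier K') := hK'.of_isClosed_subset isClosed_frontier
      hK'.isClosed.frontier_subset
    have hFK : frontier K' ⊆ Kᶜ := fun x hx hxK => hx.2 (hKK' hxK)
    obtain ⟨t, ht, htF⟩ := hF.elim_nhds_subcover (fun y => connectedComponentIn Kᶜ y) fun y hy =>
      (hop y).mem_nhds (mem_connectedComponentIn (hFK hy))
    have hb : ∀ y : N, ∃ L, IsCompact L ∧ (y ∉ U → y ∉ K → connectedComponentIn Kᶜ y ⊆ L) := by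
      intro y
      by_cases hy : y ∈ U
      · exact ⟨∅, isCompact_empty, fun h => absurd hy h⟩
      by_cases hy' : y ∈ K
      · exact ⟨∅, isCompact_empty, fun _ h => absurd hy' h⟩
      have h1 : ¬ ∀ L, IsCompact L → ∃ q ∉ L, q ∈ connectedComponentIn Kᶜ y := fun h => hy ⟨hy', h⟩
      push Not at h1
      obtain ⟨L, hL, h2⟩ := h1
      exact ⟨L, hL, fun _ _ z hz => by_contra fun h => h2 z h hz⟩
    choose B hB hB' using hb
    refine IsCompact.of_isClosed_subset (hK'.union (t.isCompact_biUnion fun y _ => hB y))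
      hU.isClosed_compl fun x hx => ?_
    by_cases hxK : x ∈ K
    · exact Or.inl (interior_subset (hKK' hxK))
    have hxC := mem_connectedComponentIn (F := Kᶜ) hxK
    by_cases hd : ∃ z ∈ connectedComponentIn Kᶜ x, z ∈ frontier K'
    · obtain ⟨z, hz, hzF⟩ := hd
      obtain ⟨y, hyt, hzy⟩ := Set.mem_iUnion₂.1 (htF hzF)
      have hxy : connectedComponentIn Kᶜ x = connectedComponentIn Kᶜ y :=
        (connectedComponentIn_eq hz).trans (connectedComponentIn_eq hzy).symm
      refine Or.inr (Set.mem_iUnion₂.2 ⟨y, hyt, hB' y (fun hyU => hx ?_) (hFK (ht y hyt)) ?_⟩)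
      · exact hsub y hyU (hxy ▸ hxC)
      · exact hxy ▸ hxC
    · push Not at hd
      rcases isPreconnected_connectedComponentIn.subset_or_subset isOpen_interior
        hK'.isClosed.isOpen_compl (Set.disjoint_left.2 fun a ha ha' => ha' (interior_subset ha))
        (fun z hz => by
          by_cases hzi : z ∈ interior K'
          · exact Or.inl hzi
          · exact Or.inr fun hzK => hd z hz ⟨subset_closure hzK, hzi⟩) with h | h
      · exact Or.inl (interior_subset (h hxC))
      · exfalso
        have hcl : IsClosed (connectedComponentIn Kᶜ x) := by
          refine isClosed_of_closure_subset fun y hy => ?_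
          have hyK : y ∈ Kᶜ := fun hyK => by
            obtain ⟨z, hz1, hz2⟩ := mem_closure_iff.1 hy _ isOpen_interior (hKK' hyK)
            exact h hz2 (interior_subset hz1)
          obtain ⟨z, hz1, hz2⟩ := mem_closure_iff.1 hy _ (hop y) (mem_connectedComponentIn hyK)
          rw [connectedComponentIn_eq hz2, ← connectedComponentIn_eq hz1]
          exact mem_connectedComponentIn hyK
        have huniv := IsClopen.eq_univ ⟨hcl, hop x⟩ ⟨x, hxC⟩
        have := hB' x hx hxK
        rw [huniv] at this
        exact noncompact_univ N ((hB x).of_isClosed_subset isClosed_univ this)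
  · intro p hp L hL
    rw [Set.notMem_compl_iff] at hp
    obtain ⟨q, hqL, hq⟩ := hp.2 L hL
    refine ⟨q, hqL, ?_⟩
    rw [compl_compl]
    exact isPreconnected_connectedComponentIn.subset_connectedComponentIn
      (mem_connectedComponentIn hp.1) (hsub p hp) hq

theorem exists_unbounded_exhaustion [T2Space N] [ConnectedSpace N] [NoncompactSpace N]
    [LocallyCompactSpace N] [LocallyConnectedSpace N] [SigmaCompactSpace N] :
    ∃ K : ℕ → Set N, K 0 = ∅ ∧ (∀ n, IsCompact (K n)) ∧ (∀ n, Unbounded (K n)) ∧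
      (∀ n, K n ⊆ interior (K (n + 1))) ∧ ∀ x, ∃ n, x ∈ K n := by
  have h : ∀ (K : Set N) (n : ℕ), ∃ K', IsCompact K → IsCompact K' ∧ Unbounded K' ∧
      K ⊆ interior K' ∧ compactCovering N n ⊆ K' := by
    intro K n
    by_cases hK : IsCompact K
    · obtain ⟨A, hA, hKA⟩ := exists_compact_superset (hK.union (isCompact_compactCovering N n))
      obtain ⟨K', h1, h2, h3⟩ := exists_compact_unbounded hA
      exact ⟨K', fun _ => ⟨h2, h3, (Set.subset_union_left.trans hKA).trans (interior_mono h1),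
        ((Set.subset_union_right.trans hKA).trans interior_subset).trans h1⟩⟩
    · exact ⟨∅, fun h => absurd h hK⟩
  choose f hf using h
  let K : ℕ → Set N := fun n => Nat.rec ∅ (fun n A => f A n) n
  have hK : ∀ n, IsCompact (K n) := fun n => by
    induction n with
    | zero => exact isCompact_empty
    | succ n ih => exact (hf _ n ih).1
  refine ⟨K, rfl, hK, fun n => ?_, fun n => (hf _ n (hK n)).2.2.1, fun x => ?_⟩
  · cases n with
    | zero =>
      intro p _ L hL
      obtain ⟨q, hq⟩ := (Set.ne_univ_iff_exists_notMem L).1 hL.ne_univ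
      refine ⟨q, hq, ?_⟩
      have : (K 0)ᶜ = Set.univ := Set.compl_empty
      rw [this, connectedComponentIn_univ, PreconnectedSpace.connectedComponent_eq_univ]
      trivial
    | succ n => exact (hf _ n (hK n)).2.1
  · have hx : x ∈ ⋃ n, compactCovering N n := by rw [iUnion_compactCovering]; trivial
    obtain ⟨n, hn⟩ := Set.mem_iUnion.1 hx
    exact ⟨n + 1, (hf _ n (hK n)).2.2.2 hn⟩

end

section

variable {N : Type} [TopologicalSpace N] [T2Space N] {E Q : Type} [Group E] [Group Q]
variable {φ : ℂ → N} {k : N → N → E} {q : E →* Q} {g : N → N → Q} {K L : Set N}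

/-- The points where `k` is not locally a cocycle. -/
def bad (k : N → N → E) : Set N := {x | ¬ CocycleAt k x}

theorem exists_fill (hφ : IsOpenEmbedding φ) (hL : IsClosed L)
    (hq : Function.Surjective q) (hg : ∀ x, CocycleAt g x) (hk : IsLift q g k)
    (hfin : (bad k ∩ L).Finite) :
    ∃ k', IsLift q g k' ∧ (∀ x ∉ φ '' closedBall 0 2, k' x = k x) ∧
      bad k' ∩ (L ∪ φ '' closedBall 0 1) ⊆ {φ 0} ∪ (bad k ∩ L) \ φ '' closedBall 0 1 := by
  have h1 : ((fun u => ‖u‖) '' (φ ⁻¹' (bad k ∩ L))).Finite :=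
    (hfin.preimage hφ.injective.injOn).image _
  obtain ⟨R, ⟨hR1, hR2⟩, hR⟩ := (Set.Ioo_infinite (one_lt_two (α := ℝ))).exists_notMem_finite h1
  obtain ⟨k', h2, h3, h4, h5⟩ := exists_improves_of_circle hφ (by linarith) hL hq hg hk
    fun u hu hu' => by
      by_contra h
      exact hR ⟨u, ⟨h, hu'⟩, hu⟩
  refine ⟨k', h2, fun x hx => funext fun y => h3 x y fun h => hx ?_, ?_⟩
  · obtain ⟨u, hu, rfl⟩ := h.1
    exact ⟨u, (ball_subset_closedBall.trans (closedBall_subset_closedBall hR2.le)) hu, rfl⟩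
  · rintro x ⟨hxb, hx⟩
    by_cases h0 : x = φ 0
    · exact Or.inl h0
    by_cases hxR : x ∈ φ '' ball 0 R
    · exact absurd (h4 x hxR h0) hxb
    have hx1 : x ∉ φ '' closedBall 0 1 := fun ⟨u, hu, hux⟩ =>
      hxR ⟨u, closedBall_subset_ball hR1 hu, hux⟩
    have hxL := hx.resolve_right hx1
    exact Or.inr ⟨⟨fun h => hxb (h5 x hxL hxR h), hxL⟩, hx1⟩

/-- In any lift, bad points at `p` can be moved to `r`, away from `K` and without creating other
bad points in `L`. -/
def Moves (q : E →* Q) (g : N → N → Q) (K L : Set N) (p r : N) : Prop :=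
  ∀ k, IsLift q g k → (bad k ∩ L).Finite → ∃ k', IsLift q g k' ∧ (∀ x ∈ K, ∀ᶠ y in 𝓝 x, k' y = k y) ∧
    bad k' ∩ L ⊆ {r} ∪ (bad k ∩ L) \ {p}

theorem Moves.trans {p r s : N} (h : Moves q g K L p r) (h' : Moves q g K L r s) :
    Moves q g K L p s := by
  intro k hk hfin
  obtain ⟨k₁, h1, h2, h3⟩ := h k hk hfin
  obtain ⟨k₂, h4, h5, h6⟩ := h' k₁ h1 (((Set.finite_singleton _).union hfin.sdiff).subset h3)
  refine ⟨k₂, h4, fun x hx => ?_, fun x hx => ?_⟩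
  · filter_upwards [h2 x hx, h5 x hx] with y hy hy'
    rw [hy', hy]
  · rcases h6 hx with hx' | ⟨hx', hxr⟩
    · exact Or.inl hx'
    · exact Or.inr ((h3 hx').resolve_left hxr)

theorem eventually_eq_of_chart (hφ : IsOpenEmbedding φ) {k' : N → N → E}
    (hk' : ∀ x ∉ φ '' closedBall 0 2, k' x = k x) {x : N} (hx : x ∉ φ '' closedBall 0 2) :
    ∀ᶠ y in 𝓝 x, k' y = k y := by
  have : IsClosed (φ '' closedBall 0 2) :=
    ((isCompact_closedBall _ _).image hφ.continuous).isClosed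
  filter_upwards [this.isOpen_compl.mem_nhds hx] with y hy
  exact hk' y hy

theorem moves_of_chart (hφ : IsOpenEmbedding φ) (hL : IsClosed L)
    (hq : Function.Surjective q) (hg : ∀ x, CocycleAt g x) (hφK : φ '' closedBall 0 2 ⊆ Kᶜ)
    {p : N} (hp : p ∈ φ '' closedBall 0 1) : Moves q g K L p (φ 0) := by
  intro k hk hfin
  obtain ⟨k', h1, h2, h3⟩ := exists_fill hφ hL hq hg hk hfin
  refine ⟨k', h1, fun x hx => eventually_eq_of_chart hφ h2 fun h => hφK h hx, fun x hx => ?_⟩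
  rcases h3 ⟨hx.1, Or.inl hx.2⟩ with h | h
  · exact Or.inl h
  · exact Or.inr ⟨h.1, fun hxp => h.2 (by rwa [Set.mem_singleton_iff.1 hxp])⟩

theorem moves_of_mem_connectedComponentIn (hN : PlaneCharts N) (hK : IsClosed K) (hL : IsClosed L)
    (hq : Function.Surjective q) (hg : ∀ x, CocycleAt g x) {p r : N} (hp : p ∉ K)
    (hr : r ∈ connectedComponentIn Kᶜ p) : Moves q g K L p r := by
  refine isPreconnected_connectedComponentIn.induction₂' (Moves q g K L) ?_
    (fun _ _ _ _ _ _ h h' => h.trans h') (mem_connectedComponentIn hp) hr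
  intro x hx
  refine nhdsWithin_le_nhds ?_
  obtain ⟨φ, hφ, rfl, hφK⟩ := hN.exists_chart x
    (hK.isOpen_compl.mem_nhds (connectedComponentIn_subset _ _ hx)) 3
  filter_upwards [hφ.isOpenMap.image_mem_nhds (ball_mem_nhds (0 : ℂ) one_pos)]
  rintro _ ⟨u, hu, rfl⟩
  have hu' : ‖u‖ < 1 := by simpa using hu
  refine ⟨?_, moves_of_chart hφ hL hq hg ((Set.image_mono
    (closedBall_subset_closedBall (by norm_num))).trans hφK) ⟨u, ball_subset_closedBall hu, rfl⟩⟩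
  have h1 := moves_of_chart (φ := fun v => φ (u + v)) (K := K) (p := φ 0)
    (hφ.comp (Homeomorph.addLeft u).isOpenEmbedding) hL hq hg ?_
    ⟨-u, by simpa using hu'.le, by simp⟩
  · simpa using h1
  · rintro _ ⟨v, hv, rfl⟩
    refine hφK ⟨u + v, ?_, rfl⟩
    have : ‖v‖ ≤ 2 := by simpa using hv
    rw [mem_closedBall_zero_iff]
    linarith [norm_add_le u v]

theorem CocycleAt.congr_of_eventually {k k' : N → N → E} {x : N} (h : ∀ᶠ y in 𝓝 x, k' y = k y)
    (hk : CocycleAt k x) : CocycleAt k' x := by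
  filter_upwards [eventually_eventually_nhds.2 h, hk] with y hy hy'
  filter_upwards [hy, hy'] with z hz hz'
  rw [h.self_of_nhds, hy.self_of_nhds, hz']

theorem exists_good_of_finite (hN : PlaneCharts N) (hK : IsClosed K) (hKu : Unbounded K)
    (hL : IsCompact L) (hq : Function.Surjective q) (hg : ∀ x, CocycleAt g x) (hk : IsLift q g k)
    (hfin : (bad k ∩ L).Finite) (hgood : ∀ x ∈ K, CocycleAt k x) :
    ∃ k', IsLift q g k' ∧ (∀ x ∈ K, ∀ᶠ y in 𝓝 x, k' y = k y) ∧ ∀ x ∈ L, CocycleAt k' x := by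
  obtain ⟨n, hn⟩ : ∃ n, (bad k ∩ L).ncard ≤ n := ⟨_, le_rfl⟩
  induction n generalizing k with
  | zero =>
    rw [Nat.le_zero, Set.ncard_eq_zero hfin] at hn
    exact ⟨k, hk, fun _ _ => Eventually.of_forall fun _ => rfl,
      fun x hx => by_contra fun h => (hn.subset ⟨h, hx⟩ : x ∈ (∅ : Set N))⟩
  | succ n ih =>
    rcases (bad k ∩ L).eq_empty_or_nonempty with he | ⟨p, hp⟩
    · exact ih hk hfin hgood (by rw [he]; simp)
    have hpK : p ∉ K := fun h => hp.1 (hgood p h)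
    obtain ⟨r, hr, hpr⟩ := hKu p hpK L hL
    obtain ⟨k', h1, h2, h3⟩ :=
      moves_of_mem_connectedComponentIn hN hK hL.isClosed hq hg hpK hpr k hk hfin
    have h4 : bad k' ∩ L ⊆ (bad k ∩ L) \ {p} := fun x hx => (h3 hx).resolve_left fun h => by
      rw [Set.mem_singleton_iff] at h
      exact hr (h ▸ hx.2)
    obtain ⟨k'', h5, h6, h7⟩ := ih h1 (hfin.sdiff.subset h4)
      (fun x hx => (hgood x hx).congr_of_eventually (h2 x hx)) (by
        have h8 := Set.ncard_le_ncard h4 hfin.sdiff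
        rw [Set.ncard_sdiff_singleton_of_mem hp] at h8
        omega)
    refine ⟨k'', h5, fun x hx => ?_, h7⟩
    filter_upwards [h2 x hx, h6 x hx] with y hy hy'
    rw [hy', hy]

theorem exists_finite_bad (hq : Function.Surjective q) (hg : ∀ x, CocycleAt g x) {T : Type}
    (t : Finset T) (ψ : T → ℂ → N) (hψ : ∀ i ∈ t, IsOpenEmbedding (ψ i))
    (hψK : ∀ i ∈ t, ψ i '' closedBall 0 2 ⊆ Kᶜ) (hL : IsClosed L) (hk : IsLift q g k)
    (hfin : (bad k ∩ L).Finite) :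
    ∃ k', IsLift q g k' ∧ (∀ x ∈ K, ∀ᶠ y in 𝓝 x, k' y = k y) ∧
      (bad k' ∩ (L ∪ ⋃ i ∈ t, ψ i '' closedBall 0 1)).Finite := by
  classical
  induction t using Finset.induction_on with
  | empty => exact ⟨k, hk, fun _ _ => Eventually.of_forall fun _ => rfl, by simpa using hfin⟩
  | insert i t _ ih =>
    obtain ⟨k', h1, h2, h3⟩ := ih (fun j hj => hψ j (Finset.mem_insert_of_mem hj))
      fun j hj => hψK j (Finset.mem_insert_of_mem hj)
    have hi := hψ i (Finset.mem_insert_self _ _)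
    have hcl : IsClosed (L ∪ ⋃ i ∈ t, ψ i '' closedBall 0 1) :=
      hL.union (t.isCompact_biUnion fun j hj => (isCompact_closedBall _ _).image
        (hψ j (Finset.mem_insert_of_mem hj)).continuous).isClosed
    obtain ⟨k'', h4, h5, h6⟩ := exists_fill hi hcl hq hg h1 h3
    refine ⟨k'', h4, fun x hx => ?_, ?_⟩
    · filter_upwards [h2 x hx, eventually_eq_of_chart hi h5 fun h =>
        hψK i (Finset.mem_insert_self _ _) h hx] with y hy hy'
      rw [hy', hy]
    · refine ((Set.finite_singleton _).union h3.sdiff).subset (Set.Subset.trans ?_ h6)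
      refine Set.inter_subset_inter_right _ ?_
      rw [Finset.set_biUnion_insert, Set.union_comm (ψ i '' _), Set.union_assoc]

theorem exists_good_extension (hN : PlaneCharts N) (hK : IsClosed K) (hKu : Unbounded K)
    (hL : IsCompact L) (hq : Function.Surjective q) (hg : ∀ x, CocycleAt g x) (hk : IsLift q g k)
    (hgood : ∀ x ∈ K, CocycleAt k x) :
    ∃ k', IsLift q g k' ∧ (∀ x ∈ K, k' x = k x) ∧ ∀ x ∈ L, CocycleAt k' x := by
  classical
  have hbad : IsClosed (bad k) :=
    ⟨isOpen_iff_mem_nhds.2 fun x hx => by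
      filter_upwards [CocycleAt.eventually (not_not.1 hx)] with y hy
      exact not_not.2 hy⟩
  have hc : ∀ x : N, ∃ φ : ℂ → N, x ∉ K → IsOpenEmbedding φ ∧ φ 0 = x ∧
      φ '' closedBall 0 2 ⊆ Kᶜ := fun x => by
    by_cases h : x ∈ K
    · exact ⟨fun _ => x, fun h' => absurd h h'⟩
    · obtain ⟨φ, hφ⟩ := hN.exists_chart x (hK.isOpen_compl.mem_nhds h) 2
      exact ⟨φ, fun _ => hφ⟩
  choose ψ hψ using hc
  have hbK : ∀ x ∈ bad k ∩ L, x ∉ K := fun x hx h => hx.1 (hgood x h)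
  have hop : ∀ x ∈ bad k ∩ L, ψ x '' ball 0 1 ∈ 𝓝 x := fun x hx => by
    obtain ⟨h1, h2, -⟩ := hψ x (hbK x hx)
    have := h1.isOpenMap.image_mem_nhds (ball_mem_nhds (0 : ℂ) one_pos)
    rwa [h2] at this
  obtain ⟨t, ht, htc⟩ := (hL.inter_left hbad).elim_nhds_subcover _ hop
  let L₀ : Set N := L \ ⋃ x ∈ t, ψ x '' ball 0 1
  have hL₀ : IsClosed L₀ := hL.isClosed.sdiff (isOpen_biUnion fun x hx =>
    (hψ x (hbK x (ht x hx))).1.isOpenMap _ isOpen_ball)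
  have hL₀b : bad k ∩ L₀ = ∅ :=
    Set.eq_empty_iff_forall_notMem.2 fun x hx => hx.2.2 (htc ⟨hx.1, hx.2.1⟩)
  obtain ⟨k₁, h1, h2, h3⟩ := exists_finite_bad (K := K) hq hg t ψ
    (fun x hx => (hψ x (hbK x (ht x hx))).1) (fun x hx => (hψ x (hbK x (ht x hx))).2.2) hL₀ hk
    (by rw [hL₀b]; exact Set.finite_empty)
  obtain ⟨k₂, h4, h5, h6⟩ := exists_good_of_finite hN hK hKu hL hq hg h1
    (h3.subset (Set.inter_subset_inter_right _ fun x hx => by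
      by_cases h : x ∈ ⋃ x ∈ t, ψ x '' ball 0 1
      · exact Or.inr (Set.biUnion_mono (fun _ h => h)
          (fun y _ => Set.image_mono ball_subset_closedBall) h)
      · exact Or.inl ⟨hx, h⟩))
    fun x hx => (hgood x hx).congr_of_eventually (h2 x hx)
  exact ⟨k₂, h4, fun x hx => by rw [(h5 x hx).self_of_nhds, (h2 x hx).self_of_nhds], h6⟩

theorem exists_cocycle_lift (hN : PlaneCharts N) [ConnectedSpace N] [NoncompactSpace N]
    [SigmaCompactSpace N] (hq : Function.Surjective q) (hg : ∀ x, CocycleAt g x) :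
    ∃ k : N → N → E, IsLift q g k ∧ ∀ x, CocycleAt k x := by
  classical
  have := hN.locallyCompactSpace
  have := hN.locallyPathConnectedSpace
  obtain ⟨K, hK0, hKc, hKu, hKi, hKN⟩ := exists_unbounded_exhaustion (N := N)
  have hstep : ∀ (n : ℕ) (k : N → N → E), ∃ k', IsLift q g k → (∀ x ∈ K n, CocycleAt k x) →
      IsLift q g k' ∧ (∀ x ∈ K n, k' x = k x) ∧ ∀ x ∈ K (n + 1), CocycleAt k' x := by
    intro n k
    by_cases h : IsLift q g k ∧ ∀ x ∈ K n, CocycleAt k x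
    · obtain ⟨k', hk'⟩ := exists_good_extension hN (hKc n).isClosed (hKu n) (hKc (n + 1)) hq hg
        h.1 h.2
      exact ⟨k', fun _ _ => hk'⟩
    · exact ⟨k, fun h1 h2 => absurd ⟨h1, h2⟩ h⟩
  choose F hF using hstep
  choose ℓ hℓ using id hq
  let k : ℕ → N → N → E := fun n => Nat.rec (fun x y => ℓ (g x y)) (fun n k => F n k) n
  have hk : ∀ n, IsLift q g (k n) ∧ ∀ x ∈ K n, CocycleAt (k n) x := fun n => by
    induction n with
    | zero =>
      refine ⟨fun x => Eventually.of_forall fun y => hℓ _, fun x hx => ?_⟩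
      rw [hK0] at hx
      exact hx.elim
    | succ n ih => exact ⟨(hF n _ ih.1 ih.2).1, (hF n _ ih.1 ih.2).2.2⟩
  have hmono : Monotone K := monotone_nat_of_le_succ fun n => (hKi n).trans interior_subset
  have hst : ∀ n m, n ≤ m → ∀ x ∈ K n, k m x = k n x := fun n m hnm x hx => by
    induction m, hnm using Nat.le_induction with
    | base => rfl
    | succ m hm ih => rw [← ih]; exact (hF m _ (hk m).1 (hk m).2).2.1 x (hmono hm hx)
  let k' : N → N → E := fun x => k (Nat.find (hKN x)) x
  have hk' : ∀ n, ∀ x ∈ K n, k' x = k n x := fun n x hx =>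
    (hst _ _ (Nat.find_min' _ hx) x (Nat.find_spec (hKN x))).symm
  have hev : ∀ x, ∃ n, x ∈ K n ∧ ∀ᶠ y in 𝓝 x, k' y = k n y := fun x => by
    obtain ⟨n, hn⟩ := hKN x
    refine ⟨n + 1, hmono n.le_succ hn, ?_⟩
    filter_upwards [mem_interior_iff_mem_nhds.1 (hKi n hn)] with y hy
    exact hk' _ y hy
  refine ⟨k', fun x => ?_, fun x => ?_⟩
  · obtain ⟨n, -, hn⟩ := hev x
    filter_upwards [(hk n).1 x] with y hy
    rw [hn.self_of_nhds, hy]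
  · obtain ⟨n, hxn, hn⟩ := hev x
    exact ((hk n).2 x hxn).congr_of_eventually hn

end

theorem isFreeGroup_of_injective {F G : Type} [Group F] [Group G] [IsFreeGroup F] (f : G →* F)
    (hf : Function.Injective f) : IsFreeGroup G :=
  IsFreeGroup.ofMulEquiv (MonoidHom.ofInjective hf).symm

theorem isFreeGroup_pi1 {N : Type} [TopologicalSpace N] [T2Space N] (hN : PlaneCharts N)
    [ConnectedSpace N] [NoncompactSpace N] [SigmaCompactSpace N] (x₀ : N) :
    IsFreeGroup (Pi1 x₀) := by
  have := hN.locallyPathConnectedSpace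
  have : PathConnectedSpace N := pathConnectedSpace_iff_connectedSpace.2 inferInstance
  obtain ⟨g, hg, hgu⟩ := exists_universal_cocycle hN x₀
  let q : FreeGroup (Pi1 x₀) →* Pi1 x₀ := FreeGroup.lift id
  have hq : Function.Surjective q := fun a => ⟨FreeGroup.of a, by simp [q]⟩
  obtain ⟨k, hk, hkc⟩ := exists_cocycle_lift hN hq hg
  refine isFreeGroup_of_injective (hol hkc x₀) (Function.LeftInverse.injective (g := q) fun a => ?_)
  obtain ⟨γ, rfl⟩ := Pi1.mk_surjective a
  conv_rhs => rw [← hgu (Pi1.mk γ)]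
  rw [hol_mk, hol_mk, ← holPath_comp hkc q γ]
  exact (holPath_congr hg _ (fun x => (hk x)) γ)

theorem PlaneCharts.of_isOpenEmbedding {X Y : Type} [TopologicalSpace X] [TopologicalSpace Y]
    (hX : PlaneCharts X) {f : Y → X} (hf : IsOpenEmbedding f) : PlaneCharts Y := by
  intro y
  obtain ⟨φ, hφ, h0⟩ := hX (f y)
  obtain ⟨ε, hε, hεU⟩ := Metric.isOpen_iff.1 (hf.isOpen_range.preimage hφ.continuous) 0
    ⟨y, h0.symm⟩
  let e := OpenPartialHomeomorph.univBall (0 : ℂ) ε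
  have he : IsOpenEmbedding e := by
    refine OpenPartialHomeomorph.isOpenEmbedding _ (OpenPartialHomeomorph.univBall_source _ _)
  have heb : ∀ u, e u ∈ ball (0 : ℂ) ε := fun u => by
    have := e.map_source (x := u) (by simp [e])
    simpa [e, OpenPartialHomeomorph.univBall_target _ hε] using this
  have h1 : ∀ u, ∃ z, f z = φ (e u) := fun u => hεU (heb u)
  choose ψ hψ using h1
  refine ⟨ψ, ?_, hf.injective (by rw [hψ, ← h0]; simp [e])⟩
  refine (IsOpenEmbedding.of_comp_iff ψ hf).1 ?_
  have : f ∘ ψ = φ ∘ e := funext hψ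
  rw [this]
  exact hφ.comp he

section

variable {X Y : Type} [TopologicalSpace X] [TopologicalSpace Y] {G : Type} [Group G]

theorem cocycleAt_iff_of_isOpenEmbedding {g : X → X → G} {f : Y → X} (hf : IsOpenEmbedding f)
    {y : Y} : CocycleAt g (f y) ↔ CocycleAt (fun a b => g (f a) (f b)) y := by
  simp only [CocycleAt, ← hf.map_nhds_eq, eventually_map]

theorem PlaneCharts.exists_coboundary (hX : PlaneCharts X) [PathConnectedSpace X]
    {g g' : X → X → G} (hg : ∀ x, CocycleAt g x) (hg' : ∀ x, CocycleAt g' x) (x₀ : X)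
    (h : ∀ γ : Path x₀ x₀, holPath hg γ = holPath hg' γ) :
    ∃ t : X → G, t x₀ = 1 ∧ ∀ x, ∀ᶠ y in 𝓝 x, g' x y = t x * g x y * (t y)⁻¹ := by
  let τ : ∀ x : X, Path x₀ x := fun x => PathConnectedSpace.somePath x₀ x
  refine ⟨fun x => (holPath hg' (τ x))⁻¹ * holPath hg (τ x), by simp [h], fun x => ?_⟩
  obtain ⟨φ, hφ, rfl⟩ := hX x
  obtain ⟨s, hs, hs1⟩ := exists_prim hφ.continuous (fun u => hg (φ u)) 0 (1 : G)
  obtain ⟨s', hs', hs1'⟩ := exists_prim hφ.continuous (fun u => hg' (φ u)) 0 (1 : G)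
  rw [← hφ.map_nhds_eq, eventually_map]
  filter_upwards [hs 0, hs' 0] with u hu hu'
  let c : Path (0 : ℂ) u := PathConnectedSpace.somePath 0 u
  have h1 : holPath hg (c.map hφ.continuous) = g (φ 0) (φ u) := by
    rw [holPath_eq hg _ fun t => (hs (c t)).comp (φ := c) c.continuous.continuousAt]
    simp [hs1, hu]
  have h2 : holPath hg' (c.map hφ.continuous) = g' (φ 0) (φ u) := by
    rw [holPath_eq hg' _ fun t => (hs' (c t)).comp (φ := c) c.continuous.continuousAt]
    simp [hs1', hu']
  have h3 := h (((τ (φ 0)).trans (c.map hφ.continuous)).trans (τ (φ u)).symm)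
  simp only [holPath_trans, holPath_symm, h1, h2] at h3
  rw [mul_inv_eq_iff_eq_mul] at h3
  have h4 : holPath hg (τ (φ 0)) * g (φ 0) (φ u) = holPath hg' (τ (φ 0)) * g' (φ 0) (φ u) *
      (holPath hg' (τ (φ u)))⁻¹ * holPath hg (τ (φ u)) := h3
  rw [mul_assoc _ (holPath hg (τ (φ 0))), h4]
  group

end

section

variable {M : Type} [TopologicalSpace M] {φ : ℂ → M} {L : Type} [Group L]

/-- The universal covering of the punctured disc of a chart. -/
noncomputable def puncturedExp (hφ : IsOpenEmbedding φ) (w : ℂ) : {x : M // x ≠ φ 0} :=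
  ⟨φ (Complex.exp w), fun h => Complex.exp_ne_zero w (hφ.injective h)⟩

theorem continuous_puncturedExp (hφ : IsOpenEmbedding φ) : Continuous (puncturedExp hφ) :=
  (hφ.continuous.comp Complex.continuous_exp).subtype_mk _

/-- The loop around the puncture. -/
noncomputable def circleLoop (hφ : IsOpenEmbedding φ) :
    Path (puncturedExp hφ 0) (puncturedExp hφ 0) where
  toFun t := puncturedExp hφ ((t : ℝ) * (2 * Real.pi * Complex.I))
  continuous_toFun := (continuous_puncturedExp hφ).comp (by fun_prop)
  source' := by simp
  target' := by simp [puncturedExp]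

variable [T2Space M]

theorem isOpenEmbedding_punctured (p : M) :
    IsOpenEmbedding (Subtype.val : {x : M // x ≠ p} → M) :=
  (isOpen_ne (x := p)).isOpenEmbedding_subtypeVal

theorem exists_periodic_prim (hφ : IsOpenEmbedding φ)
    {k : {x : M // x ≠ φ 0} → {x : M // x ≠ φ 0} → L} (hk : ∀ x, CocycleAt k x)
    (hr : holPath hk (circleLoop hφ) = 1) :
    ∃ s : ℂ → L, s 0 = 1 ∧ ∀ (u : ℂ) (hu : φ u ≠ φ 0), ∀ᶠ v in 𝓝 u, ∀ hv : φ v ≠ φ 0,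
      s v = s u * k ⟨φ u, hu⟩ ⟨φ v, hv⟩ := by
  obtain ⟨S, hS, -⟩ := exists_prim (continuous_puncturedExp hφ) (fun w => hk _) 0 (1 : L)
  have h1 : S (2 * Real.pi * Complex.I) = S 0 := by
    rw [holPath_eq hk _ (s := fun t : I => S ((t : ℝ) * (2 * Real.pi * Complex.I))) fun t =>
      (hS _).comp (φ := fun t : I => (((t : ℝ) : ℂ) * (2 * Real.pi * Complex.I))) (by fun_prop),
      inv_mul_eq_one] at hr
    simpa using hr.symm
  have hper : Function.Periodic S (2 * Real.pi * Complex.I) := by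
    intro w
    have h2 : ∀ w, PrimAt k (puncturedExp hφ) (fun w => S (w + 2 * Real.pi * Complex.I)) w := by
      intro w
      have h3 := (hS (w + 2 * Real.pi * Complex.I)).comp
        (φ := fun w => w + 2 * Real.pi * Complex.I) (by fun_prop)
      have h4 : puncturedExp hφ ∘ (fun w => w + 2 * Real.pi * Complex.I) = puncturedExp hφ :=
        funext fun w => by simp [puncturedExp, Complex.exp_periodic w]
      rw [h4] at h3
      exact h3
    have h5 := PrimAt.unique hS h2 0 w
    simp only [zero_add, h1, mul_inv_cancel] at h5
    exact mul_inv_eq_one.1 h5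
  have hlog : ∀ v w : ℂ, v ≠ 0 → Complex.exp w = v → S w = S (Complex.log v) := by
    intro v w hv hw
    obtain ⟨n, hn⟩ := Complex.exp_eq_exp_iff_exists_int.1 (hw.trans (Complex.exp_log hv).symm)
    rw [hn]
    exact hper.int_mul n _
  refine ⟨fun v => if v = 0 then 1 else S (Complex.log v), by simp, fun u hu => ?_⟩
  have hu0 : u ≠ 0 := fun h => hu (h ▸ rfl)
  let ℓ : ℂ → ℂ := fun v => Complex.log (v / u) + Complex.log u
  have hℓc : ContinuousAt ℓ u := by
    refine ContinuousAt.add (ContinuousAt.clog (by fun_prop) ?_) continuousAt_const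
    rw [div_self hu0]
    exact Complex.one_mem_slitPlane
  have hℓ : ∀ v, v ≠ 0 → Complex.exp (ℓ v) = v := fun v hv => by
    rw [Complex.exp_add, Complex.exp_log (div_ne_zero hv hu0), Complex.exp_log hu0,
      div_mul_cancel₀ _ hu0]
  have hpt : ∀ (v : ℂ) (hv : φ v ≠ φ 0), puncturedExp hφ (ℓ v) = ⟨φ v, hv⟩ := fun v hv =>
    Subtype.ext (congrArg φ (hℓ v fun h => hv (h ▸ rfl)))
  filter_upwards [hℓc.eventually (hS (ℓ u))] with v hv hv'
  have hv0 : v ≠ 0 := fun h => hv' (h ▸ rfl)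
  rw [hpt u hu, hpt v hv', hlog v _ hv0 (hℓ v hv0), hlog u _ hu0 (hℓ u hu0)] at hv
  simp [hv0, hu0, hv]

theorem exists_extension_of_circle (hφ : IsOpenEmbedding φ)
    {k : {x : M // x ≠ φ 0} → {x : M // x ≠ φ 0} → L} (hk : ∀ x, CocycleAt k x)
    (hr : holPath hk (circleLoop hφ) = 1) :
    ∃ k' : M → M → L, (∀ x, CocycleAt k' x) ∧ ∀ x y : {x : M // x ≠ φ 0}, k' x y = k x y := by
  classical
  obtain ⟨s, hs0, hs⟩ := exists_periodic_prim hφ hk hr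
  let k' : M → M → L := fun x y => if hx : x = φ 0 then s (Function.invFun φ y) else
    if hy : y = φ 0 then 1 else k ⟨x, hx⟩ ⟨y, hy⟩
  have hk' : ∀ x y : {x : M // x ≠ φ 0}, k' x y = k x y := fun x y => by
    simp [k', x.2, y.2]
  refine ⟨k', fun x => ?_, hk'⟩
  by_cases hx : x = φ 0
  · subst hx
    rw [cocycleAt_iff_of_isOpenEmbedding hφ]
    have h1 : ∀ u, k' (φ 0) (φ u) = s u := fun u => by
      simp [k', Function.leftInverse_invFun hφ.injective u]
    refine Eventually.of_forall fun u => ?_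
    by_cases hu : φ u = φ 0
    · refine Eventually.of_forall fun v => ?_
      rw [hφ.injective hu]
      simp only [h1, hs0, one_mul]
    · have hu0 : u ≠ 0 := fun h => hu (h ▸ rfl)
      filter_upwards [hs u hu, isOpen_ne.mem_nhds hu0] with v hv hv0
      have hv' : φ v ≠ φ 0 := fun h => hv0 (hφ.injective h)
      simp only [h1, hv hv', hk' ⟨φ u, hu⟩ ⟨φ v, hv'⟩]
  · have h2 := cocycleAt_iff_of_isOpenEmbedding (g := k') (isOpenEmbedding_punctured (φ 0))
      (y := ⟨x, hx⟩)
    refine h2.2 ?_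
    simp only [hk']
    exact hk _

theorem isPreconnected_punctured_plane : IsPreconnected ({0}ᶜ : Set ℂ) :=
  (isConnected_compl_singleton_of_one_lt_rank (by simp) 0).isPreconnected

theorem preconnectedSpace_punctured [PreconnectedSpace M] (hφ : IsOpenEmbedding φ) :
    PreconnectedSpace {x : M // x ≠ φ 0} := by
  classical
  refine preconnectedSpace_of_forall_constant fun f hf x y => ?_
  have hne : ∀ u : ℂ, u ≠ 0 → φ u ≠ φ 0 := fun u hu h => hu (hφ.injective h)
  have hch : ∀ (u : ℂ) (hu : φ u ≠ φ 0), f ⟨φ u, hu⟩ = f ⟨φ 1, hne 1 one_ne_zero⟩ := by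
    intro u hu
    have h1 : ContinuousOn (fun u => if hu : φ u ≠ φ 0 then f ⟨φ u, hu⟩ else true) {0}ᶜ := by
      rw [continuousOn_iff_continuous_domRestrict]
      have : Continuous fun u : ({0}ᶜ : Set ℂ) => f ⟨φ u, hne u u.2⟩ :=
        hf.comp ((hφ.continuous.comp continuous_subtype_val).subtype_mk _)
      refine this.congr fun u => ?_
      simp [hne u u.2]
    have h2 := isPreconnected_punctured_plane.constant h1 (x := u) (y := 1)
      (fun h => hu (congrArg φ h)) (by simp)
    simpa [hu, hne 1 one_ne_zero] using h2
  let F : M → Bool := fun x => if hx : x ≠ φ 0 then f ⟨x, hx⟩ else f ⟨φ 1, hne 1 one_ne_zero⟩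
  have hF : IsLocallyConstant F := by
    rw [IsLocallyConstant.iff_eventually_eq]
    intro x
    by_cases hx : x = φ 0
    · subst hx
      rw [← hφ.map_nhds_eq, eventually_map]
      refine Eventually.of_forall fun u => ?_
      by_cases hu : φ u = φ 0
      · rw [hu]
      · simp only [F, ne_eq, hu, not_false_eq_true, dif_pos, not_true_eq_false, dif_neg]
        exact hch u hu
    · have h3 := (isOpenEmbedding_punctured (φ 0)).map_nhds_eq ⟨x, hx⟩
      simp only at h3
      rw [← h3, eventually_map]
      have h4 : ∀ᶠ y in 𝓝 (⟨x, hx⟩ : {x : M // x ≠ φ 0}), f y = f ⟨x, hx⟩ :=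
        hf.continuousAt.eventually (isOpen_discrete {f ⟨x, hx⟩}|>.mem_nhds rfl)
      filter_upwards [h4] with y hy
      simp [F, hx, y.2, hy]
  have := hF.apply_eq_of_preconnectedSpace x y
  simpa [F, x.2, y.2] using this

theorem noncompactSpace_punctured (hφ : IsOpenEmbedding φ) :
    NoncompactSpace {x : M // x ≠ φ 0} := by
  by_contra h
  rw [← not_compactSpace_iff, not_not] at h
  have h1 : IsClosed {x : M | x ≠ φ 0} := by
    have := (isCompact_range (continuous_subtype_val (p := fun x : M => x ≠ φ 0))).isClosed
    simpa using this
  have h2 : IsOpen ({0} : Set ℂ) := by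
    have h3 := h1.isOpen_compl.preimage hφ.continuous
    convert h3
    ext u
    simp [hφ.injective.eq_iff]
  exact (not_isOpen_singleton (0 : ℂ)) h2

theorem eq_of_comp_punctured_eq [ConnectedSpace M] (hM : PlaneCharts M) (hφ : IsOpenEmbedding φ)
    {g g' : M → M → L} (hg : ∀ x, CocycleAt g x) (hg' : ∀ x, CocycleAt g' x)
    (h : ∀ γ : Path (puncturedExp hφ 0) (puncturedExp hφ 0),
      holPath hg (γ.map continuous_subtype_val) = holPath hg' (γ.map continuous_subtype_val))
    (γ : Path (puncturedExp hφ 0 : M) (puncturedExp hφ 0 : M)) : holPath hg γ = holPath hg' γ := by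
  classical
  have hX := hM.of_isOpenEmbedding (isOpenEmbedding_punctured (φ 0))
  have := hX.locallyPathConnectedSpace
  have := preconnectedSpace_punctured hφ
  have : Nonempty {x : M // x ≠ φ 0} := ⟨puncturedExp hφ 0⟩
  have : PathConnectedSpace {x : M // x ≠ φ 0} :=
    pathConnectedSpace_iff_connectedSpace.2 ⟨inferInstance⟩
  obtain ⟨t, ht1, ht⟩ := hX.exists_coboundary (fun x => (hg x.1).comp continuous_subtype_val)
    (fun x => (hg' x.1).comp continuous_subtype_val) (puncturedExp hφ 0) fun γ => by
      rw [holPath_map hg continuous_subtype_val, holPath_map hg' continuous_subtype_val]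
      exact h γ
  obtain ⟨s, hs, hs1⟩ := exists_prim hφ.continuous (fun u => hg (φ u)) 0 (1 : L)
  obtain ⟨s', hs', hs1'⟩ := exists_prim hφ.continuous (fun u => hg' (φ u)) 0 (1 : L)
  let T : M → L := fun x => if hx : x ≠ φ 0 then t ⟨x, hx⟩ else 1
  have hT : ∀ x : {x : M // x ≠ φ 0}, T x = t x := fun x => by simp [T, x.2]
  have hTx : ∀ x ≠ φ 0, ∀ᶠ y in 𝓝 x, g' x y = T x * g x y * (T y)⁻¹ := fun x hx => by
    have h3 := (isOpenEmbedding_punctured (φ 0)).map_nhds_eq ⟨x, hx⟩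
    simp only at h3
    rw [← h3, eventually_map]
    filter_upwards [ht ⟨x, hx⟩] with y hy
    rw [hT y, hT ⟨x, hx⟩, hy]
  have hne : ∀ u : ℂ, u ≠ 0 → φ u ≠ φ 0 := fun u hu h => hu (hφ.injective h)
  have hw : ∀ u : ℂ, u ≠ 0 → s' u * T (φ u) * (s u)⁻¹ = s' 1 * T (φ 1) * (s 1)⁻¹ := by
    intro u hu
    have := PrimAt.unique_set (g := g) (f := φ) (s := s) (s' := fun u => s' u * T (φ u))
      isPreconnected_punctured_plane (fun y _ => hs y) (fun y hy => by
        filter_upwards [hs' y, hφ.continuous.continuousAt.eventually (hTx _ (hne y hy))] with v h1 h2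
        rw [h1, h2]
        group) (y := 1) (z := u) (by simp) hu
    exact this
  let T' : M → L := fun x => if x = φ 0 then s' 1 * T (φ 1) * (s 1)⁻¹ else T x
  have hTT : ∀ x ≠ φ 0, T' x = T x := fun x hx => by simp [T', hx]
  have hT' : ∀ x, ∀ᶠ y in 𝓝 x, g' x y = T' x * g x y * (T' y)⁻¹ := by
    intro x
    by_cases hx : x = φ 0
    · subst hx
      rw [← hφ.map_nhds_eq, eventually_map]
      filter_upwards [hs 0, hs' 0] with u h1 h2
      rw [hs1, one_mul] at h1
      rw [hs1', one_mul] at h2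
      rw [← h1, ← h2]
      by_cases hu : u = 0
      · subst hu
        rw [hs1, hs1']
        group
      · rw [hTT _ (hne u hu)]
        simp only [T', if_true]
        rw [← hw u hu]
        group
    · filter_upwards [hTx x hx, isOpen_ne.mem_nhds hx] with y hy hy'
      rw [hTT x hx, hTT y hy', hy]
  rw [holPath_coboundary hg hg' T' hT', hTT _ (puncturedExp hφ 0).2, hT, ht1]
  simp

theorem exists_puncturedHom [ConnectedSpace M] (hM : PlaneCharts M) (hφ : IsOpenEmbedding φ) :
    ∃ i : Pi1 (puncturedExp hφ 0) →* Pi1 (puncturedExp hφ 0 : M), Function.Surjective i ∧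
      (∀ γ, i (Pi1.mk γ) = Pi1.mk (γ.map continuous_subtype_val)) ∧
      i (Pi1.mk (circleLoop hφ)) = 1 ∧
      ∀ (L : Type) [Group L] (ψ : Pi1 (puncturedExp hφ 0) →* L),
        ψ (Pi1.mk (circleLoop hφ)) = 1 → ∀ a, i a = 1 → ψ a = 1 := by
  have := hM.locallyPathConnectedSpace
  have : PathConnectedSpace M := pathConnectedSpace_iff_connectedSpace.2 inferInstance
  have hX := hM.of_isOpenEmbedding (isOpenEmbedding_punctured (φ 0))
  have := hX.locallyPathConnectedSpace
  have := preconnectedSpace_punctured hφ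
  have : Nonempty {x : M // x ≠ φ 0} := ⟨puncturedExp hφ 0⟩
  have : PathConnectedSpace {x : M // x ≠ φ 0} :=
    pathConnectedSpace_iff_connectedSpace.2 ⟨inferInstance⟩
  obtain ⟨g, hg, hgu⟩ := exists_universal_cocycle hM (puncturedExp hφ 0 : M)
  let i : Pi1 (puncturedExp hφ 0) →* Pi1 (puncturedExp hφ 0 : M) :=
    hol (fun x => (hg x.1).comp continuous_subtype_val) (puncturedExp hφ 0)
  have hi : ∀ γ, i (Pi1.mk γ) = Pi1.mk (γ.map continuous_subtype_val) := fun γ => by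
    simp only [i, hol_mk]
    rw [holPath_map hg continuous_subtype_val, ← hol_mk, hgu]
  refine ⟨i, ?_, hi, ?_, ?_⟩
  · have : CategoryTheory.Epi (GrpCat.ofHom i) := ⟨fun {L} f₁ f₂ hf => by
      ext a
      obtain ⟨γ, rfl⟩ := Pi1.mk_surjective a
      have h1 := eq_of_comp_punctured_eq hM hφ (fun x => (hg x).hom f₁.hom)
        (fun x => (hg x).hom f₂.hom) (fun γ => by
          have h2 : f₁.hom (i (Pi1.mk γ)) = f₂.hom (i (Pi1.mk γ)) :=
            CategoryTheory.ConcreteCategory.congr_hom hf (Pi1.mk γ)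
          rw [holPath_comp hg, holPath_comp hg, ← hol_mk, hgu, ← hi, h2]) γ
      rw [holPath_comp hg, holPath_comp hg, ← hol_mk, hgu] at h1
      exact h1⟩
    exact GrpCat.surjective_of_epi (GrpCat.ofHom i)
  · rw [hi, ← Pi1.mk_refl, Pi1.mk_eq]
    refine homotopic_of_range_subset hφ _ _ (fun t => ⟨_, rfl⟩) fun t => ⟨_, rfl⟩
  · intro L _ ψ hψ a ha
    obtain ⟨gX, hgX, hgXu⟩ := exists_universal_cocycle hX (puncturedExp hφ 0)
    obtain ⟨k, hk, hkX⟩ := exists_extension_of_circle hφ (fun x => (hgX x).hom ψ) (by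
      rw [holPath_comp hgX, ← hol_mk, hgXu, hψ])
    obtain ⟨γ, rfl⟩ := Pi1.mk_surjective a
    rw [hi, ← Pi1.mk_refl, Pi1.mk_eq] at ha
    have h1 := holPath_homotopic hk ha
    rw [holPath_refl, ← holPath_map hk continuous_subtype_val γ,
      holPath_congr (fun x => (hgX x).hom ψ) _ (fun x => Eventually.of_forall fun y => hkX x y),
      holPath_comp hgX, ← hol_mk, hgXu] at h1
    exact h1

end

namespace Tot

variable {X : Type} [TopologicalSpace X] {G : Type} [Group G] {g : X → X → G}

theorem isOpenEmbedding_lift (hg : ∀ x, CocycleAt g x) {φ : ℂ → X} (hφ : IsOpenEmbedding φ)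
    {s : ℂ → G} (hs : ∀ u, PrimAt g φ s u) : IsOpenEmbedding fun u => (⟨φ u, s u⟩ : Tot g) := by
  refine .of_continuous_injective_isOpenMap
    (continuous_iff_continuousAt.2 fun u => (continuousAt_iff hg).2
      ⟨hφ.continuous.continuousAt, hs u⟩)
    (fun u v h => hφ.injective (congrArg pt h)) (isOpenMap_iff_nhds_le.2 fun u => ?_)
  rw [nhds_eq hg]
  simp only
  rw [← hφ.map_nhds_eq, map_map]
  refine le_of_eq (Filter.map_congr ?_)
  filter_upwards [hs u] with v hv
  simp [hv]

theorem exists_lift_chart (hg : ∀ x, CocycleAt g x) {φ : ℂ → X} (hφ : IsOpenEmbedding φ) :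
    ∃ s : ℂ → G, s 0 = 1 ∧ ∀ a : G, IsOpenEmbedding fun u => (⟨φ u, a * s u⟩ : Tot g) := by
  obtain ⟨s, hs, h0⟩ := exists_prim hφ.continuous (fun u => hg (φ u)) 0 (1 : G)
  exact ⟨s, h0, fun a => isOpenEmbedding_lift hg hφ fun u => (hs u).mul_left a⟩

theorem planeCharts (hg : ∀ x, CocycleAt g x) (hX : PlaneCharts X) : PlaneCharts (Tot g) := by
  intro p
  obtain ⟨φ, hφ, h0⟩ := hX p.pt
  obtain ⟨s, hs0, hs⟩ := exists_lift_chart hg hφ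
  exact ⟨_, hs p.lab, by simp [hs0, h0]⟩

theorem t2Space [T2Space X] (hg : ∀ x, CocycleAt g x) : T2Space (Tot g) := by
  refine ⟨fun p q hpq => ?_⟩
  by_cases h : p.pt = q.pt
  · exact (isCoveringMap hg).isSeparatedMap p q h hpq
  · exact separated_by_continuous (continuous_pt hg) h

theorem sigmaCompactSpace [T2Space X] [SigmaCompactSpace X] [Countable G]
    (hg : ∀ x, CocycleAt g x) (hX : PlaneCharts X) : SigmaCompactSpace (Tot g) := by
  choose φ hφ h0 using hX
  choose s hs0 hs using fun x => exists_lift_chart hg (hφ x)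
  obtain ⟨t, ht, htc⟩ := countable_cover_nhds_of_sigmaCompact (X := X) (f := fun x => φ x '' closedBall 0 1)
    fun x => by
      have := (hφ x).isOpenMap.image_mem_nhds (closedBall_mem_nhds (0 : ℂ) one_pos)
      rwa [h0] at this
  have : Countable t := ht.to_subtype
  let K : t × G → Set (Tot g) := fun i =>
    (fun u => (⟨φ i.1 u, i.2 * s i.1 u⟩ : Tot g)) '' closedBall 0 1
  have hK : ∀ i, IsCompact (K i) := fun i =>
    (isCompact_closedBall _ _).image (hs i.1 i.2).continuous
  refine SigmaCompactSpace.of_countable (Set.range K) (Set.countable_range K)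
    (by rintro _ ⟨i, rfl⟩; exact hK i) (Set.eq_univ_of_forall fun p => ?_)
  have hp : p.pt ∈ ⋃ x ∈ t, φ x '' closedBall 0 1 := by rw [htc]; trivial
  obtain ⟨x, hx, u, hu, hup⟩ := Set.mem_iUnion₂.1 hp
  refine Set.mem_sUnion.2 ⟨_, ⟨(⟨x, hx⟩, p.lab * (s x u)⁻¹), rfl⟩, u, hu, ?_⟩
  simp [hup]

theorem noncompactSpace [T2Space X] [Infinite G] [Nonempty X] (hg : ∀ x, CocycleAt g x) :
    NoncompactSpace (Tot g) := by
  by_contra h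
  rw [← not_compactSpace_iff, not_not] at h
  obtain ⟨x⟩ := ‹Nonempty X›
  have hF : IsCompact ((pt : Tot g → X) ⁻¹' {x}) :=
    (isClosed_singleton.preimage (continuous_pt hg)).isCompact
  obtain ⟨t, htF, ht⟩ := hF.elim_nhds_subcover
    (fun p : Tot g => {q | q.lab = p.lab * g p.pt q.pt}) fun p _ => by
      change ∀ᶠ q in 𝓝 p, q.lab = p.lab * g p.pt q.pt
      rw [nhds_eq hg, eventually_map]
      exact Eventually.of_forall fun _ => rfl
  refine Set.infinite_univ (α := G) ((t.finite_toSet.image lab).subset fun a _ => ?_)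
  have ha : (⟨x, a⟩ : Tot g) ∈ ((pt : Tot g → X) ⁻¹' {x}) := rfl
  obtain ⟨p, hp, hpa⟩ := Set.mem_iUnion₂.1 (ht ha)
  have hp' : p.pt = x := htF p hp
  refine ⟨p, hp, ?_⟩
  have h1 : a = p.lab * g p.pt x := hpa
  rw [h1, hp', (hg x).self_eq_one, mul_one]

/-- The lift of a path. -/
noncomputable def liftPath (hg : ∀ x, CocycleAt g x) {x y : X} (γ : Path x y) (a : G) :
    Path (⟨x, a⟩ : Tot g) ⟨y, a * holPath hg γ⟩ where
  toFun t := ⟨γ t, a * (exists_prim γ.continuous (fun t => hg (γ t)) 0 (1 : G)).choose t⟩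
  continuous_toFun := continuous_iff_continuousAt.2 fun t => (continuousAt_iff hg).2
    ⟨γ.continuous.continuousAt, ((exists_prim γ.continuous
      (fun t => hg (γ t)) 0 (1 : G)).choose_spec.1 t).mul_left a⟩
  source' := by
    rw [(exists_prim γ.continuous (fun t => hg (γ t)) 0 (1 : G)).choose_spec.2]
    simp
  target' := by
    simp [holPath]

theorem liftPath_pt (hg : ∀ x, CocycleAt g x) {x y : X} (γ : Path x y) (a : G) (t : I) :
    (liftPath hg γ a t).pt = γ t := rfl

theorem primAt_liftPath (hg : ∀ x, CocycleAt g x) {x y : X} (γ : Path x y) (a : G) (t : I) :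
    PrimAt g γ (fun t => (liftPath hg γ a t).lab) t :=
  ((continuousAt_iff hg).1 (liftPath hg γ a).continuous.continuousAt).2

theorem connectedSpace [PathConnectedSpace X] (hg : ∀ x, CocycleAt g x) (x₀ : X)
    (hs : Function.Surjective (hol hg x₀)) : PathConnectedSpace (Tot g) := by
  have h : ∀ p : Tot g, Joined (⟨x₀, 1⟩ : Tot g) p := fun ⟨x, a⟩ => by
    let τ := PathConnectedSpace.somePath x₀ x
    obtain ⟨b, hb⟩ := hs (a * (holPath hg τ)⁻¹)
    obtain ⟨γ, rfl⟩ := Pi1.mk_surjective b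
    have h1 := liftPath hg (γ.trans τ) 1
    rw [holPath_trans, ← hol_mk, hb, inv_mul_cancel_right, one_mul] at h1
    exact ⟨h1⟩
  exact ⟨⟨⟨x₀, 1⟩⟩, fun p q => (h p).symm.trans (h q)⟩

theorem isFreeGroup_ker [T2Space X] [SigmaCompactSpace X] [PathConnectedSpace X] [Infinite G]
    [Countable G] (hX : PlaneCharts X) (x₀ : X) (c : Pi1 x₀ →* G) (hc : Function.Surjective c) :
    IsFreeGroup c.ker := by
  obtain ⟨u, hu, huu⟩ := exists_universal_cocycle hX x₀
  have hg : ∀ x, CocycleAt (fun a b => c (u a b)) x := fun x => (hu x).hom c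
  have hhol : ∀ γ : Path x₀ x₀, holPath hg γ = c (Pi1.mk γ) := fun γ => by
    rw [holPath_comp hu c, ← hol_mk, huu]
  have := t2Space hg
  have := noncompactSpace hg
  have := sigmaCompactSpace hg hX
  have := connectedSpace hg x₀ fun a => by
    obtain ⟨b, rfl⟩ := hc a
    obtain ⟨γ, rfl⟩ := Pi1.mk_surjective b
    exact ⟨Pi1.mk γ, hhol γ⟩
  have hfree := isFreeGroup_pi1 (planeCharts hg hX) (⟨x₀, 1⟩ : Tot fun a b => c (u a b))
  let j : Pi1 (⟨x₀, 1⟩ : Tot fun a b => c (u a b)) →* Pi1 x₀ :=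
    hol (fun p => (hu p.pt).comp (continuous_pt hg)) (⟨x₀, 1⟩ : Tot fun a b => c (u a b))
  have hj : ∀ γ, j (Pi1.mk γ) = Pi1.mk (γ.map (continuous_pt hg)) := fun γ => by
    simp only [j, hol_mk]
    rw [holPath_map hu (continuous_pt hg), ← hol_mk, huu]
  have hinj : Function.Injective j := by
    intro a b hab
    obtain ⟨γ, rfl⟩ := Pi1.mk_surjective a
    obtain ⟨γ', rfl⟩ := Pi1.mk_surjective b
    rw [hj, hj] at hab
    exact (isCoveringMap hg).injective_path_homotopic_map _ _ hab
  have hrange : j.range = c.ker := by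
    ext a
    obtain ⟨γ, rfl⟩ := Pi1.mk_surjective a
    rw [MonoidHom.mem_ker, MonoidHom.mem_range]
    constructor
    · rintro ⟨b, hb⟩
      obtain ⟨δ, rfl⟩ := Pi1.mk_surjective b
      rw [← hb, hj, ← hhol]
      rw [holPath_eq hg (δ.map (continuous_pt hg)) (s := fun t => (δ t).lab) fun t =>
        ((continuousAt_iff hg).1 δ.continuous.continuousAt).2]
      simp
    · intro h
      have h1 : (1 : G) * holPath hg γ = 1 := by rw [hhol, h, one_mul]
      refine ⟨Pi1.mk ((liftPath hg γ 1).cast rfl (by rw [h1])), ?_⟩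
      rw [hj]
      rfl
  exact IsFreeGroup.ofMulEquiv ((MonoidHom.ofInjective hinj).trans (MulEquiv.subgroupCongr hrange))

end Tot

/-- The group with two elements. -/
abbrev Z2 : Type := Multiplicative (ZMod 2)

theorem Z2.mul_self (x : Z2) : x * x = 1 := by
  revert x; decide

theorem Z2.mul_eq_one_of_ne {x y : Z2} (hx : x ≠ 1) (hy : y ≠ 1) : x * y = 1 := by
  revert x y; decide

section Dipoles

variable {N : Type} [TopologicalSpace N]

/-- `η` has a primitive on a punctured neighbourhood of `x`. -/
def Removable (η : N → N → Z2) (x : N) : Prop :=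
  ∃ s : N → Z2, ∀ᶠ y in 𝓝 x, y ≠ x → ∀ᶠ z in 𝓝 y, s z = s y * η y z

theorem CocycleAt.removable {η : N → N → Z2} {x : N} (h : CocycleAt η x) : Removable η x :=
  ⟨η x, h.mono fun _ hy _ => hy⟩

theorem Removable.mul {η η' : N → N → Z2} {x : N} (h : Removable η x) (h' : Removable η' x) :
    Removable (fun a b => η a b * η' a b) x := by
  obtain ⟨s, hs⟩ := h
  obtain ⟨s', hs'⟩ := h'
  refine ⟨fun y => s y * s' y, ?_⟩
  filter_upwards [hs, hs'] with y hy hy' hne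
  filter_upwards [hy hne, hy' hne] with z hz hz'
  rw [hz, hz', mul_mul_mul_comm]

theorem CocycleAt.mul_comm_group {η η' : N → N → Z2} {x : N} (h : CocycleAt η x)
    (h' : CocycleAt η' x) : CocycleAt (fun a b => η a b * η' a b) x := by
  filter_upwards [h, h'] with y hy hy'
  filter_upwards [hy, hy'] with z hz hz'
  rw [hz, hz', mul_mul_mul_comm]

theorem Removable.of_mul_left {η η' : N → N → Z2} {x : N}
    (h : Removable (fun a b => η a b * η' a b) x) (h' : Removable η x) : Removable η' x := by
  have := h'.mul h
  simpa only [← mul_assoc, Z2.mul_self, one_mul] using this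

theorem Removable.of_mul_right {η η' : N → N → Z2} {x : N}
    (h : Removable (fun a b => η a b * η' a b) x) (h' : Removable η' x) : Removable η x := by
  have := h.mul h'
  simpa only [mul_assoc, Z2.mul_self, mul_one] using this

theorem Removable.exists_repair [T2Space N] {η : N → N → Z2} {y : N} (h : Removable η y) :
    ∃ ζ : N → N → Z2, CocycleAt ζ y ∧ ∀ p q, p ≠ y → q ≠ y → ζ p q = η p q := by
  classical
  obtain ⟨s, hs⟩ := h
  refine ⟨fun p q => if p = y then (if q = y then 1 else s q) else if q = y then s p else η p q,
    ?_, fun p q hp hq => by simp [hp, hq]⟩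
  filter_upwards [hs] with p hp
  by_cases hpy : p = y
  · exact Eventually.of_forall fun q => by simp [hpy]
  · filter_upwards [hp hpy, isOpen_ne.mem_nhds hpy] with q hq hqy
    have hqy : q ≠ y := hqy
    simp [hpy, hqy, hq]

theorem Removable.of_isOpenEmbedding {Y : Type} [TopologicalSpace Y] {f : Y → N}
    (hf : IsOpenEmbedding f) {η : N → N → Z2} {y : Y} (h : Removable η (f y)) :
    Removable (fun a b => η (f a) (f b)) y := by
  obtain ⟨s, hs⟩ := h
  refine ⟨fun y => s (f y), ?_⟩
  filter_upwards [hf.continuous.continuousAt.eventually hs] with z hz hne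
  exact hf.continuous.continuousAt.eventually (hz fun h => hne (hf.injective h))

theorem removable_of_holPath_eq_one {φ : ℂ → N} (hφ : IsOpenEmbedding φ) {η : N → N → Z2}
    (hk : ∀ p : {u : ℂ // u ≠ id 0}, CocycleAt (fun p q : {u : ℂ // u ≠ id 0} => η (φ p) (φ q)) p)
    (hr : holPath hk (circleLoop .id) = 1) : Removable η (φ 0) := by
  obtain ⟨s, -, hs⟩ := exists_periodic_prim .id hk hr
  refine ⟨fun p => s (Function.invFun φ p), ?_⟩
  have hinv := Function.leftInverse_invFun hφ.injective
  rw [← hφ.map_nhds_eq, eventually_map]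
  refine Eventually.of_forall fun u hu => ?_
  have hu0 : u ≠ 0 := fun h => hu (h ▸ rfl)
  rw [← hφ.map_nhds_eq, eventually_map]
  filter_upwards [hs u hu0, isOpen_ne.mem_nhds hu0] with v hv hv0
  rw [hinv, hinv]
  exact hv hv0

theorem cocycleAt_punctured {φ : ℂ → N} (hφ : IsOpenEmbedding φ) {η : N → N → Z2}
    (h : ∀ u, u ≠ 0 → CocycleAt η (φ u)) (p : {u : ℂ // u ≠ id 0}) :
    CocycleAt (fun p q : {u : ℂ // u ≠ id 0} => η (φ p) (φ q)) p :=
  (h p p.2).comp (hφ.continuous.comp continuous_subtype_val)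

theorem removable_mul_of_not {φ : ℂ → N} (hφ : IsOpenEmbedding φ) {η η' : N → N → Z2}
    (h : ∀ u, u ≠ 0 → CocycleAt η (φ u)) (h' : ∀ u, u ≠ 0 → CocycleAt η' (φ u))
    (hn : ¬ Removable η (φ 0)) (hn' : ¬ Removable η' (φ 0)) :
    Removable (fun a b => η a b * η' a b) (φ 0) := by
  have hk := cocycleAt_punctured hφ h
  have hk' := cocycleAt_punctured hφ h'
  have h1 := mt (removable_of_holPath_eq_one hφ hk) hn
  have h1' := mt (removable_of_holPath_eq_one hφ hk') hn'
  refine removable_of_holPath_eq_one hφ (fun p => (hk p).mul_comm_group (hk' p)) ?_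
  obtain ⟨s, hs, hs0⟩ := exists_prim (circleLoop (φ := (id : ℂ → ℂ)) .id).continuous
    (fun t => hk _) 0 1
  obtain ⟨s', hs', hs0'⟩ := exists_prim (circleLoop (φ := (id : ℂ → ℂ)) .id).continuous
    (fun t => hk' _) 0 1
  rw [holPath_eq _ _ hs, hs0, inv_one, one_mul] at h1
  rw [holPath_eq _ _ hs', hs0', inv_one, one_mul] at h1'
  rw [holPath_eq _ _ (s := fun t => s t * s' t) fun t => ?_]
  · rw [hs0, hs0', Z2.mul_eq_one_of_ne h1 h1']; simp
  · filter_upwards [hs t, hs' t] with z hz hz'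
    rw [hz, hz', mul_mul_mul_comm]

/-- `η` is a compactly supported `ℤ/2`-cocycle with exactly the two singularities `x` and `y`. -/
structure IsDipole (η : N → N → Z2) (x y : N) : Prop where
  compact_support : ∃ C : Set N, IsCompact C ∧ ∀ p, p ∉ C → ∀ᶠ q in 𝓝 p, η p q = 1
  cocycleAt : ∀ z, z ≠ x → z ≠ y → CocycleAt η z
  left : ¬ Removable η x
  right : ¬ Removable η y

theorem IsDipole.symm {η : N → N → Z2} {x y : N} (h : IsDipole η x y) : IsDipole η y x :=
  ⟨h.1, fun z hx hy => h.2 z hy hx, h.4, h.3⟩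

theorem PlaneCharts.exists_chart_subset (hN : PlaneCharts N) {U : Set N} (hU : IsOpen U) {x : N}
    (hx : x ∈ U) : ∃ φ : ℂ → N, IsOpenEmbedding φ ∧ φ 0 = x ∧ ∀ u, φ u ∈ U := by
  obtain ⟨φ, hφ, h0⟩ := hN.of_isOpenEmbedding hU.isOpenEmbedding_subtypeVal ⟨x, hx⟩
  exact ⟨_, hU.isOpenEmbedding_subtypeVal.comp hφ, by simp [h0], fun u => (φ u).2⟩

theorem IsDipole.trans [T2Space N] (hN : PlaneCharts N) {η η' : N → N → Z2} {x y z : N}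
    (h : IsDipole η x y) (h' : IsDipole η' y z) (hxy : x ≠ y) (hyz : y ≠ z) (hxz : x ≠ z) :
    ∃ ζ, IsDipole ζ x z := by
  obtain ⟨φ, hφ, rfl, hU⟩ := hN.exists_chart_subset (U := {x, z}ᶜ) (x := y)
    (Set.toFinite {x, z}).isClosed.isOpen_compl (by simp [hxy.symm, hyz])
  have hux : ∀ u, φ u ≠ x := fun u h => hU u (Or.inl h)
  have huz : ∀ u, φ u ≠ z := fun u h => hU u (Or.inr h)
  have hrem := removable_mul_of_not hφ
    (fun u hu => h.cocycleAt _ (hux u) fun h => hu (hφ.injective h))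
    (fun u hu => h'.cocycleAt _ (fun h => hu (hφ.injective h)) (huz u)) h.right h'.left
  obtain ⟨ζ, hζ, hζ'⟩ := hrem.exists_repair
  have hnear : ∀ p, p ≠ φ 0 → ∀ᶠ a in 𝓝 p, ∀ᶠ b in 𝓝 a, η a b * η' a b = ζ a b := fun p hp => by
    filter_upwards [isOpen_ne.mem_nhds hp] with a ha
    filter_upwards [isOpen_ne.mem_nhds ha] with b hb
    exact (hζ' a b ha hb).symm
  have hrm : ∀ p, p ≠ φ 0 → Removable ζ p → Removable (fun a b => η a b * η' a b) p := by
    rintro p hp ⟨s, hs⟩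
    refine ⟨s, ?_⟩
    filter_upwards [hs, hnear p hp] with a ha ha' hne
    filter_upwards [ha hne, ha'] with b hb hb'
    rw [hb, hb']
  obtain ⟨C, hC, hC1⟩ := h.compact_support
  obtain ⟨C', hC', hC1'⟩ := h'.compact_support
  refine ⟨ζ, ⟨C ∪ C' ∪ {φ 0}, (hC.union hC').union isCompact_singleton, fun p hp => ?_⟩,
    fun p hx hz => ?_, fun hr => ?_, fun hr => ?_⟩
  · simp only [Set.mem_union, Set.mem_singleton_iff, not_or] at hp
    filter_upwards [hC1 p hp.1.1, hC1' p hp.1.2, (hnear p hp.2).self_of_nhds] with q h1 h2 h3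
    rw [← h3, h1, h2, one_mul]
  · obtain rfl | hy := eq_or_ne p (φ 0)
    · exact hζ
    · exact ((h.cocycleAt p hx hy).mul_comm_group (h'.cocycleAt p hy hz)).congr (hnear p hy)
  · exact h.left ((hrm x hxy hr).of_mul_right (h'.cocycleAt x hxy hxz).removable)
  · exact h'.right ((hrm z hyz.symm hr).of_mul_left (h.cocycleAt z hxz.symm hyz.symm).removable)

/-- The open rectangle in which `slit` is supported. -/
def InBox (u : ℂ) : Prop := 0 < u.re ∧ u.re < 1 ∧ |u.im| < 1

theorem InBox.eventually {u : ℂ} (h : InBox u) : ∀ᶠ v in 𝓝 u, InBox v :=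
  ((isOpen_lt continuous_const Complex.continuous_re).inter
    ((isOpen_lt Complex.continuous_re continuous_const).inter
      (isOpen_lt Complex.continuous_im.abs continuous_const))).mem_nhds h

open Classical in
/-- The cocycle on the plane that detects crossings of the segment from `0` to `1`. -/
noncomputable def slit (u v : ℂ) : Z2 :=
  if InBox u ∧ InBox v ∧ ¬ (0 ≤ u.im ↔ 0 ≤ v.im) then Multiplicative.ofAdd 1 else 1

theorem slit_eq_one {u v : ℂ} (h : ¬ InBox u ∨ ¬ InBox v ∨ (0 ≤ u.im ↔ 0 ≤ v.im)) :
    slit u v = 1 := by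
  rw [slit, if_neg]
  tauto

theorem exists_nhds_slit_eq_one {u : ℂ} (h : u.im ≠ 0 ∨ u.re < 0 ∨ 1 < u.re) :
    ∃ V ∈ 𝓝 u, ∀ a ∈ V, ∀ b ∈ V, slit a b = 1 := by
  rcases h with h | h | h
  · rcases h.lt_or_gt with h | h
    · have h1 : ∀ᶠ a : ℂ in 𝓝 u, a.im < 0 :=
        (isOpen_lt Complex.continuous_im continuous_const).mem_nhds h
      exact ⟨_, h1, fun a (ha : a.im < 0) b (hb : b.im < 0) =>
        slit_eq_one (Or.inr (Or.inr (by simp only [ha.not_ge, hb.not_ge])))⟩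
    · have h1 : ∀ᶠ a : ℂ in 𝓝 u, 0 < a.im :=
        (isOpen_lt continuous_const Complex.continuous_im).mem_nhds h
      exact ⟨_, h1, fun a (ha : 0 < a.im) b (hb : 0 < b.im) =>
        slit_eq_one (Or.inr (Or.inr (by simp only [ha.le, hb.le])))⟩
  · have h1 : ∀ᶠ a : ℂ in 𝓝 u, a.re < 0 :=
      (isOpen_lt Complex.continuous_re continuous_const).mem_nhds h
    exact ⟨_, h1, fun a (ha : _ < _) b _ => slit_eq_one (Or.inl fun hb => ha.not_gt hb.1)⟩
  · have h1 : ∀ᶠ a : ℂ in 𝓝 u, 1 < a.re :=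
      (isOpen_lt continuous_const Complex.continuous_re).mem_nhds h
    exact ⟨_, h1, fun a (ha : _ < _) b _ => slit_eq_one (Or.inl fun hb => ha.not_gt hb.2.1)⟩

theorem cocycleAt_slit {u : ℂ} (h0 : u ≠ 0) (h1 : u ≠ 1) : CocycleAt slit u := by
  by_cases hu : InBox u
  · filter_upwards [hu.eventually, eventually_eventually_nhds.2 hu.eventually] with a ha ha'
    filter_upwards [ha'] with b hb
    by_cases h2 : 0 ≤ u.im <;> by_cases h3 : 0 ≤ a.im <;> by_cases h4 : 0 ≤ b.im <;>
      simp [slit, hu, ha, hb, h2, h3, h4] <;> decide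
  · have h : u.im ≠ 0 ∨ u.re < 0 ∨ 1 < u.re := by
      by_contra! hcon
      obtain ⟨h2, h3, h4⟩ := hcon
      refine hu ⟨lt_of_le_of_ne h3 fun h => h0 ?_, lt_of_le_of_ne h4 fun h => h1 ?_, by simp [h2]⟩
      · exact Complex.ext h.symm (by simpa using h2)
      · exact Complex.ext (by simpa using h) (by simpa using h2)
    obtain ⟨V, hV, hV1⟩ := exists_nhds_slit_eq_one h
    have huV := mem_of_mem_nhds hV
    filter_upwards [eventually_mem_nhds_iff.2 hV, hV] with a ha haV
    filter_upwards [ha] with b hbV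
    rw [hV1 u huV b hbV, hV1 u huV a haV, hV1 a haV b hbV, one_mul]

theorem not_removable_slit {c ε : ℝ} (h : (c = 0 ∧ ε = 1) ∨ (c = 1 ∧ ε = -1)) :
    ¬ Removable slit c := by
  rintro ⟨s, hs⟩
  obtain ⟨r₀, hr₀, hs⟩ := Metric.eventually_nhds_iff_ball.1 hs
  obtain ⟨r, hr, hr1, hrr⟩ : ∃ r : ℝ, 0 < r ∧ r < 1 ∧ r < r₀ :=
    ⟨min r₀ 1 / 2, by positivity, by linarith [min_le_right r₀ 1], by
      have := min_le_left r₀ 1; linarith⟩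
  have hε : ε ≠ 0 := by rcases h with h | h <;> simp [h]
  have hε1 : |ε| = 1 := by rcases h with h | h <;> simp [h]
  let p : ℝ → ℂ := fun θ => ⟨c + ε * r * Real.cos θ, ε * r * Real.sin θ⟩
  have hp : Continuous p := by
    have : p = fun θ => ((c + ε * r * Real.cos θ : ℝ) : ℂ) +
        ((ε * r * Real.sin θ : ℝ) : ℂ) * Complex.I := by
      funext θ
      apply Complex.ext <;> simp [p] <;> exact Or.inl rfl
    rw [this]
    fun_prop
  have hsp : ∀ θ, PrimAt slit p (fun θ => s (p θ)) θ := by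
    intro θ
    have hd : ‖p θ - c‖ = r := by
      have : p θ - c = ((ε * r : ℝ) : ℂ) * Complex.exp (θ * Complex.I) := by
        rw [Complex.exp_mul_I]
        apply Complex.ext <;> simp [p] <;> exact Or.inl rfl
      rw [this, norm_mul, Complex.norm_exp_ofReal_mul_I, Complex.norm_real, Real.norm_eq_abs,
        abs_mul, hε1, abs_of_pos hr]
      simp
    refine hp.continuousAt.eventually (hs (p θ) (by rwa [mem_ball, dist_eq_norm, hd]) fun h => ?_)
    rw [h, sub_self, norm_zero] at hd
    exact hr.ne hd
  have hconst : ∀ θ ∈ Set.Ioo 0 (2 * Real.pi), PrimAt slit p (fun _ => (1 : Z2)) θ := by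
    intro θ hθ
    have h1 : (p θ).im ≠ 0 ∨ (p θ).re < 0 ∨ 1 < (p θ).re := by
      by_cases hsin : Real.sin θ = 0
      · have hπ : θ = Real.pi := by
          obtain ⟨n, hn⟩ := Real.sin_eq_zero_iff.1 hsin
          have h0 : 0 < (n : ℝ) := by
            have := hθ.1; rw [← hn] at this; exact pos_of_mul_pos_left this Real.pi_pos.le
          have h2 : (n : ℝ) < 2 := by
            have := hθ.2; rw [← hn] at this; exact lt_of_mul_lt_mul_right this Real.pi_pos.le
          have hn1 : n = 1 := by
            have : 0 < n := by exact_mod_cast h0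
            have : n < 2 := by exact_mod_cast h2
            omega
          rw [← hn, hn1]; simp
        right
        rcases h with ⟨rfl, rfl⟩ | ⟨rfl, rfl⟩
        · left; simp [p, hπ, hr]
        · right; simp [p, hπ, hr]
      · left
        simp [p, hε, hr.ne', hsin]
    obtain ⟨V, hV, hV1⟩ := exists_nhds_slit_eq_one h1
    filter_upwards [hp.continuousAt.preimage_mem_nhds hV] with z hz
    rw [hV1 _ (mem_of_mem_nhds hV) _ hz, one_mul]
  have hbox : InBox (p 0) := by
    rcases h with ⟨rfl, rfl⟩ | ⟨rfl, rfl⟩ <;> simp [p, InBox, hr, hr1]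
  have hnear := (hsp 0).and (hp.continuousAt.eventually hbox.eventually)
  have hneg : ∀ᶠ θ in 𝓝 (0 : ℝ), _ := (show Continuous fun θ : ℝ => -θ by fun_prop).tendsto' 0 0
    neg_zero |>.eventually hnear
  have hsmall : ∀ᶠ θ in 𝓝[>] (0 : ℝ), θ < Real.pi :=
    (eventually_lt_nhds Real.pi_pos).filter_mono nhdsWithin_le_nhds
  obtain ⟨θ, ⟨h1, h2⟩, ⟨h3, h4⟩, hθ, hθ0⟩ := ((hnear.filter_mono nhdsWithin_le_nhds).and
    ((hneg.filter_mono nhdsWithin_le_nhds).and (hsmall.and self_mem_nhdsWithin))).exists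
  have hθ0 : 0 < θ := hθ0
  have hsin := Real.sin_pos_of_pos_of_lt_pi hθ0 hθ
  have hper : p (-θ) = p (2 * Real.pi - θ) := by
    simp [p, Real.cos_two_pi_sub, Real.sin_two_pi_sub]
  have heq : s (p (-θ)) = s (p θ) := by
    have := PrimAt.unique_set isPreconnected_Ioo hconst (fun θ _ => hsp θ)
      (y := θ) (z := 2 * Real.pi - θ) ⟨hθ0, by linarith⟩ ⟨by linarith, by linarith⟩
    simpa [hper] using this
  have h5 : slit (p 0) (p (-θ)) = slit (p 0) (p θ) := by
    simp only at h1 h3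
    rw [h1, h3] at heq
    exact mul_left_cancel heq
  have him0 : (p 0).im = 0 := by simp [p]
  have hex : ((p θ).im < 0 ∧ 0 ≤ (p (-θ)).im) ∨ (0 ≤ (p θ).im ∧ (p (-θ)).im < 0) := by
    have h7 : 0 < r * Real.sin θ := by positivity
    rcases h with ⟨rfl, rfl⟩ | ⟨rfl, rfl⟩
    · right; simp [p, h7.le, hr, hsin]
    · left; simp [p, h7.le, hr, hsin]
  rcases hex with ⟨h6, h7⟩ | ⟨h6, h7⟩
  · rw [slit_eq_one (v := p (-θ)) (by simp [him0, h7]), slit, if_pos ⟨hbox, h2, by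
      simp [him0, h6.not_ge]⟩] at h5
    exact absurd h5 (by decide)
  · rw [slit_eq_one (v := p θ) (by simp [him0, h6]), slit, if_pos ⟨hbox, h4, by
      simp [him0, h7.not_ge]⟩] at h5
    exact absurd h5 (by decide)

theorem exists_isDipole_chart [T2Space N] {φ : ℂ → N} (hφ : IsOpenEmbedding φ) :
    ∃ η, IsDipole η (φ 0) (φ 1) := by
  classical
  let η : N → N → Z2 := fun p q => if p ∈ Set.range φ ∧ q ∈ Set.range φ then
    slit (Function.invFun φ p) (Function.invFun φ q) else 1
  have hη : ∀ u v, η (φ u) (φ v) = slit u v := fun u v => by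
    simp [η, Function.leftInverse_invFun hφ.injective u,
      Function.leftInverse_invFun hφ.injective v]
  have hC : IsCompact (φ '' closedBall 0 2) := (isCompact_closedBall _ _).image hφ.continuous
  have hC1 : ∀ p ∉ φ '' closedBall 0 2, ∀ q, η p q = 1 := fun p hp q => by
    by_cases h : p ∈ Set.range φ ∧ q ∈ Set.range φ
    · obtain ⟨⟨u, rfl⟩, v, rfl⟩ := h
      rw [hη]
      refine slit_eq_one (Or.inl fun h => hp ⟨u, ?_, rfl⟩)
      rw [mem_closedBall_zero_iff]
      have := Complex.norm_le_abs_re_add_abs_im u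
      have h1 : |u.re| < 1 := by rw [abs_of_pos h.1]; exact h.2.1
      linarith [h.2.2]
    · exact if_neg h
  refine ⟨η, ⟨_, hC, fun p hp => Eventually.of_forall (hC1 p hp)⟩, fun p h0 h1 => ?_,
    fun h => ?_, fun h => ?_⟩
  · by_cases hp : p ∈ Set.range φ
    · obtain ⟨u, rfl⟩ := hp
      rw [cocycleAt_iff_of_isOpenEmbedding hφ]
      simp only [hη]
      exact cocycleAt_slit (fun h => h0 (h ▸ rfl)) (fun h => h1 (h ▸ rfl))
    · have hp' : p ∉ φ '' closedBall 0 2 := fun h => hp (Set.image_subset_range _ _ h)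
      refine CocycleAt.congr (g := fun _ _ => 1) (Eventually.of_forall fun _ =>
        Eventually.of_forall fun _ => by simp) ?_
      filter_upwards [hC.isClosed.isOpen_compl.mem_nhds hp'] with a ha
      exact Eventually.of_forall fun b => (hC1 a ha b).symm
  · have := h.of_isOpenEmbedding hφ
    simp only [hη] at this
    simpa using not_removable_slit (Or.inl ⟨rfl, rfl⟩) (by simpa using this)
  · have := h.of_isOpenEmbedding hφ
    simp only [hη] at this
    simpa using not_removable_slit (Or.inr ⟨rfl, rfl⟩) (by simpa using this)

theorem exists_isDipole [T2Space N] [PreconnectedSpace N] (hN : PlaneCharts N) {x y : N}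
    (hxy : x ≠ y) : ∃ η, IsDipole η x y := by
  suffices h : x = y ∨ ∃ η, IsDipole η x y from h.resolve_left hxy
  refine PreconnectedSpace.induction₂' (fun x y => x = y ∨ ∃ η, IsDipole η x y) (fun x => ?_)
    ⟨fun x y z hxy hyz => ?_⟩ x y
  · obtain ⟨φ, hφ, rfl⟩ := hN x
    filter_upwards [hφ.isOpen_range.mem_nhds ⟨0, rfl⟩] with y hy
    obtain ⟨u, rfl⟩ := hy
    obtain rfl | hu := eq_or_ne u 0
    · simp
    · obtain ⟨η, hη⟩ := exists_isDipole_chart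
        (hφ.comp (Homeomorph.mulLeft₀ u hu).isOpenEmbedding)
      simp only [Function.comp, Homeomorph.coe_mulLeft₀, mul_zero, mul_one] at hη
      exact ⟨Or.inr ⟨η, hη⟩, Or.inr ⟨η, hη.symm⟩⟩
  · rcases hxy with rfl | ⟨η, hη⟩
    · exact hyz
    rcases hyz with rfl | ⟨η', hη'⟩
    · exact Or.inr ⟨η, hη⟩
    by_cases hxy : x = y
    · subst hxy; exact Or.inr ⟨η', hη'⟩
    by_cases hyz : y = z
    · subst hyz; exact Or.inr ⟨η, hη⟩
    by_cases hxz : x = z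
    · exact Or.inl hxz
    exact Or.inr (hη.trans hN hη' hxy hyz hxz)

end Dipoles

section

variable {X : Type} [TopologicalSpace X] {G : Type} [Group G] {g : X → X → G}

theorem holPath_eq_of_coe (hg : ∀ x, CocycleAt g x) {x y x' y' : X} {γ : Path x y}
    {γ' : Path x' y'} (h : (γ : I → X) = γ') : holPath hg γ = holPath hg γ' := by
  obtain ⟨s, hs, -⟩ := exists_prim γ.continuous (fun t => hg (γ t)) 0 (1 : G)
  rw [holPath_eq hg γ hs, holPath_eq hg γ' (s := s) fun t => h ▸ hs t]

theorem Tot.coe_eq (hg : ∀ x, CocycleAt g x) {p q p' q' : Tot g} {γ : Path p q}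
    {γ' : Path p' q'} (h : ∀ t, (γ t).pt = (γ' t).pt) (h0 : p = p') : (γ : I → Tot g) = γ' :=
  (isCoveringMap hg).eq_of_comp_eq γ.continuous γ'.continuous (funext h) 0 (by simp [h0])

/-- The holonomy of a cocycle on the total space of `g` along the lift of a path. -/
noncomputable def liftHol (hg : ∀ x, CocycleAt g x) {η : Tot g → Tot g → Z2}
    (hη : ∀ p, CocycleAt η p) {x y : X} (γ : Path x y) (a : G) : Z2 :=
  holPath hη (Tot.liftPath hg γ a)

variable (hg : ∀ x, CocycleAt g x) {η : Tot g → Tot g → Z2} (hη : ∀ p, CocycleAt η p)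

theorem liftHol_trans {x y z : X} (γ : Path x y) (δ : Path y z) (a : G) :
    liftHol hg hη (γ.trans δ) a = liftHol hg hη γ a * liftHol hg hη δ (a * holPath hg γ) := by
  rw [liftHol, liftHol, liftHol, ← holPath_trans]
  refine holPath_eq_of_coe hη (Tot.coe_eq hg (fun t => ?_) rfl)
  rw [Tot.liftPath_pt, Path.trans_apply, Path.trans_apply]
  split_ifs <;> rfl

theorem liftHol_homotopic {x y : X} {γ δ : Path x y} (h : γ.Homotopic δ) (a : G) :
    liftHol hg hη γ a = liftHol hg hη δ a := by
  have he : holPath hg γ = holPath hg δ := holPath_homotopic hg h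
  let ε : Path (⟨x, a⟩ : Tot g) ⟨y, a * holPath hg γ⟩ :=
    (Tot.liftPath hg δ a).cast rfl (by rw [he])
  have hc : (Tot.liftPath hg δ a : I → Tot g) = ε := rfl
  rw [liftHol, liftHol, holPath_eq_of_coe hη hc]
  refine holPath_homotopic hη (Path.Homotopic.Quotient.exact
    ((Tot.isCoveringMap hg).injective_path_homotopic_map _ _ ?_))
  have h1 : Path.Homotopic.Quotient.mk γ = Path.Homotopic.Quotient.mk δ :=
    Path.Homotopic.Quotient.eq.2 h
  exact h1

theorem liftPath_lab {x y : X} (γ : Path x y) (a : G) (t : I) :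
    (Tot.liftPath hg γ a t).lab = a * (Tot.liftPath hg γ 1 t).lab := by
  change a * _ = a * (1 * _)
  rw [one_mul]

theorem finite_labels_of_isCompact [T2Space X] {C : Set (Tot g)} (hC : IsCompact C) {x y : X}
    (γ : Path x y) : {a | ∃ t, Tot.liftPath hg γ a t ∈ C}.Finite := by
  have hZ : IsCompact {p : I × Tot g | p.2 ∈ C ∧ p.2.pt = γ p.1} := by
    refine (isCompact_univ.prod hC).of_isClosed_subset ?_ fun p hp => ⟨trivial, hp.1⟩
    have := Tot.t2Space hg
    exact (hC.isClosed.preimage continuous_snd).inter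
      (isClosed_eq ((Tot.continuous_pt hg).comp continuous_snd)
        (γ.continuous.comp continuous_fst))
  let s : I → G := fun t => (Tot.liftPath hg γ 1 t).lab
  obtain ⟨T, hTZ, hT⟩ := hZ.elim_nhds_subcover
    (fun p : I × Tot g => {q | s q.1 = s p.1 * g (γ p.1) (γ q.1) ∧
      q.2.lab = p.2.lab * g p.2.pt q.2.pt}) fun p _ => by
      refine (continuous_fst.continuousAt.eventually (Tot.primAt_liftPath hg γ 1 p.1)).and
        (continuous_snd.continuousAt.eventually (p := fun q : Tot g =>
          q.lab = p.2.lab * g p.2.pt q.pt) ?_)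
      rw [Tot.nhds_eq hg, eventually_map]
      exact Eventually.of_forall fun _ => rfl
  refine (T.finite_toSet.image fun p => p.2.lab * (s p.1)⁻¹).subset ?_
  rintro a ⟨t, ht⟩
  obtain ⟨p, hp, h1, h2⟩ := Set.mem_iUnion₂.1 (hT (a := (t, Tot.liftPath hg γ a t)) ⟨ht, rfl⟩)
  refine ⟨p, hp, ?_⟩
  have h3 := (hTZ p hp).2
  simp only [liftPath_lab hg γ a, Tot.liftPath_pt] at h1 h2
  change a * s t = _ at h2
  rw [h1, h3, ← mul_assoc] at h2
  simp [← mul_right_cancel h2]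

end

section

variable {M : Type} [TopologicalSpace M] [T2Space M] {φ : ℂ → M} {G : Type} [Group G]
  {g : M → M → G}

theorem cocycleAt_subtype (hg : ∀ x, CocycleAt g x) (p : {x : M // x ≠ φ 0}) :
    CocycleAt (fun a b : {x : M // x ≠ φ 0} => g a b) p :=
  (hg p).comp continuous_subtype_val

/-- The inclusion of the part of a covering that lies over the complement of a point. -/
def totIncl (φ : ℂ → M) (g : M → M → G) (p : Tot fun a b : {x : M // x ≠ φ 0} => g a b) : Tot g :=
  ⟨p.pt, p.lab⟩

theorem continuous_totIncl (hg : ∀ x, CocycleAt g x) : Continuous (totIncl φ g) :=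
  continuous_iff_continuousAt.2 fun _ => (Tot.continuousAt_iff hg).2
    ⟨(continuous_subtype_val.comp (Tot.continuous_pt (cocycleAt_subtype hg))).continuousAt,
      ((Tot.continuousAt_iff (cocycleAt_subtype (φ := φ) hg)).1
        (continuous_id (X := Tot fun a b : {x : M // x ≠ φ 0} => g a b)).continuousAt).2⟩

theorem totIncl_liftPath (hg : ∀ x, CocycleAt g x) {x y : {x : M // x ≠ φ 0}} (γ : Path x y)
    (a : G) (t : I) : totIncl φ g (Tot.liftPath (cocycleAt_subtype hg) γ a t) =
      Tot.liftPath hg (γ.map continuous_subtype_val) a t :=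
  congrFun (Tot.coe_eq hg (γ := (Tot.liftPath (cocycleAt_subtype hg) γ a).map
    (continuous_totIncl hg)) (γ' := Tot.liftPath hg (γ.map continuous_subtype_val) a)
    (fun _ => rfl) rfl) t

variable (hg : ∀ x, CocycleAt g x) {η : Tot g → Tot g → Z2}
  (hη : ∀ p, CocycleAt (fun a b => η (totIncl φ g a) (totIncl φ g b)) p)

theorem finite_liftHol_ne_one (hC : ∃ C : Set (Tot g), IsCompact C ∧
    ∀ p, p ∉ C → ∀ᶠ q in 𝓝 p, η p q = 1) {x y : {x : M // x ≠ φ 0}} (γ : Path x y) :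
    {a | liftHol (cocycleAt_subtype hg) hη γ a ≠ 1}.Finite := by
  obtain ⟨C, hC, hC1⟩ := hC
  refine (finite_labels_of_isCompact hg hC (γ.map continuous_subtype_val)).subset fun a ha => ?_
  by_contra hcon
  simp only [Set.mem_ofPred_eq, not_exists, ← totIncl_liftPath] at hcon
  refine ha ?_
  rw [liftHol, holPath_eq hη _ (s := fun _ => 1) fun t => ?_, inv_one, one_mul]
  filter_upwards [((continuous_totIncl hg).comp
    (Tot.liftPath (cocycleAt_subtype hg) γ a).continuous).continuousAt.eventually
    (hC1 _ (hcon t))] with t' ht'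
  exact (one_mul (1 : Z2) ▸ congrArg (1 * ·) ht'.symm)

theorem liftHol_circleLoop_eq_one_iff (hφ : IsOpenEmbedding φ) {s : ℂ → G} (b : G)
    (hΦ : IsOpenEmbedding fun u => (⟨φ u, b * s u⟩ : Tot g)) :
    (liftHol (cocycleAt_subtype hg) hη (circleLoop hφ) (b * s 1) = 1 →
      Removable η ⟨φ 0, b * s 0⟩) ∧
    (CocycleAt η ⟨φ 0, b * s 0⟩ →
      liftHol (cocycleAt_subtype hg) hη (circleLoop hφ) (b * s 1) = 1) := by
  have hne : ∀ u : {u : ℂ // u ≠ id 0}, φ u ≠ φ 0 := fun u h => u.2 (hφ.injective h)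
  let Γ : {u : ℂ // u ≠ id 0} → Tot fun a b : {x : M // x ≠ φ 0} => g a b :=
    fun u => ⟨⟨φ u, hne u⟩, b * s u⟩
  have hΓ : Continuous Γ := continuous_iff_continuousAt.2 fun u =>
    (Tot.continuousAt_iff (cocycleAt_subtype hg)).2
      ⟨((hφ.continuous.comp continuous_subtype_val).subtype_mk _).continuousAt,
        ((Tot.continuousAt_iff hg).1
          (hΦ.continuous.comp continuous_subtype_val).continuousAt).2⟩
  have hk : ∀ p : {u : ℂ // u ≠ id 0}, CocycleAt (fun p q : {u : ℂ // u ≠ id 0} =>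
      η ⟨φ p, b * s p⟩ ⟨φ q, b * s q⟩) p := fun p => (hη (Γ p)).comp hΓ
  have h1 : liftHol (cocycleAt_subtype hg) hη (circleLoop hφ) (b * s 1) =
      holPath hk (circleLoop .id) := by
    refine Eq.trans ?_ (holPath_map hη hΓ (circleLoop .id)).symm
    refine holPath_eq_of_coe hη (Tot.coe_eq (cocycleAt_subtype hg) (fun t => ?_) ?_)
    · rfl
    · simp [Γ, puncturedExp]
  rw [h1]
  refine ⟨removable_of_holPath_eq_one hΦ hk, fun h0 => ?_⟩
  have hall : ∀ u, CocycleAt η ⟨φ u, b * s u⟩ := fun u => by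
    by_cases hu : u = 0
    · rwa [hu]
    · exact (cocycleAt_iff_of_isOpenEmbedding (hΦ.comp
        (isOpen_ne (x := (0 : ℂ))).isOpenEmbedding_subtypeVal) (y := ⟨u, hu⟩)).2 (hk ⟨u, hu⟩)
  obtain ⟨S, hS, -⟩ := exists_prim hΦ.continuous hall 0 1
  rw [holPath_eq hk _ (s := fun t => S (circleLoop (φ := (id : ℂ → ℂ)) .id t)) fun t =>
    (hS _).comp (continuous_subtype_val.comp
      (circleLoop (φ := (id : ℂ → ℂ)) .id).continuous).continuousAt]
  simp

theorem exists_windingCochain [ConnectedSpace M] (hM : PlaneCharts M) (hφ : IsOpenEmbedding φ)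
    (i : Pi1 (puncturedExp hφ 0) →* Pi1 (puncturedExp hφ 0 : M))
    (hi : ∀ γ, i (Pi1.mk γ) = Pi1.mk (γ.map continuous_subtype_val))
    (c : Pi1 (puncturedExp hφ 0 : M) →* Multiplicative ℤ) (hc : Function.Surjective c) :
    ∃ e : Pi1 (puncturedExp hφ 0) → ℤ → ZMod 2,
      (∀ v w j, e (v * w) j = e v j + e w (j + (c (i v)).toAdd)) ∧
      (∀ v, (Function.support (e v)).Finite) ∧
      ∃ j0, ∀ j, e (Pi1.mk (circleLoop hφ)) j ≠ 0 ↔ j = j0 ∨ j = j0 + 1 := by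
  have := hM.locallyPathConnectedSpace
  have : PathConnectedSpace M := pathConnectedSpace_iff_connectedSpace.2 inferInstance
  obtain ⟨u, hu, huu⟩ := exists_universal_cocycle hM (puncturedExp hφ 0 : M)
  have hg : ∀ x, CocycleAt (fun a b => c (u a b)) x := fun x => (hu x).hom c
  have hhol : ∀ γ : Path (puncturedExp hφ 0 : M) (puncturedExp hφ 0 : M),
      holPath hg γ = c (Pi1.mk γ) := fun γ => by
    rw [holPath_comp hu c, ← hol_mk, huu]
  have hhol' : ∀ γ : Path (puncturedExp hφ 0) (puncturedExp hφ 0),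
      holPath (cocycleAt_subtype hg) γ = c (i (Pi1.mk γ)) := fun γ => by
    rw [hi, ← hhol]
    exact holPath_map hg continuous_subtype_val γ
  have := Tot.t2Space hg
  have := Tot.connectedSpace hg (puncturedExp hφ 0 : M) fun a => by
    obtain ⟨b, rfl⟩ := hc a
    obtain ⟨γ, rfl⟩ := Pi1.mk_surjective b
    exact ⟨Pi1.mk γ, hhol γ⟩
  obtain ⟨s, hs0, hs⟩ := Tot.exists_lift_chart hg hφ
  obtain ⟨η, hη⟩ := exists_isDipole (Tot.planeCharts hg hM)
    (x := ⟨φ 0, 1⟩) (y := ⟨φ 0, Multiplicative.ofAdd 1⟩) fun h => by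
      have h1 : (1 : Multiplicative ℤ) = Multiplicative.ofAdd 1 := congrArg Tot.lab h
      exact absurd h1 (by decide)
  have hη' : ∀ p, CocycleAt (fun a b => η (totIncl φ _ a) (totIncl φ _ b)) p := fun p =>
    (hη.cocycleAt (totIncl φ _ p) (fun h => p.pt.2 (congrArg Tot.pt h))
      (fun h => p.pt.2 (congrArg Tot.pt h))).comp (continuous_totIncl hg)
  choose rep hrep using Pi1.mk_surjective (x := puncturedExp hφ 0)
  let E (v : Pi1 (puncturedExp hφ 0)) (j : ℤ) : ZMod 2 :=
    (liftHol (cocycleAt_subtype hg) hη' (rep v) (Multiplicative.ofAdd j)).toAdd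
  have hE : ∀ γ j, E (Pi1.mk γ) j =
      (liftHol (cocycleAt_subtype hg) hη' γ (Multiplicative.ofAdd j)).toAdd := fun γ j => by
    simp only [E]
    rw [liftHol_homotopic (cocycleAt_subtype hg) hη' (Pi1.mk_eq.1 (hrep (Pi1.mk γ)))]
  refine ⟨E, fun v w j => ?_, fun v => ?_, (s 1).toAdd, fun j => ?_⟩
  · obtain ⟨γ, rfl⟩ := Pi1.mk_surjective v
    obtain ⟨δ, rfl⟩ := Pi1.mk_surjective w
    rw [← Pi1.mk_trans, hE, hE, hE, liftHol_trans, hhol']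
    rfl
  · refine ((finite_liftHol_ne_one hg hη' hη.compact_support (rep v)).preimage
      Multiplicative.ofAdd.injective.injOn).subset fun j hj => ?_
    exact fun h => hj (congrArg Multiplicative.toAdd h)
  · have h1 := liftHol_circleLoop_eq_one_iff hg hη' hφ (Multiplicative.ofAdd j * (s 1)⁻¹) (hs _)
    rw [inv_mul_cancel_right, hs0, mul_one] at h1
    rw [hE]
    have h2 : (liftHol (cocycleAt_subtype hg) hη' (circleLoop hφ) (Multiplicative.ofAdd j)).toAdd ≠
        0 ↔ liftHol (cocycleAt_subtype hg) hη' (circleLoop hφ) (Multiplicative.ofAdd j) ≠ 1 :=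
      Iff.rfl
    rw [h2]
    constructor
    · intro h3
      by_contra! h4
      refine h3 (h1.2 (hη.cocycleAt _ (fun h => h4.1 ?_) fun h => h4.2 ?_))
      · have := congrArg Multiplicative.toAdd (mul_inv_eq_iff_eq_mul.1 (congrArg Tot.lab h))
        simpa using this
      · have := congrArg Multiplicative.toAdd (mul_inv_eq_iff_eq_mul.1 (congrArg Tot.lab h))
        simpa [add_comm] using this
    · rintro (rfl | rfl) h3
      · have := h1.1 h3
        simp only [ofAdd_toAdd, mul_inv_cancel] at this
        exact hη.left this
      · have := h1.1 h3
        rw [ofAdd_add, mul_right_comm, ofAdd_toAdd, mul_inv_cancel, one_mul] at this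
        exact hη.right this

end

theorem pointwiseInnerInner_pi1 {M : Type} [TopologicalSpace M] [T2Space M] [ConnectedSpace M]
    [SecondCountableTopology M] (hM : PlaneCharts M) (x : M) :
    ∃ x₀ : M, PointwiseInnerInner (Pi1 x₀) := by
  obtain ⟨φ, hφ, rfl⟩ := hM x
  refine ⟨(puncturedExp hφ 0 : M), ?_⟩
  have := hM.locallyCompactSpace
  have := hM.locallyPathConnectedSpace
  have : PathConnectedSpace M := pathConnectedSpace_iff_connectedSpace.2 inferInstance
  have hX := hM.of_isOpenEmbedding (isOpenEmbedding_punctured (φ 0))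
  have : LocallyCompactSpace {x : M // x ≠ φ 0} := hX.locallyCompactSpace
  have : SecondCountableTopology {x : M // x ≠ φ 0} :=
    (isOpenEmbedding_punctured (φ 0)).isEmbedding.secondCountableTopology
  have : SigmaCompactSpace {x : M // x ≠ φ 0} :=
    sigmaCompactSpace_of_locallyCompact_secondCountable
  have : SigmaCompactSpace M := sigmaCompactSpace_of_locallyCompact_secondCountable
  have := noncompactSpace_punctured hφ
  have := preconnectedSpace_punctured hφ
  have : ConnectedSpace {x : M // x ≠ φ 0} := { toNonempty := ⟨puncturedExp hφ 0⟩ }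
  have hfree := isFreeGroup_pi1 hX (puncturedExp hφ 0)
  let E : FreeGroup (IsFreeGroup.Generators (Pi1 (puncturedExp hφ 0))) ≃* Pi1 (puncturedExp hφ 0) :=
    IsFreeGroup.mulEquiv _
  obtain ⟨i, hi, him, hir, hext⟩ := exists_puncturedHom hM hφ
  refine pointwiseInnerInner_of_oneRelator (i := i.comp E.toMonoidHom)
    (r := E.symm (Pi1.mk (circleLoop hφ))) (hi.comp E.surjective) (by simpa using hir) ?_
    (fun c hc => Tot.isFreeGroup_ker hM _ c hc) ?_
  · intro L _ ψ hψ a ha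
    have := hext L (ψ.comp E.symm.toMonoidHom) (by simpa using hψ) (E a) (by simpa using ha)
    simpa using this
  · intro c hc
    obtain ⟨e, h1, h2, j0, h3⟩ := exists_windingCochain hM hφ i him c hc
    refine ⟨fun g => e (E g), fun g h j => ?_, fun g => h2 _, j0, fun j => ?_⟩
    · simpa using h1 (E g) (E h) j
    · simpa using h3 j

theorem PlaneCharts.of_homeomorph {M : Type} [TopologicalSpace M]
    (hM : ∀ x : M, ∃ U : Set M, IsOpen U ∧ x ∈ U ∧ Nonempty (U ≃ₜ (ℝ × ℝ))) :
    PlaneCharts M := by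
  intro x
  obtain ⟨U, hU, hx, ⟨e⟩⟩ := hM x
  let f : ℂ ≃ₜ U := Complex.equivRealProdCLM.toHomeomorph.trans e.symm
  let t : ℂ ≃ₜ U := (Homeomorph.addRight (f.symm ⟨x, hx⟩)).trans f
  exact ⟨fun z => (t z : M), hU.isOpenEmbedding_subtypeVal.comp t.isOpenEmbedding, by simp [t]⟩

/-- The standard parametrisation of the circle by the unit interval. -/
noncomputable def circleParam (t : I) : Circle :=
  AddCircle.homeomorphCircle (T := 1) one_ne_zero ((t : ℝ) : AddCircle (1 : ℝ))

theorem continuous_circleParam : Continuous circleParam :=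
  (Homeomorph.continuous _).comp ((AddCircle.continuous_mk' 1).comp continuous_subtype_val)

theorem circleParam_one : circleParam 1 = circleParam 0 := by
  simp [circleParam, AddCircle.coe_period]

theorem exists_circle_map {M : Type} [TopologicalSpace M] {x : M} (γ : Path x x) :
    ∃ f : Circle → M, Continuous f ∧ ∀ t, f (circleParam t) = γ t := by
  have : Fact ((0 : ℝ) < 1) := ⟨one_pos⟩
  refine ⟨fun z => AddCircle.liftIco 1 0 γ.extend
    ((AddCircle.homeomorphCircle (T := 1) one_ne_zero).symm z), ?_, fun t => ?_⟩
  · refine (AddCircle.liftIco_zero_continuous (by simp) ?_).comp (Homeomorph.continuous _)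
    exact γ.continuous_extend.continuousOn
  · simp only [circleParam, Homeomorph.symm_apply_apply]
    rcases t.2.2.lt_or_eq with h | h
    · rw [AddCircle.liftIco_zero_coe_apply ⟨t.2.1, h⟩, γ.extend_apply t.2]
    · have ht : t = 1 := Subtype.ext h
      subst ht
      have : (((1 : I) : ℝ) : AddCircle (1 : ℝ)) = ((0 : ℝ) : AddCircle (1 : ℝ)) := by
        simp [AddCircle.coe_period]
      rw [this, AddCircle.liftIco_zero_coe_apply (by simp)]
      simp

theorem homotopic_of_square {M : Type} [TopologicalSpace M] {a b c d : M} (q : I × I → M)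
    (hq : Continuous q) (p₁ : Path a b) (p₂ : Path b d) (p₃ : Path a c) (p₄ : Path c d)
    (h₁ : ∀ t, q (t, 0) = p₁ t) (h₂ : ∀ t, q (1, t) = p₂ t)
    (h₃ : ∀ t, q (0, t) = p₃ t) (h₄ : ∀ t, q (t, 1) = p₄ t) :
    (p₁.trans p₂).Homotopic (p₃.trans p₄) := by
  obtain rfl : q (0, 0) = a := by simp [h₁]
  obtain rfl : q (1, 0) = b := by simp [h₁]
  obtain rfl : q (0, 1) = c := by simp [h₃]
  obtain rfl : q (1, 1) = d := by simp [h₂]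
  let idp : Path (0 : I) 1 := ⟨⟨id, continuous_id⟩, rfl, rfl⟩
  let s₁ : Path ((0, 0) : I × I) (1, 0) := idp.prod (Path.refl 0)
  let s₂ : Path ((1, 0) : I × I) (1, 1) := (Path.refl 1).prod idp
  let s₃ : Path ((0, 0) : I × I) (0, 1) := (Path.refl 0).prod idp
  let s₄ : Path ((0, 1) : I × I) (1, 1) := idp.prod (Path.refl 1)
  have key := (SimplyConnectedSpace.paths_homotopic (s₁.trans s₂) (s₃.trans s₄)).map ⟨q, hq⟩
  have e₁ : p₁ = s₁.map hq := by ext t; exact (h₁ t).symm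
  have e₂ : p₂ = s₂.map hq := by ext t; exact (h₂ t).symm
  have e₃ : p₃ = s₃.map hq := by ext t; exact (h₃ t).symm
  have e₄ : p₄ = s₄.map hq := by ext t; exact (h₄ t).symm
  rw [e₁, e₂, e₃, e₄, ← Path.map_trans, ← Path.map_trans]
  exact key

theorem exists_path_of_freelyHomotopic {M : Type} [TopologicalSpace M] (h : M ≃ₜ M)
    (h5 : ∀ γ : Circle → M, Continuous γ → FreelyHomotopic γ fun z => h (γ z))
    {x : M} (γ : Path x x) :
    ∃ δ : Path x (h x), (γ.trans δ).Homotopic (δ.trans (γ.map h.continuous)) := by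
  obtain ⟨f, hf, hfγ⟩ := exists_circle_map γ
  obtain ⟨H, hH, hH0, hH1⟩ := h5 f hf
  have hc : Continuous fun t : I => H (circleParam 0, t) := hH.comp (by fun_prop)
  let δ : Path x (h x) := ⟨⟨fun t => H (circleParam 0, t), hc⟩, by simp [hH0, hfγ],
    by simp [hH1, hfγ]⟩
  refine ⟨δ, homotopic_of_square (fun p => H (circleParam p.1, p.2)) ?_ _ _ _ _ ?_ ?_ ?_ ?_⟩
  · exact hH.comp ((continuous_circleParam.comp continuous_fst).prodMk continuous_snd)
  · intro t; simp [hH0, hfγ]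
  · intro t; simp [circleParam_one, δ]
  · intro t; simp [δ]
  · intro t; simp [hH1, hfγ]

theorem quotient_symm_trans_cancel {M : Type} [TopologicalSpace M] {x y z : M}
    (a : Path.Homotopic.Quotient x y) (b : Path.Homotopic.Quotient y z) :
    a.symm.trans (a.trans b) = b := by
  rw [← Path.Homotopic.Quotient.trans_assoc, Path.Homotopic.Quotient.symm_trans,
    Path.Homotopic.Quotient.refl_trans]

theorem quotient_map_trans {M N : Type} [TopologicalSpace M] [TopologicalSpace N] {x y z : M}
    (a : Path.Homotopic.Quotient x y) (b : Path.Homotopic.Quotient y z) (f : C(M, N)) :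
    (a.trans b).map f = (a.map f).trans (b.map f) := by
  obtain ⟨γ, rfl⟩ := a.mk_surjective
  obtain ⟨γ', rfl⟩ := b.mk_surjective
  rw [← Path.Homotopic.Quotient.mk_trans, ← Path.Homotopic.Quotient.mk_map, Path.map_trans,
    Path.Homotopic.Quotient.mk_trans, Path.Homotopic.Quotient.mk_map,
    Path.Homotopic.Quotient.mk_map]

theorem quotient_symm_of_trans {M : Type} [TopologicalSpace M] {x y z : M}
    (a : Path.Homotopic.Quotient x y) (b : Path.Homotopic.Quotient y z) :
    (a.trans b).symm = b.symm.trans a.symm := by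
  obtain ⟨γ, rfl⟩ := a.mk_surjective
  obtain ⟨γ', rfl⟩ := b.mk_surjective
  rw [← Path.Homotopic.Quotient.mk_trans, ← Path.Homotopic.Quotient.mk_symm, Path.trans_symm,
    Path.Homotopic.Quotient.mk_trans, Path.Homotopic.Quotient.mk_symm,
    Path.Homotopic.Quotient.mk_symm]

theorem quotient_symm_symm {M : Type} [TopologicalSpace M] {x y : M}
    (a : Path.Homotopic.Quotient x y) : a.symm.symm = a := by
  obtain ⟨γ, rfl⟩ := a.mk_surjective
  rw [← Path.Homotopic.Quotient.mk_symm, ← Path.Homotopic.Quotient.mk_symm, Path.symm_symm]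

theorem conj_map_trans {M : Type} [TopologicalSpace M] (h : C(M, M)) {x : M}
    (α : Path.Homotopic.Quotient x (h x)) (a b : Path.Homotopic.Quotient x x) :
    α.trans (((a.trans b).map h).trans α.symm) =
      (α.trans ((a.map h).trans α.symm)).trans (α.trans ((b.map h).trans α.symm)) := by
  rw [quotient_map_trans]
  simp only [Path.Homotopic.Quotient.trans_assoc, quotient_symm_trans_cancel]

/-- The endomorphism of the fundamental group induced by `h`, transported along `α`. -/
noncomputable def inducedHom {M : Type} [TopologicalSpace M] (h : C(M, M)) {x : M}
    (α : Path.Homotopic.Quotient x (h x)) : Pi1 x →* Pi1 x :=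
  MonoidHom.mk' (fun a => α.trans ((Path.Homotopic.Quotient.map a h).trans α.symm))
    (conj_map_trans h α)

end SurfacePi1

open SurfacePi1 in
/-- **Proposition 2.5 ((W5) implies (W4)).** If every loop of a surface `M` is freely
homotopic to its image under a homeomorphism `h`, then `h` acts trivially on `π₁(M)`:
there are a basepoint `x₀` and a path `α` from `x₀` to `h x₀` such that the map induced
by `h` on fundamental groups is the conjugation isomorphism given by `α`. -/
theorem actsTriviallyOnPi1_of_loops_freely_homotopic
    {M : Type} [TopologicalSpace M] (hM : IsSurface M) (h : M ≃ₜ M)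
    (h5 : ∀ γ : Circle → M, Continuous γ → FreelyHomotopic γ fun z => h (γ z)) :
    ∃ (x₀ : M) (α : Path x₀ (h x₀)), ∀ γ : Path x₀ x₀,
      (γ.map h.continuous).Homotopic ((α.symm.trans γ).trans α) := by
  obtain ⟨_, _, _, hch⟩ := hM
  have hM := PlaneCharts.of_homeomorph hch
  have := hM.locallyPathConnectedSpace
  have : PathConnectedSpace M := pathConnectedSpace_iff_connectedSpace.2 inferInstance
  obtain ⟨x, hx⟩ := pointwiseInnerInner_pi1 hM (Classical.arbitrary M)
  let α : Path.Homotopic.Quotient x (h x) := .mk (PathConnectedSpace.somePath x (h x))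
  let f : C(M, M) := ⟨h, h.continuous⟩
  obtain ⟨u, hu⟩ := hx (inducedHom f α) fun a => by
    obtain ⟨γ, rfl⟩ := Pi1.mk_surjective a
    obtain ⟨δ, hδ⟩ := exists_path_of_freelyHomotopic h h5 γ
    let d : Path.Homotopic.Quotient x (h x) := .mk δ
    let c : Path.Homotopic.Quotient x x := .mk γ
    have hδ : c.trans d = d.trans (c.map f) := Path.Homotopic.Quotient.eq.2 hδ
    refine isConj_iff.2 ⟨(α.trans d.symm : Path.Homotopic.Quotient x x), ?_⟩
    change ((α.trans d.symm).trans c).trans (α.trans d.symm).symm =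
      α.trans ((c.map f).trans α.symm)
    simp only [quotient_symm_of_trans, quotient_symm_symm, Path.Homotopic.Quotient.trans_assoc]
    rw [← Path.Homotopic.Quotient.trans_assoc c, hδ, Path.Homotopic.Quotient.trans_assoc,
      quotient_symm_trans_cancel]
  obtain ⟨ω, rfl⟩ := Pi1.mk_surjective u
  refine ⟨x, ω.symm.trans (PathConnectedSpace.somePath x (h x)), fun γ => ?_⟩
  let c : Path.Homotopic.Quotient x x := .mk γ
  let w : Path.Homotopic.Quotient x x := .mk ω
  have key : α.trans ((c.map f).trans α.symm) = (w.trans c).trans w.symm := hu c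
  refine Path.Homotopic.Quotient.eq.1 ?_
  change c.map f = ((w.symm.trans α).symm.trans c).trans (w.symm.trans α)
  have := congrArg (fun p => (α.symm.trans p).trans α) key
  simpa only [quotient_symm_of_trans, quotient_symm_symm, Path.Homotopic.Quotient.trans_assoc,
    quotient_symm_trans_cancel, Path.Homotopic.Quotient.symm_trans,
    Path.Homotopic.Quotient.trans_refl] using this
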